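/- Let g : ℝ → ℂ be measurable with ∫_ℝ |g(x)|² dx < ∞. Then for Lebesgue-almost every k ∈ ℝ, the limit lim_{N→∞} ∫_{−N}^{N} g(x)·e^{ikx} dx exists (as a finite complex number). -/

import Mathlib

open Real Set MeasureTheory Filter

namespace CF
noncomputable section
open Complex (I)
open scoped ComplexConjugate

def ex (t : ℝ) : ℂ := Complex.exp ((2 * π * t : ℝ) * I)

lemma norm_ex (t : ℝ) : ‖ex t‖ = 1 := Complex.norm_exp_ofReal_mul_I _
lemma ex_add (a b : ℝ) : ex (a + b) = ex a * ex b := by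
  unfold ex; rw [← Complex.exp_add]; congr 1; push_cast; ring
lemma ex_zero : ex 0 = 1 := by simp [ex]
lemma conj_ex (t : ℝ) : conj (ex t) = ex (-t) := by
  unfold ex; rw [← Complex.exp_conj]; congr 1
  rw [map_mul, Complex.conj_ofReal, Complex.conj_I]; push_cast; ring
@[fun_prop] lemma cont_ex : Continuous ex := by unfold ex; fun_prop
lemma ex_lip (a b : ℝ) : ‖ex a - ex b‖ ≤ 2 * π * |a - b| := by
  have h : ex a - ex b = ex b * (Complex.exp (I * (2 * π * (a - b) : ℝ)) - 1) := by
    have : ex a = ex b * ex (a - b) := by rw [← ex_add]; congr 1; ring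
    have e2 : ex (a - b) = Complex.exp (I * (2 * π * (a - b) : ℝ)) := by rw [ex, mul_comm]
    rw [this, e2]; ring
  rw [h, norm_mul, norm_ex, one_mul]
  refine (Real.norm_exp_I_mul_ofReal_sub_one_le).trans ?_
  rw [Real.norm_eq_abs, abs_mul, abs_of_pos two_pi_pos]

/-- Fourier type integral. -/
def V (ν : Measure ℝ) (f : ℝ → ℂ) (x : ℝ) : ℂ := ∫ η, f η * ex (x * η) ∂ν

lemma intg_ex {ν : Measure ℝ} {f : ℝ → ℂ} (hf : Integrable f ν) {φ : ℝ → ℝ} (h : Measurable φ) :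
    Integrable (fun η => f η * ex (φ η)) ν :=
  hf.mul_bdd (c := 1) (cont_ex.measurable.comp h).aestronglyMeasurable
    (Eventually.of_forall fun _ => (norm_ex _).le)

lemma norm_V_le {ν : Measure ℝ} (f : ℝ → ℂ) (x : ℝ) : ‖V ν f x‖ ≤ ∫ η, ‖f η‖ ∂ν := by
  refine (norm_integral_le_integral_norm _).trans_eq ?_
  simp [norm_ex]

lemma cont_V {ν : Measure ℝ} {f : ℝ → ℂ} (hf : Integrable f ν) : Continuous (V ν f) := by
  refine continuous_of_dominated (bound := fun η => ‖f η‖) (fun x => ?_) (fun x => ?_) hf.norm ?_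
  · exact (intg_ex hf (by fun_prop)).aestronglyMeasurable
  · exact Eventually.of_forall fun η => by simp [norm_ex]
  · exact Eventually.of_forall fun η => by fun_prop

/-- Fubini for kernels of modulus one. -/
lemma fub {μ ν : Measure ℝ} [SFinite μ] [SFinite ν] {f b : ℝ → ℂ} (hf : Integrable f μ)
    (hb : Integrable b ν) {φ : ℝ → ℝ → ℝ} (hφ : Continuous (Function.uncurry φ)) :
    ∫ x, b x * ∫ η, f η * ex (φ x η) ∂μ ∂ν = ∫ η, f η * ∫ x, b x * ex (φ x η) ∂ν ∂μ := by
  simp_rw [← integral_const_mul]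
  rw [integral_integral_swap]
  · congr 1; ext η; congr 1; ext x; ring
  · have := (hb.mul_prod hf).mul_bdd (c := 1)
      (g := fun z : ℝ × ℝ => ex (Function.uncurry φ z))
      (cont_ex.comp hφ).aestronglyMeasurable (Eventually.of_forall fun _ => (norm_ex _).le)
    refine this.congr (Eventually.of_forall fun z => ?_)
    simp [Function.uncurry, mul_assoc]

lemma DU {μ ν : Measure ℝ} [SFinite μ] [SFinite ν] {f b : ℝ → ℂ} (hf : Integrable f μ)
    (hb : Integrable b ν) : ∫ x, b x * V μ f x ∂ν = ∫ η, f η * V ν b η ∂μ := by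
  have := fub hf hb (φ := fun x η => x * η) (by fun_prop)
  unfold V; rw [this]; simp_rw [mul_comm]

/-- CV -/
lemma CV {β G : ℝ → ℂ} (hβ : Integrable β) (hG : Integrable G) (r x : ℝ) :
    ‖V volume (fun η => V volume β (r * η) * G η) x‖ ≤ ∫ s, ‖β s‖ * ‖V volume G (x + r * s)‖ := by
  have h1 : V volume (fun η => V volume β (r * η) * G η) x
      = ∫ s, β s * V volume G (x + r * s) := by
    have := fub hG hβ (φ := fun s η => (x + r * s) * η) (by fun_prop)
    unfold V; rw [this]; congr 1; ext η
    have e : ∀ s, β s * ex ((x + r * s) * η) = β s * ex (r * η * s) * ex (x * η) := by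
      intro s; rw [mul_assoc, ← ex_add]; congr 2; ring
    simp_rw [e]; rw [integral_mul_const]; ring
  rw [h1]; refine (norm_integral_le_integral_norm _).trans_eq ?_
  simp

/-- distance weight -/
def d (k : ℤ) (z : ℝ) : ℝ := 1 + |z| / 2 ^ k

lemma p2 (k : ℤ) : (0:ℝ) < 2 ^ k := zpow_pos two_pos k
lemma one_le_d (k : ℤ) (z : ℝ) : 1 ≤ d k z := by
  unfold d; have := div_nonneg (abs_nonneg z) (p2 k).le; linarith
lemma d_pos (k : ℤ) (z : ℝ) : 0 < d k z := one_pos.trans_le (one_le_d k z)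
lemma d_sub (k : ℤ) (a b : ℝ) : d k (a + b) ≤ d k a * d k b := by
  have h := p2 k
  have h1 : |a + b| / 2 ^ k ≤ |a| / 2 ^ k + |b| / 2 ^ k := by
    rw [← add_div]; exact div_le_div_of_nonneg_right (abs_add_le a b) h.le
  have := mul_nonneg (div_nonneg (abs_nonneg a) h.le) (div_nonneg (abs_nonneg b) h.le)
  unfold d; nlinarith
lemma d_neg (k : ℤ) (z : ℝ) : d k (-z) = d k z := by simp [d]
lemma d_comm (k : ℤ) (a b : ℝ) : d k (a - b) = d k (b - a) := by rw [← d_neg, neg_sub]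
lemma d_tri (k : ℤ) (a b c : ℝ) : d k (a - c) ≤ d k (a - b) * d k (b - c) := by
  have := d_sub k (a - b) (b - c); simpa using this
lemma d_anti {k l : ℤ} (h : k ≤ l) (z : ℝ) : d l z ≤ d k z := by
  unfold d
  have := div_le_div_of_nonneg_left (abs_nonneg z) (p2 k) (zpow_le_zpow_right₀ one_le_two h)
  linarith
lemma cont_d (k : ℤ) : Continuous (d k) := by unfold d; fun_prop
@[fun_prop] lemma cont_d_comp (k : ℤ) {f : ℝ → ℝ} (h : Continuous f) :
    Continuous (fun x => d k (f x)) := (cont_d k).comp h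
/-- inverse power weight -/
def w (n : ℕ) (k : ℤ) (z : ℝ) : ℝ := (d k z ^ n)⁻¹
lemma w_pos (n k z) : 0 < w n k z := inv_pos.2 (pow_pos (d_pos k z) n)
lemma w_le_one (n k z) : w n k z ≤ 1 := inv_le_one_of_one_le₀ (one_le_pow₀ (one_le_d k z))
lemma cont_w (n k) : Continuous (w n k) := by
  unfold w; exact ((cont_d k).pow n).inv₀ fun z => (pow_pos (d_pos k z) n).ne'
@[fun_prop] lemma cont_w_comp (n k) {f : ℝ → ℝ} (h : Continuous f) :
    Continuous (fun x => w n k (f x)) := (cont_w n k).comp h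
lemma w_comm (n k) (a b : ℝ) : w n k (a - b) = w n k (b - a) := by unfold w; rw [d_comm]
lemma w_neg (n k) (a : ℝ) : w n k (-a) = w n k a := by unfold w; rw [d_neg]
lemma w_tri (n k) (a b c : ℝ) : w n k (a - b) * w n k (b - c) ≤ w n k (a - c) := by
  unfold w; rw [← mul_inv, ← mul_pow]
  exact inv_anti₀ (pow_pos (d_pos _ _) n) (pow_le_pow_left₀ (d_pos _ _).le (d_tri k a b c) n)
lemma w_add (n m k z) : w (n + m) k z = w n k z * w m k z := by unfold w; rw [pow_add, mul_inv]
lemma w_mono {k l : ℤ} (h : k ≤ l) (n z) : w n k z ≤ w n l z :=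
  inv_anti₀ (pow_pos (d_pos _ _) n) (pow_le_pow_left₀ (d_pos _ _).le (d_anti h z) n)
lemma w_anti {n m : ℕ} (h : n ≤ m) (k z) : w m k z ≤ w n k z :=
  inv_anti₀ (pow_pos (d_pos _ _) n) (pow_le_pow_right₀ (one_le_d _ _) h)
lemma w_mul_d (n k z) : w n k z * d k z ^ n = 1 :=
  inv_mul_cancel₀ (pow_pos (d_pos _ _) n).ne'
lemma w_zero_eq (n k) (z : ℝ) : w n k z = w n 0 ((2 ^ k)⁻¹ * z) := by
  simp [w, d, abs_mul, abs_of_pos (p2 k), div_eq_inv_mul]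

lemma intw0 {n : ℕ} (hn : 2 ≤ n) : Integrable (w n 0) := by
  have := integrable_one_add_norm (E := ℝ) (μ := volume) (r := n) (by simpa using by exact_mod_cast hn)
  refine this.congr (Eventually.of_forall fun z => ?_)
  simp [w, d, rpow_neg (show 0 ≤ 1 + |z| by positivity)]
lemma intw {n : ℕ} (hn : 2 ≤ n) (k : ℤ) : Integrable (w n k) := by
  have := (integrable_comp_mul_left_iff (w n 0) (R := (2 ^ k)⁻¹) (inv_ne_zero (p2 k).ne')).2 (intw0 hn)
  exact this.congr (Eventually.of_forall fun z => (w_zero_eq n k z).symm)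
lemma intw' {n : ℕ} (hn : 2 ≤ n) (k : ℤ) (c : ℝ) : Integrable (fun x => w n k (x - c)) :=
  (intw hn k).comp_sub_right c
def C0 : ℝ := ∫ z, w 2 0 z
lemma int_w (k : ℤ) (c : ℝ) : ∫ x, w 2 k (x - c) = C0 * 2 ^ k := by
  rw [integral_sub_right_eq_self (w 2 k) c]
  simp_rw [w_zero_eq 2 k]
  rw [Measure.integral_comp_mul_left, inv_inv, abs_of_pos (p2 k), smul_eq_mul, C0, mul_comm]
lemma int_w' (k : ℤ) (c : ℝ) : ∫ x, w 2 k (c - x) = C0 * 2 ^ k := by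
  simp_rw [w_comm 2 k c]; exact int_w k c
lemma C0_pos : 0 < C0 := by
  rw [C0, integral_pos_iff_support_of_nonneg (fun z => (w_pos _ _ _).le) (intw0 le_rfl)]
  have : Function.support (w 2 0) = univ := by ext z; simp [(w_pos 2 0 z).ne']
  rw [this]; simp

lemma CS {ν : Measure ℝ} {f h : ℝ → ℝ} (hf : AEStronglyMeasurable f ν) (hh : AEStronglyMeasurable h ν)
    (hf2 : Integrable (fun x => f x ^ 2) ν) (hh2 : Integrable (fun x => h x ^ 2) ν) :
    Integrable (fun x => f x * h x) ν ∧
    (∫ x, f x * h x ∂ν) ^ 2 ≤ (∫ x, f x ^ 2 ∂ν) * ∫ x, h x ^ 2 ∂ν := by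
  have hi : Integrable (fun x => f x * h x) ν := by
    refine (hf2.add hh2).mono' (hf.mul hh) (Eventually.of_forall fun x => ?_)
    rw [norm_mul, Real.norm_eq_abs, Real.norm_eq_abs]
    simp only [Pi.add_apply]
    nlinarith [sq_nonneg (|f x| - |h x|), sq_abs (f x), sq_abs (h x), sq_nonneg (f x), sq_nonneg (h x)]
  refine ⟨hi, ?_⟩
  have key : ∀ t : ℝ, 0 ≤ (∫ x, f x ^ 2 ∂ν) * (t * t) + (2 * ∫ x, f x * h x ∂ν) * t + ∫ x, h x ^ 2 ∂ν := by
    intro t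
    have : (∫ x, f x ^ 2 ∂ν) * (t * t) + (2 * ∫ x, f x * h x ∂ν) * t + ∫ x, h x ^ 2 ∂ν
        = ∫ x, (t * f x + h x) ^ 2 ∂ν := by
      have e : ∀ x, (t * f x + h x) ^ 2 = (t * t) * f x ^ 2 + (2 * t) * (f x * h x) + h x ^ 2 := by
        intro x; ring
      simp_rw [e]
      have i1 : Integrable (fun x => (t * t) * f x ^ 2 + (2 * t) * (f x * h x)) ν :=
        (hf2.const_mul _).add (hi.const_mul _)
      rw [integral_add i1 hh2,
        integral_add (hf2.const_mul _) (hi.const_mul _), integral_const_mul, integral_const_mul]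
      ring
    rw [this]; exact integral_nonneg fun x => sq_nonneg _
  have := discrim_le_zero key
  unfold discrim at this; nlinarith

/-- nice bump -/
structure Nice (α : ℝ → ℂ) (C : ℝ) : Prop where
  cont : Continuous α
  int : Integrable α
  dec : ∀ x, ‖V volume α x‖ ≤ C * w 10 0 x
  inv : ∀ u, α u = V volume (fun s => V volume α (-s)) u
  bd : ∀ u, ‖α u‖ ≤ C
  pos : 0 < C

lemma Nice.mono {α C C'} (h : Nice α C) (hC : C ≤ C') : Nice α C' :=
  ⟨h.cont, h.int, fun x => (h.dec x).trans (mul_le_mul_of_nonneg_right hC (w_pos _ _ _).le), h.inv,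
    fun u => (h.bd u).trans hC, h.pos.trans_le hC⟩

lemma V_eq_inv (f : ℝ → ℂ) (x : ℝ) : V volume f x = FourierTransformInv.fourierInv f x := by
  rw [Real.fourierInv_eq', V]; congr 1; ext v
  simp [ex, mul_comm]
lemma V_neg_eq (f : ℝ → ℂ) (x : ℝ) : V volume f (-x) = FourierTransform.fourier f x := by
  rw [Real.fourier_eq', V]; congr 1; ext v
  simp [ex, mul_comm]

lemma exists_nice {f : ℝ → ℝ} (hf : ContDiff ℝ ((⊤ : ℕ∞) : WithTop ℕ∞) f) (hs : HasCompactSupport f) :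
    ∃ C, Nice (fun x => (f x : ℂ)) C := by
  have hs' : HasCompactSupport (fun x => (f x : ℂ)) := hs.comp_left (g := fun t : ℝ => (t:ℂ)) rfl
  have hf' : ContDiff ℝ ((⊤ : ℕ∞) : WithTop ℕ∞) (fun x => (f x : ℂ)) :=
    Complex.ofRealCLM.contDiff.comp hf
  let F : SchwartzMap ℝ ℂ := hs'.toSchwartzMap hf'
  have hF : ⇑F = fun x => (f x : ℂ) := rfl
  let FF : SchwartzMap ℝ ℂ := FourierTransform.fourier F
  have hFF : ⇑FF = fun s => V volume (fun x => (f x : ℂ)) (-s) := by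
    ext s; rw [V_neg_eq, ← hF, ← SchwartzMap.fourier_coe]
  have h6 := SchwartzMap.one_add_le_sup_seminorm_apply (𝕜 := ℝ) (m := (10, 0)) (k := 10) (n := 0)
    le_rfl le_rfl FF
  set C1 := 2 ^ (10, 0).1 * (Finset.Iic (10, 0)).sup (fun m => SchwartzMap.seminorm ℝ m.1 m.2) FF
  have h0 := SchwartzMap.one_add_le_sup_seminorm_apply (𝕜 := ℝ) (m := (0, 0)) (k := 0) (n := 0)
    le_rfl le_rfl F
  set C2 := 2 ^ (0, 0).1 * (Finset.Iic (0, 0)).sup (fun m => SchwartzMap.seminorm ℝ m.1 m.2) F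
  refine ⟨max (max C1 C2) 1, hf'.continuous, F.integrable, fun x => ?_, fun u => ?_, fun u => ?_,
    lt_max_of_lt_right one_pos⟩
  · have := h6 (-x)
    rw [norm_iteratedFDeriv_zero, hFF, norm_neg] at this
    simp only [neg_neg] at this
    have hp : 0 < (1 + ‖x‖) ^ 10 := by positivity
    have : ‖V volume (fun x => (f x : ℂ)) x‖ ≤ C1 * w 10 0 x := by
      have e : w 10 0 x = ((1 + ‖x‖) ^ 10)⁻¹ := by simp [w, d]
      rw [e, ← div_eq_mul_inv, le_div_iff₀ hp, mul_comm]; exact this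
    exact this.trans (mul_le_mul_of_nonneg_right ((le_max_left _ _).trans (le_max_left _ _)) (w_pos _ _ _).le)
  · rw [V_eq_inv, ← hFF]
    have := F.continuous.fourierInv_fourier_eq F.integrable FF.integrable
    exact (congrFun this u).symm
  · have := h0 u
    rw [norm_iteratedFDeriv_zero, pow_zero, one_mul] at this
    exact this.trans ((le_max_right _ _).trans (le_max_left _ _))

lemma Nice.beta {α C} (h : Nice α C) : Continuous (fun s => V volume α (-s)) ∧
    Integrable (fun s => V volume α (-s)) ∧ ∀ s, ‖V volume α (-s)‖ ≤ C * w 10 0 s := by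
  have hc : Continuous (fun s => V volume α (-s)) := (cont_V h.int).comp continuous_neg
  have hb : ∀ s, ‖V volume α (-s)‖ ≤ C * w 10 0 s := fun s => by simpa [w_neg] using h.dec (-s)
  exact ⟨hc, ((intw0 (n := 10) (by norm_num)).const_mul C).mono' hc.aestronglyMeasurable
    (Eventually.of_forall hb), hb⟩

/-- shifting a multiplier -/
lemma V_shift {β : ℝ → ℂ} (c u : ℝ) : V volume (fun s => β s * ex (-(c * s))) u = V volume β (u - c) := by
  unfold V; congr 1; ext s; rw [mul_assoc, ← ex_add]; congr 2; ring

lemma V_scale {α C} (h : Nice α C) (k : ℤ) (c x : ℝ) :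
    ‖V volume (fun η => α (2 ^ k * η - c)) x‖ ≤ C * (2 ^ k)⁻¹ * w 10 k x := by
  have e : V volume (fun η => α (2 ^ k * η - c)) x
      = ((2 ^ k)⁻¹ : ℝ) * (ex ((2 ^ k)⁻¹ * x * c) * V volume α ((2 ^ k)⁻¹ * x)) := by
    have h1 := Measure.integral_comp_mul_left (fun u => α (u - c) * ex ((2 ^ k)⁻¹ * x * u)) (2 ^ k)
    have h2 := integral_sub_right_eq_self (fun u => α u * ex ((2 ^ k)⁻¹ * x * (u + c))) c (μ := volume)
    simp only [sub_add_cancel] at h2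
    rw [h2] at h1
    have e1 : ∀ η : ℝ, (2 ^ k)⁻¹ * x * (2 ^ k * η) = x * η := fun η => by
      field_simp
    simp only [e1] at h1
    rw [V, h1, abs_of_pos (inv_pos.2 (p2 k)), Complex.real_smul]
    congr 1
    rw [V, ← integral_const_mul]; congr 1; ext u; rw [mul_add, ex_add]; ring
  rw [e, norm_mul, norm_mul, norm_ex, one_mul, Complex.norm_real, Real.norm_eq_abs,
    abs_of_pos (inv_pos.2 (p2 k)), w_zero_eq 10 k]
  have := mul_le_mul_of_nonneg_left (h.dec ((2 ^ k)⁻¹ * x)) (inv_pos.2 (p2 k)).le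
  linarith

/-- kernel -/
def q (k : ℤ) (z : ℝ) : ℝ := (2 ^ k)⁻¹ * w 4 k z
lemma q_nonneg (k z) : 0 ≤ q k z := mul_nonneg (inv_pos.2 (p2 k)).le (w_pos _ _ _).le

lemma int_scale {α C} (h : Nice α C) (k : ℤ) (c : ℝ) : Integrable (fun η => α (2 ^ k * η - c)) :=
  (integrable_comp_mul_left_iff (fun u => α (u - c)) (p2 k).ne').2 (h.int.comp_sub_right c)

lemma PK {α C} (h : Nice α C) {k l : ℤ} (hkl : l ≤ k) (c c' x : ℝ) :
    ‖V volume (fun η => α (2 ^ l * η - c') * α (2 ^ k * η - c)) x‖ ≤ C ^ 2 * C0 * q k x := by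
  obtain ⟨b1, b2, b3⟩ := h.beta
  have hβ : Integrable (fun s => V volume α (-s) * ex (-(c' * s))) := intg_ex b2 (by fun_prop)
  have := CV hβ (int_scale h k c) (2 ^ l) x
  simp_rw [V_shift, ← h.inv] at this
  refine this.trans ?_
  have hb : ∀ s, ‖V volume α (-s) * ex (-(c' * s))‖ * ‖V volume (fun η => α (2 ^ k * η - c)) (x + 2 ^ l * s)‖
      ≤ C ^ 2 * q k x * w 2 0 s := by
    intro s
    rw [norm_mul, norm_ex, mul_one]
    have h1 := b3 s
    have h2 := V_scale h k c (x + 2 ^ l * s)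
    have h3 : w 4 k (x + 2 ^ l * s) * w 4 0 s ≤ w 4 k x := by
      have a1 : w 4 0 s ≤ w 4 k (2 ^ l * s) := by
        have : w 4 0 s = w 4 l (2 ^ l * s) := by
          rw [w_zero_eq 4 l]; congr 1; rw [← mul_assoc, inv_mul_cancel₀ (p2 l).ne', one_mul]
        rw [this]; exact w_mono hkl _ _
      have a2 := w_tri 4 k x (-(2 ^ l * s)) 0
      simp only [sub_neg_eq_add, sub_zero, w_neg] at a2
      exact (mul_le_mul_of_nonneg_left a1 (w_pos _ _ _).le).trans a2
    calc _ ≤ (C * w 10 0 s) * (C * (2 ^ k)⁻¹ * w 10 k (x + 2 ^ l * s)) :=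
          mul_le_mul h1 h2 (norm_nonneg _) (mul_nonneg h.pos.le (w_pos _ _ _).le)
      _ ≤ (C * (w 2 0 s * w 4 0 s)) * (C * (2 ^ k)⁻¹ * w 4 k (x + 2 ^ l * s)) := by
          have := w_anti (show 4 ≤ 10 by norm_num) k (x + 2 ^ l * s)
          have h4 := w_anti (show 6 ≤ 10 by norm_num) 0 s
          have h5 := w_add 2 4 0 s
          have := h.pos; have := p2 k; have := w_pos 10 k (x + 2 ^ l * s); have := w_pos 10 0 s
          have := w_pos (2 + 4) 0 s
          rw [← h5]; gcongr
      _ = C ^ 2 * (2 ^ k)⁻¹ * w 2 0 s * (w 4 k (x + 2 ^ l * s) * w 4 0 s) := by ring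
      _ ≤ C ^ 2 * (2 ^ k)⁻¹ * w 2 0 s * w 4 k x := by
          have := h.pos; have := p2 k; have := w_pos 2 0 s
          gcongr
      _ = _ := by unfold q; ring
  refine (integral_mono_of_nonneg (Eventually.of_forall fun s => by positivity)
    ((intw0 le_rfl).const_mul _) (Eventually.of_forall hb)).trans_eq ?_
  rw [integral_const_mul, C0]; ring

end
end CF


namespace CF
noncomputable section
open Complex (I)
open scoped ComplexConjugate

/-- PB, squared. -/
lemma PB2 {β G : ℝ → ℂ} {B : ℝ} (hβc : Continuous β) (hβ : ∀ s, ‖β s‖ ≤ B * w 6 0 s)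
    (hG : Integrable G) (k : ℤ) (c x : ℝ) :
    ‖V volume (fun η => V volume β (2 ^ k * η) * G η) x‖ ^ 2
      ≤ B ^ 2 * C0 * d k (x - c) ^ 10 * ((2 ^ k)⁻¹ * ∫ y, ‖V volume G y‖ ^ 2 * w 10 k (y - c)) := by
  have hk := p2 k
  have hB : 0 ≤ B := by
    have := (norm_nonneg _).trans (hβ 0)
    exact nonneg_of_mul_nonneg_left this (w_pos _ _ _)
  have hβi : Integrable β := ((intw0 (n := 6) (by norm_num)).const_mul B).mono' hβc.aestronglyMeasurable
    (Eventually.of_forall hβ)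
  have hVc := cont_V hG
  set M := ∫ η, ‖G η‖
  have hM : ∀ y, ‖V volume G y‖ ≤ M := norm_V_le G
  have h1 := CV hβi hG (2 ^ k) x
  have i0 : Integrable (fun s => w 6 0 s * ‖V volume G (x + 2 ^ k * s)‖) :=
    (intw0 (n := 6) (by norm_num)).mul_bdd (c := M) (by fun_prop)
      (Eventually.of_forall fun s => by simpa using hM _)
  have h2 : ∫ s, ‖β s‖ * ‖V volume G (x + 2 ^ k * s)‖ ≤ B * ∫ s, w 6 0 s * ‖V volume G (x + 2 ^ k * s)‖ := by
    rw [← integral_const_mul]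
    refine integral_mono_of_nonneg (Eventually.of_forall fun s => by positivity) (i0.const_mul B)
      (Eventually.of_forall fun s => ?_)
    have := mul_le_mul_of_nonneg_right (hβ s) (norm_nonneg (V volume G (x + 2 ^ k * s)))
    simp only; linarith
  have h3 : ∫ s, w 6 0 s * ‖V volume G (x + 2 ^ k * s)‖ = (2 ^ k)⁻¹ * ∫ y, w 6 k (y - x) * ‖V volume G y‖ := by
    have a := Measure.integral_comp_mul_left (fun z => w 6 k z * ‖V volume G (x + z)‖) ((2:ℝ) ^ k)
    have b := integral_sub_right_eq_self (fun z => w 6 k z * ‖V volume G (x + z)‖) x (μ := volume)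
    simp only [add_sub_cancel] at b
    rw [← b, abs_of_pos (inv_pos.2 hk), smul_eq_mul] at a
    rw [← a]; congr 1; ext s
    rw [w_zero_eq 6 k, ← mul_assoc ((2:ℝ)^k)⁻¹, inv_mul_cancel₀ hk.ne', one_mul]
  have e2 : ∀ y, (w 5 k (y - c) * ‖V volume G y‖) ^ 2 = ‖V volume G y‖ ^ 2 * w 10 k (y - c) := by
    intro y; rw [show 10 = 5 + 5 by norm_num, w_add]; ring
  have e1 : ∀ y, (w 1 k (y - x)) ^ 2 = w 2 k (y - x) := by
    intro y; rw [show 2 = 1 + 1 by norm_num, w_add]; ring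
  have i2 : Integrable (fun y => (w 5 k (y - c) * ‖V volume G y‖) ^ 2) := by
    simp_rw [e2]
    refine (intw' (n := 10) (by norm_num) k c).bdd_mul (c := M ^ 2) (by fun_prop) (Eventually.of_forall fun s => ?_)
    rw [norm_pow, norm_norm]; exact pow_le_pow_left₀ (norm_nonneg _) (hM s) 2
  obtain ⟨ci, cs⟩ := CS (ν := volume) (f := fun y => w 1 k (y - x)) (h := fun y => w 5 k (y - c) * ‖V volume G y‖)
    (by fun_prop) (by fun_prop) (by simp_rw [e1]; exact intw' le_rfl k x) i2
  simp_rw [e1, e2, int_w] at cs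
  have h4 : ∫ y, w 6 k (y - x) * ‖V volume G y‖
      ≤ d k (x - c) ^ 5 * ∫ y, w 1 k (y - x) * (w 5 k (y - c) * ‖V volume G y‖) := by
    rw [← integral_const_mul]
    refine integral_mono_of_nonneg (Eventually.of_forall fun s => ?_) (ci.const_mul _)
      (Eventually.of_forall fun y => ?_)
    · have := w_pos 6 k (s - x); positivity
    · have a : w 5 k (y - x) * w 5 k (x - c) ≤ w 5 k (y - c) := w_tri 5 k y x c
      have b : w 5 k (y - x) ≤ d k (x - c) ^ 5 * w 5 k (y - c) := by
        have := mul_le_mul_of_nonneg_left a (pow_pos (d_pos k (x - c)) 5).le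
        have e : d k (x - c) ^ 5 * (w 5 k (y - x) * w 5 k (x - c)) = w 5 k (y - x) * (w 5 k (x - c) * d k (x - c) ^ 5) := by ring
        rw [e, w_mul_d, mul_one] at this; exact this
      simp only
      rw [show 6 = 1 + 5 by norm_num, w_add]
      have := mul_le_mul_of_nonneg_left b (mul_nonneg (w_pos 1 k (y - x)).le (norm_nonneg (V volume G y)))
      nlinarith
  set X := ∫ y, w 1 k (y - x) * (w 5 k (y - c) * ‖V volume G y‖)
  set a := ∫ y, ‖V volume G y‖ ^ 2 * w 10 k (y - c)
  have h5 : ‖V volume (fun η => V volume β (2 ^ k * η) * G η) x‖ ≤ B * ((2 ^ k)⁻¹ * (d k (x - c) ^ 5 * X)) := by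
    refine h1.trans (h2.trans ?_); rw [h3]; gcongr
  calc _ ≤ (B * ((2 ^ k)⁻¹ * (d k (x - c) ^ 5 * X))) ^ 2 := pow_le_pow_left₀ (norm_nonneg _) h5 2
    _ = B ^ 2 * d k (x - c) ^ 10 * ((2 ^ k)⁻¹) ^ 2 * X ^ 2 := by ring
    _ ≤ B ^ 2 * d k (x - c) ^ 10 * ((2 ^ k)⁻¹) ^ 2 * (C0 * 2 ^ k * a) := by gcongr
    _ = _ := by field_simp

lemma PB1 {β G : ℝ → ℂ} {B σ : ℝ} (hβc : Continuous β) (hβ : ∀ s, ‖β s‖ ≤ B * w 6 0 s)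
    (hG : Integrable G) (k : ℤ) (c x : ℝ) (hσ : 0 ≤ σ)
    (ha : ∫ y, ‖V volume G y‖ ^ 2 * w 10 k (y - c) ≤ σ ^ 2 * 2 ^ k) :
    ‖V volume (fun η => V volume β (2 ^ k * η) * G η) x‖ ≤ B * √C0 * d k (x - c) ^ 5 * σ := by
  have hB : 0 ≤ B := by
    have := (norm_nonneg _).trans (hβ 0)
    exact nonneg_of_mul_nonneg_left this (w_pos _ _ _)
  have := d_pos k (x - c)
  refine le_of_sq_le_sq ((PB2 hβc hβ hG k c x).trans ?_) (by positivity)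
  have hk := p2 k
  have h := C0_pos
  have e : (B * √C0 * d k (x - c) ^ 5 * σ) ^ 2 = B ^ 2 * C0 * d k (x - c) ^ 10 * ((2 ^ k)⁻¹ * (σ ^ 2 * 2 ^ k)) := by
    rw [mul_pow, mul_pow, mul_pow, Real.sq_sqrt h.le]; field_simp
  rw [e]; gcongr

/-- multiplier coefficient for a shifted bump -/
def bsh (α : ℝ → ℂ) (c s : ℝ) : ℂ := V volume α (-s) * ex (-(c * s))
lemma bsh_spec {α C} (h : Nice α C) (c : ℝ) : Continuous (bsh α c) ∧ (∀ s, ‖bsh α c s‖ ≤ C * w 6 0 s) ∧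
    ∀ u, V volume (bsh α c) u = α (u - c) := by
  obtain ⟨b1, b2, b3⟩ := h.beta
  refine ⟨b1.mul (by fun_prop), fun s => ?_, fun u => ?_⟩
  · rw [bsh, norm_mul, norm_ex, mul_one]
    exact (b3 s).trans (mul_le_mul_of_nonneg_left (w_anti (by norm_num) _ _) h.pos.le)
  · unfold bsh; rw [V_shift, ← h.inv]

lemma V_sub {ν : Measure ℝ} {f h : ℝ → ℂ} (hf : Integrable f ν) (hh : Integrable h ν) (x : ℝ) :
    V ν (fun η => f η - h η) x = V ν f x - V ν h x := by
  unfold V; rw [← integral_sub (intg_ex hf (by fun_prop)) (intg_ex hh (by fun_prop))]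
  congr 1; ext; ring

lemma bsh2_spec {α C} (h : Nice α C) (c c' : ℝ) :
    Continuous (fun s => bsh α c s - bsh α c' s) ∧
    (∀ s, ‖bsh α c s - bsh α c' s‖ ≤ (2 * π * |c - c'| * C) * w 6 0 s) ∧
    ∀ u, V volume (fun s => bsh α c s - bsh α c' s) u = α (u - c) - α (u - c') := by
  obtain ⟨b1, b2, b3⟩ := h.beta
  obtain ⟨c1, c2, c3⟩ := bsh_spec h c
  obtain ⟨c1', c2', c3'⟩ := bsh_spec h c'
  refine ⟨c1.sub c1', fun s => ?_, fun u => ?_⟩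
  · have e : bsh α c s - bsh α c' s = V volume α (-s) * (ex (-(c * s)) - ex (-(c' * s))) := by
      unfold bsh; ring
    rw [e, norm_mul]
    have h1 : ‖ex (-(c * s)) - ex (-(c' * s))‖ ≤ 2 * π * |c - c'| * |s| := by
      refine (ex_lip _ _).trans_eq ?_
      rw [mul_assoc (2 * π), ← abs_mul, ← abs_neg]; congr 2; ring
    have h2 : w 10 0 s * |s| ≤ w 6 0 s := by
      have a := w_anti (show 7 ≤ 10 by norm_num) 0 s
      have b := w_add 6 1 0 s
      have e : w 1 0 s * |s| ≤ 1 := by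
        rw [← w_mul_d 1 0 s]; refine mul_le_mul_of_nonneg_left ?_ (w_pos _ _ _).le
        simp [d]
      calc w 10 0 s * |s| ≤ w 7 0 s * |s| := by gcongr
        _ = w 6 0 s * (w 1 0 s * |s|) := by rw [show 7 = 6 + 1 by norm_num, b]; ring
        _ ≤ _ := mul_le_of_le_one_right (w_pos _ _ _).le e
    calc _ ≤ (C * w 10 0 s) * (2 * π * |c - c'| * |s|) :=
          mul_le_mul (b3 s) h1 (norm_nonneg _) (mul_nonneg h.pos.le (w_pos _ _ _).le)
      _ = (2 * π * |c - c'| * C) * (w 10 0 s * |s|) := by ring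
      _ ≤ _ := by have := h.pos; have := pi_pos; gcongr
  · have i : ∀ c, Integrable (bsh α c) := fun c => intg_ex b2 (by fun_prop)
    rw [V_sub (i c) (i c'), c3, c3']

/-- GP: Gram pair -/
lemma GP {φ : ℝ → ℂ} {D : ℝ} {k : ℤ} (hφ : Integrable φ) (hD : ∀ z, ‖V volume φ z‖ ≤ D * q k z)
    {ν ν' : Measure ℝ} [SFinite ν] [SFinite ν'] {b b' : ℝ → ℂ} (hb : Integrable b ν) (hb' : Integrable b' ν') :
    ‖∫ η, φ η * V ν' b' η * conj (V ν b η)‖ ≤ D * ∫ y, ‖b' y‖ * ∫ x, ‖b x‖ * q k (y - x) ∂ν ∂ν' := by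
  have hVc := cont_V hb
  have hcb : Integrable (fun x => conj (b x)) ν := by
    refine hb.congr' (Complex.continuous_conj.comp_aestronglyMeasurable hb.1) (Eventually.of_forall fun x => ?_)
    simp
  have i1 : Integrable (fun η => φ η * conj (V ν b η)) :=
    hφ.mul_bdd (c := ∫ x, ‖b x‖ ∂ν) (Complex.continuous_conj.comp hVc).aestronglyMeasurable
      (Eventually.of_forall fun η => by rw [RCLike.norm_conj]; exact norm_V_le b η)
  have e1 : ∫ η, φ η * V ν' b' η * conj (V ν b η)
      = ∫ y, b' y * V volume (fun η => φ η * conj (V ν b η)) y ∂ν' := by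
    rw [DU i1 hb']; congr 1; ext η; ring
  have e2 : ∀ y, V volume (fun η => φ η * conj (V ν b η)) y = ∫ x, conj (b x) * V volume φ (y - x) ∂ν := by
    intro y
    have := fub hφ hcb (φ := fun x η => (y - x) * η) (by fun_prop)
    unfold V; rw [this]; congr 1; ext η
    simp only []
    rw [← integral_conj, mul_assoc, ← integral_mul_const]; congr 2; ext x
    rw [map_mul, conj_ex, mul_assoc, ← ex_add]; congr 2; ring
  have cq : Continuous (q k) := by unfold q; exact continuous_const.mul (cont_w 4 k)
  have bq : ∀ z, ‖q k z‖ ≤ (2 ^ k)⁻¹ := fun z => by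
    rw [Real.norm_eq_abs, abs_of_nonneg (q_nonneg k z), q]
    exact mul_le_of_le_one_right (inv_pos.2 (p2 k)).le (w_le_one _ _ _)
  have iq : ∀ y, Integrable (fun x => ‖b x‖ * q k (y - x)) ν := fun y =>
    hb.norm.mul_bdd (cq.comp (by fun_prop : Continuous fun x => y - x)).aestronglyMeasurable
      (Eventually.of_forall fun x => bq _)
  have hi : ∀ y, ‖V volume (fun η => φ η * conj (V ν b η)) y‖ ≤ D * ∫ x, ‖b x‖ * q k (y - x) ∂ν := by
    intro y; rw [e2, ← integral_const_mul]
    refine (norm_integral_le_integral_norm _).trans (integral_mono_of_nonneg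
      (Eventually.of_forall fun _ => norm_nonneg _) ((iq y).const_mul D) (Eventually.of_forall fun x => ?_))
    simp only [norm_mul, RCLike.norm_conj]
    have := mul_le_mul_of_nonneg_left (hD (y - x)) (norm_nonneg (b x)); linarith
  have cJ : Continuous (fun y => ∫ x, ‖b x‖ * q k (y - x) ∂ν) := by
    refine continuous_of_dominated (bound := fun x => ‖b x‖ * (2 ^ k)⁻¹) (fun y => (iq y).1) (fun y => ?_)
      (hb.norm.mul_const _) ?_
    · exact Eventually.of_forall fun x => by
        rw [norm_mul, norm_norm]; exact mul_le_mul_of_nonneg_left (bq _) (norm_nonneg _)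
    · exact Eventually.of_forall fun x => by fun_prop
  have bJ : ∀ y, ‖∫ x, ‖b x‖ * q k (y - x) ∂ν‖ ≤ ∫ x, ‖b x‖ * (2 ^ k)⁻¹ ∂ν := fun y => by
    refine norm_integral_le_of_norm_le (hb.norm.mul_const _) (Eventually.of_forall fun x => ?_)
    rw [norm_mul, norm_norm]; exact mul_le_mul_of_nonneg_left (bq _) (norm_nonneg _)
  rw [e1, ← integral_const_mul]
  refine (norm_integral_le_integral_norm _).trans (integral_mono_of_nonneg
      (Eventually.of_forall fun _ => norm_nonneg _) ((hb'.norm.mul_bdd cJ.aestronglyMeasurable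
        (Eventually.of_forall bJ)).const_mul D) (Eventually.of_forall fun y => ?_))
  simp only [norm_mul]
  have := mul_le_mul_of_nonneg_left (hi y) (norm_nonneg (b' y)); linarith

/-- expansion of a square -/
lemma GS {ι : Type*} (s : Finset ι) (f : ι → ℝ → ℂ)
    (hi : ∀ i ∈ s, ∀ j ∈ s, Integrable (fun x => f i x * conj (f j x))) :
    Integrable (fun x => ‖∑ i ∈ s, f i x‖ ^ 2) ∧
    ∫ x, ‖∑ i ∈ s, f i x‖ ^ 2 ≤ ∑ i ∈ s, ∑ j ∈ s, ‖∫ x, f i x * conj (f j x)‖ := by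
  have e : ∀ x, ((‖∑ i ∈ s, f i x‖ ^ 2 : ℝ) : ℂ) = ∑ i ∈ s, ∑ j ∈ s, f i x * conj (f j x) := by
    intro x; push_cast; rw [← Complex.mul_conj', map_sum, Finset.sum_mul_sum]
  have i1 : Integrable (fun x => ∑ i ∈ s, ∑ j ∈ s, f i x * conj (f j x)) :=
    integrable_finsetSum _ fun i hi' => integrable_finsetSum _ fun j hj => hi i hi' j hj
  have i2 : Integrable (fun x => ‖∑ i ∈ s, f i x‖ ^ 2) := by
    refine i1.re.congr (Eventually.of_forall fun x => ?_)
    simp only [← e]; exact RCLike.ofReal_re (K := ℂ) _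
  refine ⟨i2, ?_⟩
  have h : ((∫ x, ‖∑ i ∈ s, f i x‖ ^ 2 : ℝ) : ℂ) = ∑ i ∈ s, ∑ j ∈ s, ∫ x, f i x * conj (f j x) := by
    rw [← integral_complex_ofReal]; simp_rw [e]
    rw [integral_finsetSum _ fun i hi' => integrable_finsetSum _ fun j hj => hi i hi' j hj]
    exact Finset.sum_congr rfl fun i hi' => integral_finsetSum _ fun j hj => hi i hi' j hj
  calc _ = ‖((∫ x, ‖∑ i ∈ s, f i x‖ ^ 2 : ℝ) : ℂ)‖ := by
        rw [Complex.norm_real, Real.norm_of_nonneg (integral_nonneg fun x => by positivity)]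
    _ ≤ _ := by
        rw [h]; exact (norm_sum_le _ _).trans (Finset.sum_le_sum fun i _ => norm_sum_le _ _)

end
end CF


namespace CF
noncomputable section
open Complex (I)
open scoped ComplexConjugate Classical

def fl (k : ℤ) (x : ℝ) : ℤ := ⌊x / 2 ^ k⌋

lemma fl_iff {k n : ℤ} {x : ℝ} : fl k x = n ↔ (n:ℝ) * 2 ^ k ≤ x ∧ x < (n + 1) * 2 ^ k := by
  rw [fl, Int.floor_eq_iff, le_div_iff₀ (p2 k), div_lt_iff₀ (p2 k)]
lemma fl_neg_iff {k n : ℤ} {x : ℝ} : fl (-k) x = n ↔ (n:ℝ) ≤ 2 ^ k * x ∧ 2 ^ k * x < n + 1 := by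
  rw [fl, Int.floor_eq_iff, zpow_neg, div_inv_eq_mul, mul_comm]
lemma fl_set (k n : ℤ) : {x | fl k x = n} = Ico ((n:ℝ) * 2 ^ k) ((n + 1) * 2 ^ k) := by
  ext x; simp [fl_iff]
@[fun_prop] lemma meas_fl (k : ℤ) : Measurable (fl k) := Int.measurable_floor.comp (by fun_prop)
lemma fl_add (k : ℤ) (j : ℕ) (x : ℝ) : fl (k + j) x = fl k x / 2 ^ j := by
  have := Int.floor_div_natCast (x / 2 ^ k) (2 ^ j)
  push_cast at this
  rw [fl, fl, ← this, zpow_add₀ two_ne_zero, div_mul_eq_div_div, zpow_natCast]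
lemma fl_succ (k : ℤ) (x : ℝ) : fl (k + 1) x = fl k x / 2 := by
  have := fl_add k 1 x; simpa using this
lemma fl_mono {k l : ℤ} (h : k ≤ l) {x y : ℝ} (e : fl k x = fl k y) : fl l x = fl l y := by
  obtain ⟨j, rfl⟩ := Int.le.dest h
  rw [fl_add, fl_add, e]

abbrev Tile := ℤ × ℤ × ℤ
def tl (k : ℤ) (x ξ : ℝ) : Tile := (k, fl k x, fl (-k) ξ)
def xi (P : Tile) : ℝ := (P.2.2 + 1 / 2) / 2 ^ P.1
def cc (P : Tile) : ℝ := P.2.1 * 2 ^ P.1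
lemma fl_xi (P : Tile) : fl (-P.1) (xi P) = P.2.2 := by
  have := p2 P.1
  rw [fl_neg_iff, xi, mul_div_cancel₀ _ this.ne']; constructor <;> linarith
lemma fl_xi' (P : Tile) : fl (-(P.1 + 1)) (xi P) = 2 * P.2.2 + 1 := by
  have := p2 P.1
  rw [fl_neg_iff, xi, zpow_add_one₀ two_ne_zero, mul_right_comm, mul_div_cancel₀ _ this.ne']
  push_cast; constructor <;> linarith
lemma fl_cc (P : Tile) : fl P.1 (cc P) = P.2.1 := by
  have := p2 P.1
  rw [fl_iff, cc]; constructor <;> nlinarith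
lemma tl_self (P : Tile) : tl P.1 (cc P) (xi P) = P := by
  rw [tl, fl_cc, fl_xi]
lemma tl_mono {k l : ℤ} {x ξ x' ξ' : ℝ} (h : fl k x = fl k x') (h' : fl (-l) ξ = fl (-l) ξ')
    {j : ℤ} (h1 : k ≤ j) (h2 : j ≤ l) : tl j x ξ = tl j x' ξ' := by
  rw [tl, tl, fl_mono h1 h, fl_mono (neg_le_neg h2) h']

def le (P Q : Tile) : Prop := ∃ x ξ, P = tl P.1 x ξ ∧ Q = tl Q.1 x ξ ∧ P.1 ≤ Q.1

lemma tl_eq {x ξ : ℝ} {P : Tile} : P = tl P.1 x ξ ↔ fl P.1 x = P.2.1 ∧ fl (-P.1) ξ = P.2.2 := by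
  rcases P with ⟨a, b, c⟩; simp [tl, eq_comm]
lemma le_refl' (P : Tile) : le P P := ⟨cc P, xi P, (tl_self P).symm, (tl_self P).symm, le_rfl⟩
lemma le_tl {k l : ℤ} (h : k ≤ l) (x ξ : ℝ) : le (tl k x ξ) (tl l x ξ) := ⟨x, ξ, rfl, rfl, h⟩
lemma le_iff {P Q : Tile} {x ξ : ℝ} (hx : fl P.1 x = P.2.1) (hξ : fl (-Q.1) ξ = Q.2.2) :
    le P Q ↔ P.1 ≤ Q.1 ∧ fl Q.1 x = Q.2.1 ∧ fl (-P.1) ξ = P.2.2 := by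
  constructor
  · rintro ⟨y, ζ, h1, h2, h3⟩
    rw [tl_eq] at h1 h2
    exact ⟨h3, (fl_mono h3 (hx.trans h1.1.symm)).trans h2.1,
      (fl_mono (neg_le_neg h3) (hξ.trans h2.2.symm)).trans h1.2⟩
  · rintro ⟨h1, h2, h3⟩
    exact ⟨x, ξ, tl_eq.2 ⟨hx, h3⟩, tl_eq.2 ⟨h2, hξ⟩, h1⟩
lemma le_trans' {P Q R : Tile} (h : le P Q) (h' : le Q R) : le P R := by
  have a := (le_iff (fl_cc P) (fl_xi Q)).1 h
  have b := (le_iff (x := cc P) a.2.1 (fl_xi R)).1 h'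
  have c := (le_iff (ξ := xi R) (fl_cc P) b.2.2).1 h
  exact (le_iff (fl_cc P) (fl_xi R)).2 ⟨h.choose_spec.choose_spec.2.2.trans b.1, b.2.1, c.2.2⟩

def Cvx (S : Finset Tile) : Prop := ∀ x ξ a b c, a ≤ b → b ≤ c → tl a x ξ ∈ S → tl c x ξ ∈ S → tl b x ξ ∈ S

/-- result of a selection -/
structure Dec (f : Tile → ℝ) (Bad : Finset Tile → Tile → Prop) (S S' Tp : Finset Tile)
    (T : Tile → Finset Tile) : Prop where
  sub : S' ⊆ S
  cvx : Cvx S'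
  good : ∀ P ∈ S', ¬ Bad S' P
  Tsub : ∀ P ∈ Tp, T P ⊆ S
  Tcvx : ∀ P ∈ Tp, Cvx (T P)
  top : ∀ P ∈ Tp, P ∈ T P
  bad : ∀ P ∈ Tp, Bad (T P) P
  pw : ∀ P ∈ Tp, ∀ P' ∈ Tp, P ≠ P' → (f P ≤ f P' ∧ ∀ Q ∈ T P', ¬ le Q P) ∨ (f P' ≤ f P ∧ ∀ Q ∈ T P, ¬ le Q P')
  sum : ∀ y : Tile → ℂ, ∑ P ∈ S, y P = ∑ P ∈ S', y P + ∑ P0 ∈ Tp, ∑ P ∈ T P0 with le P P0, y P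

lemma SEL (f : Tile → ℝ) (Bad : Finset Tile → Tile → Prop)
    (hm : ∀ S T P, S ⊆ T → Bad S P → Bad T P) (S : Finset Tile) (hS : Cvx S) :
    ∃ S' Tp T, Dec f Bad S S' Tp T := by
  induction h : S.card using Nat.strong_induction_on generalizing S with
  | _ n ih =>
  by_cases hb : ∃ P ∈ S, Bad S P
  · obtain ⟨P0, hP0, hmin⟩ := Finset.exists_min_image (S.filter (Bad S)) f
      (by obtain ⟨P, a, b⟩ := hb; exact ⟨P, Finset.mem_filter.2 ⟨a, b⟩⟩)
    rw [Finset.mem_filter] at hP0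
    set S1 := S.filter (fun P => ¬ le P P0) with hS1
    have hsub : S1 ⊆ S := Finset.filter_subset _ _
    have hP1 : P0 ∉ S1 := by simp [hS1, le_refl']
    have hcard : S1.card < n := by
      rw [← h]; exact Finset.card_lt_card ⟨hsub, fun hh => hP1 (hh hP0.1)⟩
    have hc1 : Cvx S1 := by
      intro x ξ a b c hab hbc ha hc
      rw [hS1, Finset.mem_filter] at *
      exact ⟨hS x ξ a b c hab hbc ha.1 hc.1, fun hh => ha.2 (le_trans' (le_tl hab x ξ) hh)⟩
    obtain ⟨S', Tp, T, D⟩ := ih _ hcard S1 hc1 rfl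
    have hn : P0 ∉ Tp := fun hh => hP1 (D.Tsub P0 hh (D.top P0 hh))
    have hT : ∀ P ∈ Tp, Function.update T P0 S P = T P := fun P hP =>
      Function.update_of_ne (fun e : P = P0 => hn (e ▸ hP)) _ _
    have key : ∀ P ∈ Tp, f P0 ≤ f P ∧ ∀ Q ∈ T P, ¬ le Q P0 := fun P hP =>
      ⟨hmin P (Finset.mem_filter.2 ⟨hsub (D.Tsub P hP (D.top P hP)),
        hm _ _ _ ((D.Tsub P hP).trans hsub) (D.bad P hP)⟩),
        fun Q hQ => (Finset.mem_filter.1 (D.Tsub P hP hQ)).2⟩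
    refine ⟨S', insert P0 Tp, Function.update T P0 S, D.sub.trans hsub, D.cvx, D.good, ?_, ?_, ?_, ?_, ?_, ?_⟩
    · intro P hP; rcases Finset.mem_insert.1 hP with rfl | hP
      · simp
      · rw [hT P hP]; exact (D.Tsub P hP).trans hsub
    · intro P hP; rcases Finset.mem_insert.1 hP with rfl | hP
      · simpa using hS
      · rw [hT P hP]; exact D.Tcvx P hP
    · intro P hP; rcases Finset.mem_insert.1 hP with rfl | hP
      · simpa using hP0.1
      · rw [hT P hP]; exact D.top P hP
    · intro P hP; rcases Finset.mem_insert.1 hP with rfl | hP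
      · simpa using hP0.2
      · rw [hT P hP]; exact D.bad P hP
    · intro P hP P' hP' hne
      rcases Finset.mem_insert.1 hP with e | p <;> rcases Finset.mem_insert.1 hP' with e' | p'
      · exact absurd (e.trans e'.symm) hne
      · subst e; rw [hT P' p', Function.update_self]; exact Or.inl (key P' p')
      · subst e'; rw [hT P p, Function.update_self]; exact Or.inr (key P p)
      · rw [hT P p, hT P' p']; exact D.pw P p P' p' hne
    · intro y
      have e : ∑ P ∈ Tp, ∑ Q ∈ Function.update T P0 S P with le Q P, y Q = ∑ P ∈ Tp, ∑ Q ∈ T P with le Q P, y Q :=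
        Finset.sum_congr rfl fun P hP => by rw [hT P hP]
      rw [Finset.sum_insert hn, e, Function.update_self, ← Finset.sum_filter_add_sum_filter_not S (fun P => le P P0) y,
        ← hS1, D.sum y]
      ring
  · push Not at hb
    exact ⟨S, ∅, fun _ => ∅, Finset.Subset.refl _, hS, hb, by simp, by simp, by simp, by simp, by simp, by simp⟩

/-- density -/
def dn (N : ℝ → ℝ) (E : Set ℝ) (P : Tile) : ℝ := volume.real {x ∈ E | P = tl P.1 x (N x)}

lemma meas_tile {N : ℝ → ℝ} (hN : Measurable N) (P : Tile) : MeasurableSet {x | P = tl P.1 x (N x)} := by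
  have : {x | P = tl P.1 x (N x)} = {x | fl P.1 x = P.2.1} ∩ {x | fl (-P.1) (N x) = P.2.2} := by
    ext x; exact tl_eq
  rw [this]
  exact (measurableSet_eq_fun (meas_fl _) measurable_const).inter
    (measurableSet_eq_fun ((meas_fl _).comp hN) measurable_const)

lemma MASS {N : ℝ → ℝ} (hN : Measurable N) {E : Set ℝ} (hE : MeasurableSet E) (hEf : volume E ≠ ⊤)
    {μ : ℝ} {S : Finset Tile} (hS : Cvx S) :
    ∃ S' Tp T, Dec (fun P => -P.1) (fun _ P => μ * 2 ^ P.1 < dn N E P) S S' Tp T ∧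
      μ * ∑ P ∈ Tp, (2:ℝ) ^ P.1 ≤ volume.real E := by
  obtain ⟨S', Tp, T, D⟩ := SEL (fun P => -P.1) (fun _ P => μ * 2 ^ P.1 < dn N E P) (fun _ _ _ _ h => h) S hS
  refine ⟨S', Tp, T, D, ?_⟩
  have hd : (Tp : Set Tile).PairwiseDisjoint (fun P => {x ∈ E | P = tl P.1 x (N x)}) := by
    intro P hP P' hP' hne
    rw [Function.onFun, Set.disjoint_left]
    rintro x ⟨-, h1⟩ ⟨-, h2⟩
    rcases D.pw P hP P' hP' hne with ⟨h, h'⟩ | ⟨h, h'⟩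
    · exact h' P' (D.top _ hP') ⟨x, N x, h2, h1, by exact_mod_cast neg_le_neg_iff.1 h⟩
    · exact h' P (D.top _ hP) ⟨x, N x, h1, h2, by exact_mod_cast neg_le_neg_iff.1 h⟩
  calc _ = ∑ P ∈ Tp, μ * (2:ℝ) ^ P.1 := Finset.mul_sum _ _ _
    _ ≤ ∑ P ∈ Tp, dn N E P := Finset.sum_le_sum fun P hP => (D.bad P hP).le
    _ = volume.real (⋃ P ∈ Tp, {x ∈ E | P = tl P.1 x (N x)}) :=
        (measureReal_biUnion_finset hd (fun P _ => hE.inter (meas_tile hN P))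
          (fun P _ => ((measure_mono (fun x hx => hx.1)).trans_lt hEf.lt_top).ne)).symm
    _ ≤ _ := measureReal_mono (iUnion₂_subset fun P _ x hx => hx.1) hEf

end
end CF


namespace CF
noncomputable section
open Complex (I)
open scoped ComplexConjugate Classical

lemma DS {ι : Type*} (s : Finset ι) (B : ι → Set ℝ) (hB : ∀ i ∈ s, MeasurableSet (B i))
    (hd : (s : Set ι).PairwiseDisjoint B) {Ω : Set ℝ} (hf : ∀ i ∈ s, volume (B i) ≠ ⊤)
    (hs : ∀ i ∈ s, B i ⊆ Ω) {φ : ℝ → ℝ} (hφ : Integrable φ) (h0 : ∀ y, 0 ≤ φ y)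
    {v : ι → ℝ} (hv : ∀ i ∈ s, ∀ y ∈ B i, v i ≤ φ y) :
    ∑ i ∈ s, volume.real (B i) * v i ≤ ∫ y in Ω, φ y := by
  calc _ ≤ ∑ i ∈ s, ∫ y in B i, φ y := Finset.sum_le_sum fun i hi => by
        have : ∫ y in B i, v i = volume.real (B i) * v i := by simp
        rw [← this]
        exact setIntegral_mono_on (integrableOn_const (hf i hi)) hφ.integrableOn (hB i hi) (hv i hi)
    _ = ∫ y in ⋃ i ∈ s, B i, φ y := by
        rw [integral_biUnion_finset s hB hd (fun i _ => hφ.integrableOn)]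
    _ ≤ _ := setIntegral_mono_set hφ.integrableOn (Eventually.of_forall h0)
        (LE.le.eventuallyLE (iUnion₂_subset hs))

def II (P : Tile) : Set ℝ := {x | fl P.1 x = P.2.1}
lemma II_Ico (P : Tile) : II P = Ico (cc P) (cc P + 2 ^ P.1) := by
  rw [II, fl_set, cc]; congr 1; ring
lemma meas_II (P : Tile) : MeasurableSet (II P) := by rw [II_Ico]; exact measurableSet_Ico
lemma vol_II (P : Tile) : volume.real (II P) = 2 ^ P.1 := by
  rw [II_Ico, Measure.real, Real.volume_Ico]; simp [(p2 P.1).le]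
lemma II_fin (P : Tile) : volume (II P) ≠ ⊤ := by
  rw [II_Ico, Real.volume_Ico]; simp

lemma w_slow {n : ℕ} {k : ℤ} {c y : ℝ} (h : |y - c| ≤ 2 ^ k) (z : ℝ) :
    w n k (z - c) ≤ 2 ^ n * w n k (z - y) := by
  have h1 : d k (z - y) ≤ d k (z - c) * 2 := by
    refine (d_tri k z c y).trans (mul_le_mul_of_nonneg_left ?_ (d_pos _ _).le)
    rw [d_comm, d]; have := (div_le_one (p2 k)).2 h; linarith
  have a := d_pos k (z - y)
  have b := d_pos k (z - c)
  unfold w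
  rw [← div_eq_mul_inv, inv_eq_one_div, div_le_div_iff₀ (by positivity) (by positivity), one_mul, ← mul_pow]
  exact pow_le_pow_left₀ a.le (by linarith) n

lemma II_dist {P : Tile} {y : ℝ} (h : y ∈ II P) : |y - cc P| ≤ 2 ^ P.1 := by
  rw [II_Ico] at h; rw [abs_of_nonneg (by linarith [h.1])]; linarith [h.2]

/-- sums over disjoint dyadic intervals -/
lemma DSUM (s : Finset Tile) (hd : (s : Set Tile).PairwiseDisjoint II) {Ω : Set ℝ}
    (hs : ∀ P ∈ s, II P ⊆ Ω) {k : ℤ} (hk : ∀ P ∈ s, P.1 ≤ k) {n : ℕ} (hn : 2 ≤ n) (z : ℝ) :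
    ∑ P ∈ s, 2 ^ P.1 * w n k (z - cc P) ≤ 2 ^ n * ∫ y in Ω, w n k (z - y) := by
  rw [← integral_const_mul]
  have := DS s II (fun P _ => meas_II P) hd (fun P _ => II_fin P) hs (φ := fun y => 2 ^ n * w n k (z - y))
    ((by simpa [w_comm n k z] using intw' hn k z : Integrable (fun y => w n k (z - y))).const_mul _)
    (fun y => by have := w_pos n k (z - y); positivity) (v := fun P => w n k (z - cc P))
    (fun P hP y hy => w_slow ((II_dist hy).trans (zpow_le_zpow_right₀ one_le_two (hk P hP))) z)
  simpa only [vol_II] using this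

lemma intwc {n : ℕ} (hn : 2 ≤ n) (k : ℤ) (z : ℝ) : Integrable (fun y => w n k (z - y)) := by
  simpa [w_comm n k z] using intw' hn k z

lemma OUT {a b x : ℝ} (h1 : a ≤ x) (h2 : x ≤ b) (k : ℤ) :
    ∫ y in (Ico a b)ᶜ, w 4 k (x - y) ≤ C0 * 2 ^ k * (w 2 k (x - a) + w 2 k (x - b)) := by
  rw [← int_w' k x, ← integral_mul_const]
  have i1 := (intwc (n := 2) le_rfl k x).mul_const (w 2 k (x - a) + w 2 k (x - b))
  have p1 := w_pos 2 k (x - a)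
  have p2 := w_pos 2 k (x - b)
  refine (setIntegral_mono_on (intwc (by norm_num) k x).integrableOn i1.integrableOn measurableSet_Ico.compl
    fun y hy => ?_).trans (setIntegral_le_integral i1 (Eventually.of_forall fun y => ?_))
  · rw [show 4 = 2 + 2 from rfl, w_add]
    refine mul_le_mul_of_nonneg_left ?_ (w_pos _ _ _).le
    have key : ∀ u, |u| ≤ |x - y| → w 2 k (x - y) ≤ w 2 k u := fun u hu => by
      have h := CF.p2 k
      have : d k u ≤ d k (x - y) := by unfold d; gcongr
      exact inv_anti₀ (pow_pos (d_pos _ _) _) (pow_le_pow_left₀ (d_pos _ _).le this 2)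
    by_cases hy1 : y < a
    · have := key (x - a) (by rw [abs_of_nonneg (by linarith), abs_of_nonneg (by linarith)]; linarith)
      linarith
    · have hy2 : b ≤ y := by by_contra hh; exact hy ⟨not_lt.1 hy1, not_le.1 hh⟩
      have := key (x - b) (by rw [abs_of_nonpos (by linarith), abs_of_nonpos (by linarith)]; linarith)
      linarith
  · have := w_pos 2 k (x - y); positivity

lemma GEO0 (t : Finset ℤ) (k0 : ℤ) (h : ∀ k ∈ t, k ≤ k0) : ∑ k ∈ t, (2:ℝ) ^ k ≤ 2 * 2 ^ k0 := by
  have e : ∀ k ∈ t, (2:ℝ) ^ k = 2 ^ k0 * (1 / 2) ^ (k0 - k).toNat := fun k hk => by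
    have : ((k0 - k).toNat : ℤ) = k0 - k := Int.toNat_of_nonneg (by linarith [h k hk])
    rw [one_div, inv_pow, ← zpow_natCast, this, ← zpow_neg, ← zpow_add₀ two_ne_zero]; congr 1; ring
  have inj : Set.InjOn (fun k => (k0 - k).toNat) t := fun a ha b hb hab => by
    have := h a ha; have := h b hb; simp only at hab; omega
  rw [Finset.sum_congr rfl e, ← Finset.mul_sum, ← Finset.sum_image (f := fun n : ℕ => ((1:ℝ) / 2) ^ n) inj, mul_comm]
  refine mul_le_mul_of_nonneg_right ?_ (p2 k0).le
  have := summable_geometric_two.sum_le_tsum (t.image (fun k => (k0 - k).toNat)) (fun i _ => by positivity)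
  rwa [tsum_geometric_two] at this

lemma GEO1 (t : Finset ℤ) (k0 : ℤ) (h : ∀ k ∈ t, k0 ≤ k) : ∑ k ∈ t, ((2:ℝ) ^ k)⁻¹ ≤ 2 * (2 ^ k0)⁻¹ := by
  have := GEO0 (t.image Neg.neg) (-k0) (by simpa using h)
  rw [Finset.sum_image neg_injective.injOn] at this
  simpa using this

lemma GEO {ι : Type*} (s : Finset ι) (κ : ι → ℤ) (v : ι → ℝ) {M : ℝ} (hM : 0 ≤ M) (k0 : ℤ)
    (hk : ∀ i ∈ s, κ i ≤ k0) (h : ∀ k, k ≤ k0 → ∑ i ∈ s with κ i = k, v i ≤ M * 2 ^ k) :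
    ∑ i ∈ s, v i ≤ M * (2 * 2 ^ k0) := by
  rw [← Finset.sum_fiberwise_of_maps_to (t := s.image κ) (g := κ) (fun i hi => Finset.mem_image_of_mem κ hi)]
  have hk' : ∀ k ∈ s.image κ, k ≤ k0 := by simpa using hk
  calc _ ≤ ∑ k ∈ s.image κ, M * 2 ^ k := Finset.sum_le_sum fun k hk => h k (hk' k hk)
    _ = M * ∑ k ∈ s.image κ, 2 ^ k := (Finset.mul_sum _ _ _).symm
    _ ≤ _ := mul_le_mul_of_nonneg_left (GEO0 _ _ hk') hM

end
end CF


namespace CF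
noncomputable section
open Complex (I)
open scoped ComplexConjugate Classical

abbrev st := Real.smoothTransition
lemma st0 {x : ℝ} (h : x ≤ 0) : st x = 0 := Real.smoothTransition.zero_of_nonpos h
lemma st1 {x : ℝ} (h : 1 ≤ x) : st x = 1 := Real.smoothTransition.one_of_one_le h
lemma stc {f : ℝ → ℝ} (hf : ContDiff ℝ ((⊤ : ℕ∞) : WithTop ℕ∞) f) :
    ContDiff ℝ ((⊤ : ℕ∞) : WithTop ℕ∞) (fun x => st (f x)) := Real.smoothTransition.contDiff.comp hf

def thR (u : ℝ) : ℝ := st (21 * (u - 1/5)) - st (21 * (u - 1/5) - 1)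
def psR (t : ℝ) : ℝ := st ((t - 3/10) * 50) - st ((t / 2 - 3/10) * 50)
def psn (u : ℝ) : ℝ := psR (-u)
def chR (u : ℝ) : ℝ := st ((u - 1/10) * 10) * st ((2/5 - u) * 10)
def laR (u : ℝ) : ℝ := st ((u + 1/5) * 5) * st ((6/5 - u) * 5)

lemma thR_supp {u : ℝ} (h : thR u ≠ 0) : 1/5 < u ∧ u < 3/10 := by
  by_contra hh; apply h; unfold thR
  by_cases h1 : 1/5 < u
  · have h2 : 3/10 ≤ u := by by_contra h3; exact hh ⟨h1, not_le.1 h3⟩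
    rw [st1 (by linarith), st1 (by linarith)]; ring
  · rw [st0 (by linarith), st0 (by linarith)]; ring
lemma psR_supp {u : ℝ} (h : psR u ≠ 0) : 3/10 < u ∧ u < 16/25 := by
  by_contra hh; apply h; unfold psR
  by_cases h1 : 3/10 < u
  · have h2 : 16/25 ≤ u := by by_contra h3; exact hh ⟨h1, not_le.1 h3⟩
    rw [st1 (by linarith), st1 (by linarith)]; ring
  · rw [st0 (by linarith), st0 (by linarith)]; ring
lemma chR_supp {u : ℝ} (h : chR u ≠ 0) : 1/10 < u ∧ u < 2/5 := by
  unfold chR at h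
  constructor
  · by_contra hh; exact h (by rw [st0 (by linarith)]; ring)
  · by_contra hh; exact h (by rw [st0 (x := (2/5 - u) * 10) (by linarith)]; ring)
lemma chR_one {u : ℝ} (h1 : 1/5 ≤ u) (h2 : u ≤ 3/10) : chR u = 1 := by
  rw [chR, st1 (by linarith), st1 (by linarith), one_mul]
lemma laR_supp {u : ℝ} (h : laR u ≠ 0) : -(1/5) < u ∧ u < 6/5 := by
  unfold laR at h
  constructor
  · by_contra hh; exact h (by rw [st0 (by linarith)]; ring)
  · by_contra hh; exact h (by rw [st0 (x := (6/5 - u) * 5) (by linarith)]; ring)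
lemma laR_one {u : ℝ} (h1 : 0 ≤ u) (h2 : u ≤ 1) : laR u = 1 := by
  rw [laR, st1 (by linarith), st1 (by linarith), one_mul]

lemma hcs {f : ℝ → ℝ} {a b : ℝ} (h : ∀ u, f u ≠ 0 → a < u ∧ u < b) : HasCompactSupport f :=
  HasCompactSupport.intro (isCompact_Icc (a := a) (b := b)) fun x hx => by
    by_contra h'; exact hx ⟨(h x h').1.le, (h x h').2.le⟩

lemma exCB : ∃ C, Nice (fun x => (thR x : ℂ)) C ∧ Nice (fun x => (psn x : ℂ)) C ∧
    Nice (fun x => (chR x : ℂ)) C ∧ Nice (fun x => (laR x : ℂ)) C := by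
  obtain ⟨C1, h1⟩ := exists_nice (f := thR) (by unfold thR; exact (stc (by fun_prop)).sub (stc (by fun_prop)))
    (hcs fun u => thR_supp)
  obtain ⟨C2, h2⟩ := exists_nice (f := psn) (by unfold psn psR; exact (stc (by fun_prop)).sub (stc (by fun_prop)))
    (hcs (a := -(16/25)) (b := -(3/10)) fun u h => by have := psR_supp h; constructor <;> linarith)
  obtain ⟨C3, h3⟩ := exists_nice (f := chR) (by unfold chR; exact (stc (by fun_prop)).mul (stc (by fun_prop)))
    (hcs fun u => chR_supp)
  obtain ⟨C4, h4⟩ := exists_nice (f := laR) (by unfold laR; exact (stc (by fun_prop)).mul (stc (by fun_prop)))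
    (hcs fun u => laR_supp)
  have := h1.pos; have := h2.pos; have := h3.pos; have := h4.pos
  exact ⟨C1 + C2 + C3 + C4, h1.mono (by linarith), h2.mono (by linarith), h3.mono (by linarith), h4.mono (by linarith)⟩

def CB : ℝ := exCB.choose
def th (u : ℝ) : ℂ := thR u
def ps (u : ℝ) : ℂ := psn u
def ch (u : ℝ) : ℂ := chR u
def la (u : ℝ) : ℂ := laR u
lemma nth : Nice th CB := exCB.choose_spec.1
lemma nps : Nice ps CB := exCB.choose_spec.2.1
lemma nch : Nice ch CB := exCB.choose_spec.2.2.1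
lemma nla : Nice la CB := exCB.choose_spec.2.2.2
lemma CBp : 0 < CB := nth.pos
lemma th_supp {u : ℝ} (h : th u ≠ 0) : 1/5 < u ∧ u < 3/10 := thR_supp (by unfold th at h; exact_mod_cast h)
lemma conj_th (u : ℝ) : conj (th u) = th u := Complex.conj_ofReal _

lemma int_mulα {α C} (h : Nice α C) {g : ℝ → ℂ} (hg : Integrable g) {r c : ℝ} :
    Integrable (fun η => g η * α (r * η - c)) :=
  hg.mul_bdd (c := C) (h.cont.comp (by fun_prop)).aestronglyMeasurable (Eventually.of_forall fun _ => h.bd _)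

def Gt (g : ℝ → ℂ) (k : ℤ) (m : ℝ) (η : ℝ) : ℂ := g η * th (2 ^ k * η - m)
lemma int_Gt {g : ℝ → ℂ} (hg : Integrable g) (k m) : Integrable (Gt g k m) := int_mulα nth hg
/-- the coefficient function -/
def FF (g : ℝ → ℂ) (P : Tile) : ℝ → ℂ := V volume (Gt g P.1 P.2.2)
def A (g : ℝ → ℂ) (P : Tile) : ℝ := ∫ y, ‖FF g P y‖ ^ 2 * w 10 P.1 (y - cc P)
lemma A_nonneg (g P) : 0 ≤ A g P := integral_nonneg fun y => mul_nonneg (by positivity) (w_pos _ _ _).le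
lemma cont_FF {g} (hg : Integrable g) (P : Tile) : Continuous (FF g P) := cont_V (int_Gt hg _ _)
lemma bd_FF {g : ℝ → ℂ} (P : Tile) (y : ℝ) : ‖FF g P y‖ ≤ ∫ η, ‖Gt g P.1 P.2.2 η‖ := norm_V_le _ _
lemma int_A {g : ℝ → ℂ} (hg : Integrable g) (P : Tile) :
    Integrable (fun y => ‖FF g P y‖ ^ 2 * w 10 P.1 (y - cc P)) := by
  refine (intw' (n := 10) (by norm_num) _ _).bdd_mul (c := (∫ η, ‖Gt g P.1 P.2.2 η‖) ^ 2)
    ((cont_FF hg P).norm.pow 2).aestronglyMeasurable (Eventually.of_forall fun s => ?_)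
  rw [norm_pow, norm_norm]; exact pow_le_pow_left₀ (norm_nonneg _) (bd_FF P s) 2

def bP (g : ℝ → ℂ) (P : Tile) (y : ℝ) : ℂ := conj (FF g P y) * (w 10 P.1 (y - cc P) : ℝ)
lemma int_bP {g : ℝ → ℂ} (hg : Integrable g) (P : Tile) : Integrable (bP g P) := by
  refine ((intw' (n := 10) (by norm_num) _ _).ofReal (𝕜 := ℂ)).bdd_mul (c := (∫ η, ‖Gt g P.1 P.2.2 η‖))
    (Complex.continuous_conj.comp (cont_FF hg P)).aestronglyMeasurable (Eventually.of_forall fun s => ?_)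
  simpa using bd_FF P s
def fP (g : ℝ → ℂ) (P : Tile) (η : ℝ) : ℂ := th (2 ^ P.1 * η - P.2.2) * V volume (bP g P) η
lemma A_eq {g : ℝ → ℂ} (hg : Integrable g) (P : Tile) : (A g P : ℂ) = ∫ η, g η * fP g P η := by
  have := DU (int_Gt hg P.1 P.2.2) (int_bP hg P)
  have e : ∀ y, bP g P y * V volume (Gt g P.1 P.2.2) y = ((‖FF g P y‖ ^ 2 * w 10 P.1 (y - cc P) : ℝ) : ℂ) := by
    intro y; change conj (FF g P y) * _ * FF g P y = _
    push_cast; rw [← Complex.conj_mul']; ring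
  simp_rw [e] at this
  rw [integral_complex_ofReal] at this
  rw [A, this]; congr 1; ext η; unfold Gt fP; ring

def JJ (g : ℝ → ℂ) (P : Tile) : ℝ := ∫ y, w 1 P.1 (y - cc P) * (‖FF g P y‖ * w 5 P.1 (y - cc P))
lemma JJ_nonneg (g P) : 0 ≤ JJ g P := integral_nonneg fun y => by
  have := w_pos 1 P.1 (y - cc P); have := w_pos 5 P.1 (y - cc P); positivity
lemma JJ_sq {g : ℝ → ℂ} (hg : Integrable g) (P : Tile) :
    Integrable (fun y => w 1 P.1 (y - cc P) * (‖FF g P y‖ * w 5 P.1 (y - cc P))) ∧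
    JJ g P ^ 2 ≤ C0 * 2 ^ P.1 * A g P := by
  have e1 : ∀ y, w 1 P.1 (y - cc P) ^ 2 = w 2 P.1 (y - cc P) := fun y => by
    rw [show 2 = 1 + 1 by norm_num, w_add]; ring
  have e2 : ∀ y, (‖FF g P y‖ * w 5 P.1 (y - cc P)) ^ 2 = ‖FF g P y‖ ^ 2 * w 10 P.1 (y - cc P) := fun y => by
    rw [show 10 = 5 + 5 by norm_num, w_add]; ring
  have cf := cont_FF hg P
  have := CS (ν := volume) (f := fun y => w 1 P.1 (y - cc P)) (h := fun y => ‖FF g P y‖ * w 5 P.1 (y - cc P))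
    (by fun_prop) (by fun_prop) (by simp_rw [e1]; exact intw' le_rfl _ _) (by simp_rw [e2]; exact int_A hg P)
  refine ⟨this.1, ?_⟩
  have h := this.2
  simp_rw [e1, e2, int_w] at h
  exact h

def X (g : ℝ → ℂ) (P Q : Tile) : ℝ := ‖∫ η, fP g P η * conj (fP g Q η)‖
lemma X_comm (g P Q) : X g P Q = X g Q P := by
  unfold X; rw [← Complex.norm_conj, ← integral_conj]; congr 2; ext η; rw [map_mul, Complex.conj_conj, mul_comm]

lemma X_zero {g : ℝ → ℂ} {P Q : Tile} (h : ¬ ∃ η, th (2 ^ P.1 * η - P.2.2) ≠ 0 ∧ th (2 ^ Q.1 * η - Q.2.2) ≠ 0) :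
    X g P Q = 0 := by
  have : ∀ η, fP g P η * conj (fP g Q η) = 0 := fun η => by
    by_cases h1 : th (2 ^ P.1 * η - P.2.2) = 0
    · simp [fP, h1]
    · have h2 : th (2 ^ Q.1 * η - Q.2.2) = 0 := by by_contra h2; exact h ⟨η, h1, h2⟩
      simp [fP, h2]
  simp [X, this]

lemma int_th2 (k l : ℤ) (a b : ℝ) : Integrable (fun η => th (2 ^ k * η - a) * th (2 ^ l * η - b)) :=
  int_mulα nth (int_scale nth k a)

lemma int_ff {g : ℝ → ℂ} (hg : Integrable g) (P Q : Tile) : Integrable (fun η => fP g P η * conj (fP g Q η)) := by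
  have h := int_th2 P.1 Q.1 P.2.2 Q.2.2
  have c1 := cont_V (int_bP hg P)
  have c2 := cont_V (int_bP hg Q)
  have := (h.mul_bdd (c := ∫ η, ‖bP g P η‖) c1.aestronglyMeasurable (Eventually.of_forall fun η => norm_V_le _ _)).mul_bdd
    (c := ∫ η, ‖bP g Q η‖) (Complex.continuous_conj.comp c2).aestronglyMeasurable
    (Eventually.of_forall fun η => by simpa using norm_V_le _ _)
  refine this.congr (Eventually.of_forall fun η => ?_)
  simp only [fP, map_mul, conj_th, Function.comp]; ring

lemma X_bd {g : ℝ → ℂ} (hg : Integrable g) {P Q : Tile} (hk : Q.1 ≤ P.1) :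
    X g P Q ≤ CB ^ 2 * C0 * ((2 ^ P.1)⁻¹ * w 4 P.1 (cc P - cc Q)) * (JJ g P * JJ g Q) := by
  have h1 := GP (φ := fun η => th (2 ^ Q.1 * η - Q.2.2) * th (2 ^ P.1 * η - P.2.2)) (int_th2 _ _ _ _)
    (fun z => PK nth hk P.2.2 Q.2.2 z) (int_bP hg Q) (int_bP hg P)
  have e : X g P Q = ‖∫ η, th (2 ^ Q.1 * η - Q.2.2) * th (2 ^ P.1 * η - P.2.2) * V volume (bP g P) η * conj (V volume (bP g Q) η)‖ := by
    unfold X; congr 2; ext η; simp only [fP, map_mul, conj_th]; ring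
  rw [e]; refine h1.trans ?_
  have hp := p2 P.1
  have key : ∀ y x, ‖bP g P y‖ * (‖bP g Q x‖ * q P.1 (y - x)) ≤ ((2 ^ P.1)⁻¹ * w 4 P.1 (cc P - cc Q)) *
      ((w 1 P.1 (y - cc P) * (‖FF g P y‖ * w 5 P.1 (y - cc P))) * (w 1 Q.1 (x - cc Q) * (‖FF g Q x‖ * w 5 Q.1 (x - cc Q)))) := by
    intro y x
    have a1 : w 4 P.1 (y - x) * w 4 P.1 (y - cc P) * w 4 P.1 (x - cc Q) ≤ w 4 P.1 (cc P - cc Q) := by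
      rw [mul_comm (w 4 P.1 (y - x)), w_comm 4 P.1 y (cc P)]
      refine (mul_le_mul_of_nonneg_right (w_tri 4 P.1 _ _ _) (w_pos _ _ _).le).trans (w_tri _ _ _ _ _)
    have a2 : w 4 P.1 (y - x) * w 4 P.1 (y - cc P) * w 4 Q.1 (x - cc Q) ≤ w 4 P.1 (cc P - cc Q) :=
      (mul_le_mul_of_nonneg_left (w_mono hk 4 _) (mul_nonneg (w_pos _ _ _).le (w_pos _ _ _).le)).trans a1
    have n1 : ‖bP g P y‖ = ‖FF g P y‖ * (w 4 P.1 (y - cc P) * w 1 P.1 (y - cc P) * w 5 P.1 (y - cc P)) := by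
      rw [bP, norm_mul, Complex.norm_conj, Complex.norm_real, Real.norm_of_nonneg (w_pos _ _ _).le, ← w_add, ← w_add]
    have n2 : ‖bP g Q x‖ = ‖FF g Q x‖ * (w 4 Q.1 (x - cc Q) * w 1 Q.1 (x - cc Q) * w 5 Q.1 (x - cc Q)) := by
      rw [bP, norm_mul, Complex.norm_conj, Complex.norm_real, Real.norm_of_nonneg (w_pos _ _ _).le, ← w_add, ← w_add]
    rw [n1, n2, q]
    have := w_pos 1 P.1 (y - cc P); have := w_pos 5 P.1 (y - cc P)
    have := w_pos 1 Q.1 (x - cc Q); have := w_pos 5 Q.1 (x - cc Q)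
    have := mul_le_mul_of_nonneg_left a2 (show 0 ≤ (2 ^ P.1)⁻¹ * ((w 1 P.1 (y - cc P) * (‖FF g P y‖ * w 5 P.1 (y - cc P))) * (w 1 Q.1 (x - cc Q) * (‖FF g Q x‖ * w 5 Q.1 (x - cc Q)))) by positivity)
    linarith
  have iP := (JJ_sq hg P).1
  have iQ := (JJ_sq hg Q).1
  have : ∫ y, ‖bP g P y‖ * ∫ x, ‖bP g Q x‖ * q P.1 (y - x) ≤ ((2 ^ P.1)⁻¹ * w 4 P.1 (cc P - cc Q)) * (JJ g P * JJ g Q) := by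
    unfold JJ
    rw [← integral_mul_const, ← integral_const_mul]
    refine integral_mono_of_nonneg (Eventually.of_forall fun y => mul_nonneg (norm_nonneg _) (integral_nonneg fun x => mul_nonneg (norm_nonneg _) (q_nonneg _ _)))
      ((iP.mul_const _).const_mul _) (Eventually.of_forall fun y => ?_)
    simp only
    rw [← integral_const_mul, ← integral_const_mul, ← integral_const_mul]
    exact integral_mono_of_nonneg (Eventually.of_forall fun x => mul_nonneg (norm_nonneg _) (mul_nonneg (norm_nonneg _) (q_nonneg _ _)))
      ((iQ.const_mul _).const_mul _) (Eventually.of_forall fun x => key y x)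
  have c0 := C0_pos
  calc _ ≤ CB ^ 2 * C0 * (((2 ^ P.1)⁻¹ * w 4 P.1 (cc P - cc Q)) * (JJ g P * JJ g Q)) := by gcongr
    _ = _ := by ring

end
end CF


namespace CF
noncomputable section
open Complex (I)
open scoped ComplexConjugate Classical

lemma fl_half (k : ℤ) (x : ℝ) : fl (-k) x = fl (-(k + 1)) x / 2 := by
  rw [← fl_succ]; congr 1; ring
lemma fl_le (k : ℤ) {x y : ℝ} (h : x ≤ y) : fl k x ≤ fl k y := by
  unfold fl; exact Int.floor_le_floor (div_le_div_of_nonneg_right h (p2 k).le)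

lemma th_fl {k : ℤ} {m : ℤ} {η : ℝ} (h : th (2 ^ k * η - m) ≠ 0) : fl (-k) η = m ∧ fl (-(k + 1)) η = 2 * m := by
  have := th_supp h
  rw [fl_neg_iff, fl_neg_iff, zpow_add_one₀ two_ne_zero]; push_cast
  refine ⟨⟨?_, ?_⟩, ?_, ?_⟩ <;> linarith

/-- 2-tree -/
def T2 (S : Finset Tile) (P0 : Tile) : Finset Tile :=
  S.filter (fun P => le P P0 ∧ fl (-(P.1 + 1)) (xi P0) = 2 * P.2.2 + 1)
def en (g : ℝ → ℂ) (S : Finset Tile) (P0 : Tile) : ℝ := ∑ P ∈ T2 S P0, A g P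

lemma en_mono (g) {S T : Finset Tile} (h : S ⊆ T) (P) : en g S P ≤ en g T P :=
  Finset.sum_le_sum_of_subset_of_nonneg (Finset.filter_subset_filter _ h) fun i _ _ => A_nonneg g i

def ov (P Q : Tile) : Prop := ∃ η, th (2 ^ P.1 * η - P.2.2) ≠ 0 ∧ th (2 ^ Q.1 * η - Q.2.2) ≠ 0

lemma ov_fl {P Q : Tile} (h : ov P Q) (hk : Q.1 < P.1) : fl (-(Q.1 + 1)) (xi P) = 2 * Q.2.2 := by
  obtain ⟨η, h1, h2⟩ := h
  rw [← (th_fl h2).2]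
  exact fl_mono (by omega) ((fl_xi P).trans (th_fl h1).1.symm)

lemma SD {σ : ℝ} {g : ℝ → ℂ} {S S' Tp : Finset Tile} {T : Tile → Finset Tile}
    (D : Dec xi (fun S P => σ ^ 2 / 4 * 2 ^ P.1 < en g S P) S S' Tp T)
    {P0 Q0 P Q : Tile} (hP0 : P0 ∈ Tp) (hQ0 : Q0 ∈ Tp) (hP : P ∈ T2 (T P0) P0) (hQ : Q ∈ T2 (T Q0) Q0)
    (hk : Q.1 < P.1) {ζ : ℝ} (h1 : fl (-P.1) ζ = P.2.2) (h2 : fl (-(Q.1 + 1)) ζ = 2 * Q.2.2)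
    {x : ℝ} (hx : fl Q.1 x = Q.2.1) (hx0 : fl P0.1 x = P0.2.1) : False := by
  simp only [T2, Finset.mem_filter] at hP hQ
  have l1 := (le_iff (fl_cc P) (fl_xi P0)).1 hP.2.1
  have e1 : fl (-(Q.1 + 1)) (xi P0) = 2 * Q.2.2 := by
    rw [← h2]; exact fl_mono (by omega) (l1.2.2.trans h1.symm)
  have e2 : fl (-Q.1) (xi P0) = Q.2.2 := by rw [fl_half, e1]; omega
  have l2 : le Q P0 := (le_iff hx (fl_xi P0)).2 ⟨by omega, hx0, e2⟩
  by_cases he : P0 = Q0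
  · subst he; omega
  rcases D.pw P0 hP0 Q0 hQ0 he with ⟨_, h⟩ | ⟨h, _⟩
  · exact h Q hQ.1 l2
  · have := fl_le (-(Q.1 + 1)) h
    omega

lemma int_w4 (k : ℤ) (z : ℝ) (Ω : Set ℝ) : ∫ y in Ω, w 4 k (z - y) ≤ C0 * 2 ^ k := by
  rw [← int_w' k z]
  refine (setIntegral_le_integral (intwc (by norm_num) k z) (Eventually.of_forall fun y => (w_pos _ _ _).le)).trans ?_
  exact integral_mono (intwc (by norm_num) k z) (intwc le_rfl k z) fun y => w_anti (by norm_num) _ _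

lemma pd_same {s : Finset Tile} {k : ℤ} (h : ∀ P ∈ s, P.1 = k) (hm : ∀ P ∈ s, ∀ Q ∈ s, P.2.1 = Q.2.1 → P = Q) :
    (s : Set Tile).PairwiseDisjoint II := by
  intro P hP Q hQ hne
  rw [Function.onFun, Set.disjoint_left]
  intro x hx hy
  simp only [II, mem_ofPred_eq] at hx hy
  rw [h P hP] at hx; rw [h Q hQ] at hy
  exact hne (hm P hP Q hQ (hx.symm.trans hy))

/-- diagonal sums -/
lemma SZdiag {g : ℝ → ℂ} (hg : Integrable g) (W : Finset Tile) :
    ∑ P ∈ W, ∑ Q ∈ W with Q.1 = P.1, X g P Q ≤ CB ^ 2 * C0 ^ 3 * 16 * ∑ P ∈ W, A g P := by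
  have c0 := C0_pos
  have b : ∀ P Q, Q.1 = P.1 → X g P Q ≤ CB ^ 2 * C0 ^ 2 / 2 * (w 4 P.1 (cc P - cc Q) * A g P + w 4 P.1 (cc P - cc Q) * A g Q) := by
    intro P Q h
    refine (X_bd hg h.le).trans ?_
    have j1 := (JJ_sq hg P).2
    have j2 := (JJ_sq hg Q).2
    rw [h] at j2
    have hp := p2 P.1
    have hw := w_pos 4 P.1 (cc P - cc Q)
    have : JJ g P * JJ g Q ≤ C0 * 2 ^ P.1 * (A g P + A g Q) / 2 := by nlinarith [sq_nonneg (JJ g P - JJ g Q)]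
    calc _ ≤ CB ^ 2 * C0 * ((2 ^ P.1)⁻¹ * w 4 P.1 (cc P - cc Q)) * (C0 * 2 ^ P.1 * (A g P + A g Q) / 2) := by gcongr
      _ = _ := by field_simp
  have eq1 : ∀ P ∈ W, ∑ Q ∈ W with Q.1 = P.1, X g P Q = ∑ Q ∈ W with Q.1 = P.1 ∧ Q.2.2 = P.2.2, X g P Q := by
    intro P _
    rw [← Finset.filter_filter]
    symm; apply Finset.sum_filter_of_ne
    intro Q hQ hX
    by_contra hm
    apply hX; apply X_zero
    rintro ⟨η, h1, h2⟩
    have a := (th_fl h1).1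
    have b := (th_fl h2).1
    rw [(Finset.mem_filter.1 hQ).2] at b
    exact hm (b.symm.trans a)
  have sw : ∀ P, ∑ Q ∈ W with Q.1 = P.1 ∧ Q.2.2 = P.2.2, w 4 P.1 (cc P - cc Q) ≤ 16 * C0 := by
    intro P
    have := DSUM (W.filter (fun Q => Q.1 = P.1 ∧ Q.2.2 = P.2.2)) (pd_same (k := P.1) (fun Q hQ => (Finset.mem_filter.1 hQ).2.1) (by
      intro A hA B hB h
      simp only [Finset.mem_filter] at hA hB
      exact Prod.ext (hA.2.1.trans hB.2.1.symm) (Prod.ext h (hA.2.2.trans hB.2.2.symm)))) (Ω := univ) (by simp) (k := P.1)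
      (by intro Q hQ; exact (Finset.mem_filter.1 hQ).2.1.le) (n := 4) (by norm_num) (cc P)
    have h2 := int_w4 P.1 (cc P) univ
    have e : ∑ Q ∈ W with Q.1 = P.1 ∧ Q.2.2 = P.2.2, 2 ^ Q.1 * w 4 P.1 (cc P - cc Q)
        = 2 ^ P.1 * ∑ Q ∈ W with Q.1 = P.1 ∧ Q.2.2 = P.2.2, w 4 P.1 (cc P - cc Q) := by
      rw [Finset.mul_sum]; refine Finset.sum_congr rfl fun Q hQ => by rw [(Finset.mem_filter.1 hQ).2.1]
    rw [e] at this
    have hp := p2 P.1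
    refine le_of_mul_le_mul_left ?_ hp
    nlinarith
  rw [Finset.sum_congr rfl eq1]
  have s1 : ∑ P ∈ W, ∑ Q ∈ W with Q.1 = P.1 ∧ Q.2.2 = P.2.2, w 4 P.1 (cc P - cc Q) * A g P ≤ 16 * C0 * ∑ P ∈ W, A g P := by
    rw [Finset.mul_sum]; refine Finset.sum_le_sum fun P _ => ?_
    rw [← Finset.sum_mul]; exact mul_le_mul_of_nonneg_right (sw P) (A_nonneg g P)
  have s2 : ∑ P ∈ W, ∑ Q ∈ W with Q.1 = P.1 ∧ Q.2.2 = P.2.2, w 4 P.1 (cc P - cc Q) * A g Q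
      = ∑ P ∈ W, ∑ Q ∈ W with Q.1 = P.1 ∧ Q.2.2 = P.2.2, w 4 P.1 (cc P - cc Q) * A g P := by
    simp_rw [Finset.sum_filter]
    rw [Finset.sum_comm]
    refine Finset.sum_congr rfl fun P _ => Finset.sum_congr rfl fun Q _ => ?_
    by_cases h : Q.1 = P.1 ∧ Q.2.2 = P.2.2
    · rw [if_pos h, if_pos ⟨h.1.symm, h.2.symm⟩, w_comm, h.1]
    · rw [if_neg h, if_neg (fun h' => h ⟨h'.1.symm, h'.2.symm⟩)]
  calc _ ≤ ∑ P ∈ W, ∑ Q ∈ W with Q.1 = P.1 ∧ Q.2.2 = P.2.2, CB ^ 2 * C0 ^ 2 / 2 * (w 4 P.1 (cc P - cc Q) * A g P + w 4 P.1 (cc P - cc Q) * A g Q) :=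
        Finset.sum_le_sum fun P _ => Finset.sum_le_sum fun Q hQ => b P Q (Finset.mem_filter.1 hQ).2.1
    _ = CB ^ 2 * C0 ^ 2 / 2 * (∑ P ∈ W, ∑ Q ∈ W with Q.1 = P.1 ∧ Q.2.2 = P.2.2, w 4 P.1 (cc P - cc Q) * A g P + ∑ P ∈ W, ∑ Q ∈ W with Q.1 = P.1 ∧ Q.2.2 = P.2.2, w 4 P.1 (cc P - cc Q) * A g Q) := by
        simp_rw [← Finset.mul_sum, Finset.sum_add_distrib]
    _ ≤ CB ^ 2 * C0 ^ 2 / 2 * (16 * C0 * ∑ P ∈ W, A g P + 16 * C0 * ∑ P ∈ W, A g P) := by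
        rw [s2]; gcongr
    _ = _ := by ring

lemma X_off {g : ℝ → ℂ} (hg : Integrable g) {σ : ℝ} (hσ : 0 ≤ σ) {P Q : Tile} (hk : Q.1 ≤ P.1)
    (h1 : A g P ≤ σ ^ 2 * 2 ^ P.1) (h2 : A g Q ≤ σ ^ 2 * 2 ^ Q.1) :
    X g P Q ≤ CB ^ 2 * C0 ^ 2 * σ ^ 2 * (2 ^ Q.1 * w 4 P.1 (cc P - cc Q)) := by
  have c0 := C0_pos
  refine (X_bd hg hk).trans ?_
  have b : ∀ R : Tile, A g R ≤ σ ^ 2 * 2 ^ R.1 → JJ g R ≤ √C0 * σ * 2 ^ R.1 := fun R h => by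
    have := p2 R.1
    refine le_of_sq_le_sq (((JJ_sq hg R).2).trans ?_) (by positivity)
    rw [mul_pow, mul_pow, Real.sq_sqrt c0.le]
    calc C0 * 2 ^ R.1 * A g R ≤ C0 * 2 ^ R.1 * (σ ^ 2 * 2 ^ R.1) := by gcongr
      _ = _ := by ring
  have hp := p2 P.1
  have hq := p2 Q.1
  have hw := w_pos 4 P.1 (cc P - cc Q)
  have j1 := JJ_nonneg g P
  have j2 := JJ_nonneg g Q
  have s := Real.mul_self_sqrt c0.le
  calc _ ≤ CB ^ 2 * C0 * ((2 ^ P.1)⁻¹ * w 4 P.1 (cc P - cc Q)) * ((√C0 * σ * 2 ^ P.1) * (√C0 * σ * 2 ^ Q.1)) := by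
        gcongr; exacts [b P h1, b Q h2]
    _ = CB ^ 2 * C0 * (√C0 * √C0) * σ ^ 2 * (2 ^ Q.1 * w 4 P.1 (cc P - cc Q)) := by field_simp
    _ = _ := by rw [s]; ring

lemma II_sub {P P0 : Tile} (h : le P P0) : II P ⊆ II P0 := fun x hx => ((le_iff hx (fl_xi P0)).1 h).2.1

/-- off-diagonal sums for one tree -/
lemma SZoff {σ : ℝ} {g : ℝ → ℂ} {S S' Tp : Finset Tile} {T : Tile → Finset Tile}
    (D : Dec xi (fun S P => σ ^ 2 / 4 * 2 ^ P.1 < en g S P) S S' Tp T) {P0 : Tile} (hP0 : P0 ∈ Tp) :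
    ∑ P ∈ T2 (T P0) P0, ∑ Q ∈ Tp.biUnion (fun P0 => T2 (T P0) P0) with Q.1 < P.1 ∧ ov P Q, 2 ^ Q.1 * w 4 P.1 (cc P - cc Q)
      ≤ 128 * C0 ^ 2 * (2 * 2 ^ P0.1) := by
  have c0 := C0_pos
  set W := Tp.biUnion (fun P0 => T2 (T P0) P0) with hW
  set a := cc P0
  set b := cc P0 + 2 ^ P0.1 with hb
  have h1 : ∀ P ∈ T2 (T P0) P0, ∑ Q ∈ W with Q.1 < P.1 ∧ ov P Q, 2 ^ Q.1 * w 4 P.1 (cc P - cc Q)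
      ≤ 16 * C0 * (2 ^ P.1 * w 2 P.1 (a - cc P) + 2 ^ P.1 * w 2 P.1 (b - cc P)) := by
    intro P hP
    have hP' := (Finset.mem_filter.1 hP)
    have hc : cc P ∈ II P0 := II_sub hP'.2.1 (fl_cc P)
    have hds := DSUM (W.filter (fun Q => Q.1 < P.1 ∧ ov P Q)) (by
      have key : ∀ Q ∈ W.filter (fun Q => Q.1 < P.1 ∧ ov P Q), ∀ Q' ∈ W.filter (fun Q => Q.1 < P.1 ∧ ov P Q),
          Q ≠ Q' → Q.1 ≤ Q'.1 → ∀ x, fl Q.1 x = Q.2.1 → fl Q'.1 x = Q'.2.1 → False := by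
        intro Q hQ Q' hQ' hne hk x hx hx'
        simp only [Finset.mem_filter, hW, Finset.mem_biUnion] at hQ hQ'
        obtain ⟨⟨Q0, hQ0, hQ⟩, hQk, hQo⟩ := hQ
        obtain ⟨⟨Q0', hQ0', hQ'⟩, hQk', hQo'⟩ := hQ'
        have z := ov_fl hQo hQk
        have z' := ov_fl hQo' hQk'
        have y' : fl (-Q'.1) (xi P) = Q'.2.2 := by rw [fl_half, z']; omega
        have y : fl (-Q.1) (xi P) = Q.2.2 := by rw [fl_half, z]; omega
        rcases hk.lt_or_eq with hlt | heq
        · exact SD D hQ0' hQ0 hQ' hQ hlt y' z hx (II_sub (Finset.mem_filter.1 hQ').2.1 hx')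
        · apply hne
          rw [heq] at hx y
          exact Prod.ext heq (Prod.ext (hx.symm.trans hx') (y.symm.trans y'))
      intro Q hQ Q' hQ' hne
      rw [Function.onFun, Set.disjoint_left]
      intro x hx hx'
      rcases le_total Q.1 Q'.1 with h | h
      · exact key Q hQ Q' hQ' hne h x hx hx'
      · exact key Q' hQ' Q hQ hne.symm h x hx' hx) (Ω := (II P0)ᶜ) (by
      intro Q hQ x hx hx0
      simp only [Finset.mem_filter, hW, Finset.mem_biUnion] at hQ
      obtain ⟨⟨Q0, hQ0, hQ⟩, hQk, hQo⟩ := hQ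
      exact SD D hP0 hQ0 hP hQ hQk (fl_xi P) (ov_fl hQo hQk) hx hx0) (k := P.1) (by
      intro Q hQ; exact (Finset.mem_filter.1 hQ).2.1.le) (n := 4) (by norm_num) (cc P)
    rw [II_Ico] at hds hc
    have := OUT hc.1 hc.2.le P.1
    rw [w_comm 2 P.1 (cc P), w_comm 2 P.1 (cc P)] at this
    refine hds.trans ?_
    calc _ ≤ 2 ^ 4 * (C0 * 2 ^ P.1 * (w 2 P.1 (a - cc P) + w 2 P.1 (b - cc P))) := by gcongr
      _ = _ := by ring
  refine (Finset.sum_le_sum h1).trans ?_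
  refine GEO _ (fun P => P.1) _ (by positivity) _ (fun P hP => ((le_iff (fl_cc P) (fl_xi P0)).1 (Finset.mem_filter.1 hP).2.1).1) fun k _ => ?_
  have h2 : ∀ z, ∑ P ∈ T2 (T P0) P0 with P.1 = k, 2 ^ P.1 * w 2 P.1 (z - cc P) ≤ 4 * (C0 * 2 ^ k) := by
    intro z
    have hh := DSUM ((T2 (T P0) P0).filter (fun P => P.1 = k)) (pd_same (k := k) (by simp) (by
      intro P hP Q hQ h
      simp only [Finset.mem_filter] at hP hQ
      have e1 := ((le_iff (fl_cc P) (fl_xi P0)).1 (Finset.mem_filter.1 hP.1).2.1).2.2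
      have e2 := ((le_iff (fl_cc Q) (fl_xi P0)).1 (Finset.mem_filter.1 hQ.1).2.1).2.2
      rw [hP.2] at e1; rw [hQ.2] at e2
      exact Prod.ext (hP.2.trans hQ.2.symm) (Prod.ext h (e1.symm.trans e2)))) (Ω := univ) (by simp) (k := k)
      (by intro Q hQ; exact (Finset.mem_filter.1 hQ).2.le) (n := 2) le_rfl z
    rw [setIntegral_univ, int_w'] at hh
    refine le_trans (le_of_eq (Finset.sum_congr rfl fun P hP => ?_)) (hh.trans (by norm_num))
    rw [(Finset.mem_filter.1 hP).2]
  rw [← Finset.mul_sum, Finset.sum_add_distrib]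
  calc _ ≤ 16 * C0 * (4 * (C0 * 2 ^ k) + 4 * (C0 * 2 ^ k)) := by gcongr <;> exact h2 _
    _ = _ := by ring

def CS1 : ℝ := CB ^ 2 * C0 ^ 3 * 16 + 2 * (CB ^ 2 * C0 ^ 2) * (256 * C0 ^ 2) * 4
lemma CS1p : 0 < CS1 := by have := C0_pos; have := CBp; unfold CS1; positivity

lemma SIZE {σ : ℝ} (hσ : 0 ≤ σ) {g : ℝ → ℂ} (hg : Integrable g) (hg2 : Integrable (fun x => ‖g x‖ ^ 2))
    {S : Finset Tile} (hS : Cvx S) (hA : ∀ P ∈ S, A g P ≤ σ ^ 2 * 2 ^ P.1) :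
    ∃ S' Tp T, Dec xi (fun S P => σ ^ 2 / 4 * 2 ^ P.1 < en g S P) S S' Tp T ∧
      σ ^ 2 * ∑ P ∈ Tp, (2:ℝ) ^ P.1 ≤ 4 * CS1 * ∫ x, ‖g x‖ ^ 2 := by
  obtain ⟨S', Tp, T, D⟩ := SEL xi (fun S P => σ ^ 2 / 4 * 2 ^ P.1 < en g S P)
    (fun S T P h h' => h'.trans_le (en_mono g h P)) S hS
  refine ⟨S', Tp, T, D, ?_⟩
  have c0 := C0_pos
  set W := Tp.biUnion (fun P0 => T2 (T P0) P0) with hW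
  have hd : (Tp : Set Tile).PairwiseDisjoint (fun P0 => T2 (T P0) P0) := by
    intro P hP P' hP' hne
    rw [Function.onFun, Finset.disjoint_left]
    intro R h1 h2
    simp only [T2, Finset.mem_filter] at h1 h2
    rcases D.pw P hP P' hP' hne with ⟨_, h⟩ | ⟨_, h⟩
    · exact h R h2.1 h1.2.1
    · exact h R h1.1 h2.2.1
  set a := ∑ P ∈ W, A g P with ha
  have ha0 : 0 ≤ a := Finset.sum_nonneg fun P _ => A_nonneg g P
  have hbad : σ ^ 2 * ∑ P ∈ Tp, (2:ℝ) ^ P.1 ≤ 4 * a := by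
    rw [ha, hW, Finset.sum_biUnion hd, Finset.mul_sum, Finset.mul_sum]
    refine Finset.sum_le_sum fun P hP => ?_
    have := D.bad P hP
    unfold en at this; linarith
  have hWA : ∀ P ∈ W, A g P ≤ σ ^ 2 * 2 ^ P.1 := by
    intro P hP
    obtain ⟨P0, h0, h⟩ := Finset.mem_biUnion.1 hP
    exact hA P (D.Tsub P0 h0 (Finset.mem_filter.1 h).1)
  obtain ⟨gi, gs⟩ := GS W (fP g) (fun P _ Q _ => int_ff hg P Q)
  have split : ∑ P ∈ W, ∑ Q ∈ W, X g P Q = ∑ P ∈ W, ∑ Q ∈ W with Q.1 = P.1, X g P Q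
      + 2 * ∑ P ∈ W, ∑ Q ∈ W with Q.1 < P.1, X g P Q := by
    have e : ∑ P ∈ W, ∑ Q ∈ W with P.1 < Q.1, X g P Q = ∑ P ∈ W, ∑ Q ∈ W with Q.1 < P.1, X g P Q := by
      simp_rw [Finset.sum_filter]; rw [Finset.sum_comm]; simp_rw [X_comm g]
    rw [two_mul]; nth_rewrite 2 [← e]
    rw [← Finset.sum_add_distrib, ← Finset.sum_add_distrib]
    refine Finset.sum_congr rfl fun P _ => ?_
    simp_rw [Finset.sum_filter, ← Finset.sum_add_distrib]
    refine Finset.sum_congr rfl fun Q _ => ?_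
    rcases lt_trichotomy P.1 Q.1 with h | h | h
    · simp [h, h.ne', h.not_gt]
    · simp [h]
    · simp [h, h.ne, h.not_gt]
  have off : ∑ P ∈ W, ∑ Q ∈ W with Q.1 < P.1, X g P Q ≤ CB ^ 2 * C0 ^ 2 * (256 * C0 ^ 2) * (4 * a) := by
    have e1 : ∀ P ∈ W, ∑ Q ∈ W with Q.1 < P.1, X g P Q ≤ CB ^ 2 * C0 ^ 2 * σ ^ 2 * ∑ Q ∈ W with Q.1 < P.1 ∧ ov P Q, 2 ^ Q.1 * w 4 P.1 (cc P - cc Q) := by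
      intro P hP
      have : ∑ Q ∈ W with Q.1 < P.1, X g P Q = ∑ Q ∈ W with Q.1 < P.1 ∧ ov P Q, X g P Q := by
        rw [← Finset.filter_filter]; symm; apply Finset.sum_filter_of_ne
        intro Q _ hX; by_contra h; exact hX (X_zero h)
      rw [this, Finset.mul_sum]
      refine Finset.sum_le_sum fun Q hQ => ?_
      simp only [Finset.mem_filter] at hQ
      exact X_off hg hσ hQ.2.1.le (hWA P hP) (hWA Q hQ.1)
    refine (Finset.sum_le_sum e1).trans ?_
    rw [← Finset.mul_sum]
    nth_rewrite 1 [hW]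
    rw [Finset.sum_biUnion hd]
    calc _ ≤ CB ^ 2 * C0 ^ 2 * σ ^ 2 * ∑ P0 ∈ Tp, 128 * C0 ^ 2 * (2 * 2 ^ P0.1) := by
          gcongr with P0 hP0; exact SZoff D hP0
      _ = CB ^ 2 * C0 ^ 2 * (256 * C0 ^ 2) * (σ ^ 2 * ∑ P0 ∈ Tp, 2 ^ P0.1) := by
          rw [← Finset.mul_sum, ← Finset.mul_sum]; ring
      _ ≤ _ := by gcongr
  have tot : ∫ η, ‖∑ P ∈ W, fP g P η‖ ^ 2 ≤ CS1 * a := by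
    refine gs.trans ?_
    change ∑ P ∈ W, ∑ Q ∈ W, X g P Q ≤ _
    rw [split]
    have := SZdiag hg W
    unfold CS1; linarith
  have hcf : ∀ P, Continuous (fP g P) := fun P => (nth.cont.comp (by fun_prop)).mul (cont_V (int_bP hg P))
  have hcH : Continuous (fun η => ∑ P ∈ W, fP g P η) := continuous_finsetSum _ fun P _ => hcf P
  have hib : ∀ P ∈ W, Integrable (fun η => g η * fP g P η) := fun P _ =>
    hg.mul_bdd (c := CB * ∫ y, ‖bP g P y‖) (hcf P).aestronglyMeasurable (Eventually.of_forall fun η => by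
      rw [fP, norm_mul]; exact mul_le_mul (nth.bd _) (norm_V_le _ _) (norm_nonneg _) CBp.le)
  have ea : (a : ℂ) = ∫ η, g η * ∑ P ∈ W, fP g P η := by
    simp_rw [Finset.mul_sum]
    rw [integral_finsetSum _ hib, ha]; push_cast
    exact Finset.sum_congr rfl fun P _ => A_eq hg P
  obtain ⟨-, cs⟩ := CS (ν := volume) (f := fun η => ‖g η‖) (h := fun η => ‖∑ P ∈ W, fP g P η‖) hg.1.norm
    hcH.norm.aestronglyMeasurable hg2 gi
  have ea2 : a ≤ ∫ η, ‖g η‖ * ‖∑ P ∈ W, fP g P η‖ := by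
    have : a = ‖(a:ℂ)‖ := by rw [Complex.norm_real, Real.norm_of_nonneg ha0]
    rw [this, ea]
    refine (norm_integral_le_integral_norm _).trans (le_of_eq ?_)
    congr 1; ext η; rw [norm_mul]
  have hg0 : 0 ≤ ∫ x, ‖g x‖ ^ 2 := integral_nonneg fun x => by positivity
  have fin : a * a ≤ a * (CS1 * ∫ x, ‖g x‖ ^ 2) := by
    have := pow_le_pow_left₀ ha0 ea2 2
    have := mul_le_mul_of_nonneg_left tot hg0
    nlinarith
  have c1 := CS1p
  rcases ha0.eq_or_lt with h | h
  · rw [← h, mul_zero] at hbad; refine hbad.trans ?_; positivity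
  · have := le_of_mul_le_mul_left fin h
    linarith

end
end CF


namespace CF
noncomputable section
open Complex (I)
open scoped ComplexConjugate Classical

section
variable {S : Finset Tile} {P0 : Tile}

lemma tl_top {y : ℝ} (h : y ∈ II P0) : tl P0.1 y (xi P0) = P0 := (tl_eq.2 ⟨h, fl_xi P0⟩).symm
lemma up (hS : Cvx S) (hP0 : P0 ∈ S) {y : ℝ} (h : y ∈ II P0) {a b : ℤ} (hab : a ≤ b) (hb : b ≤ P0.1)
    (ha : tl a y (xi P0) ∈ S) : tl b y (xi P0) ∈ S :=
  hS y (xi P0) a b P0.1 hab hb ha ((tl_top h).symm ▸ hP0)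

/-- gaps -/
def gp (S : Finset Tile) (P0 J : Tile) : Prop :=
  J ∉ S ∧ tl J.1 (cc J) (xi P0) = J ∧ tl (J.1 + 1) (cc J) (xi P0) ∈ S ∧ J.1 < P0.1 ∧ cc J ∈ II P0

lemma gp_at {J : Tile} (h : gp S P0 J) {y : ℝ} (hy : y ∈ II J) :
    tl J.1 y (xi P0) = J ∧ tl (J.1 + 1) y (xi P0) ∈ S ∧ y ∈ II P0 := by
  obtain ⟨_, h2, h3, h4, h5⟩ := h
  have e : fl J.1 y = fl J.1 (cc J) := Eq.trans hy (fl_cc J).symm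
  refine ⟨?_, ?_, ?_⟩
  · rw [← h2]; simp only [tl]; rw [e]
  · simp only [tl] at h3 ⊢; rwa [fl_mono (by omega) e]
  · exact (fl_mono h4.le e).trans h5

lemma gp_of {j : ℤ} {y : ℝ} (h1 : tl j y (xi P0) ∉ S) (h2 : tl (j + 1) y (xi P0) ∈ S) (h3 : j < P0.1)
    (h4 : y ∈ II P0) : gp S P0 (tl j y (xi P0)) := by
  have e : fl j (cc (tl j y (xi P0))) = fl j y := fl_cc (tl j y (xi P0))
  refine ⟨h1, ?_, ?_, h3, ?_⟩
  · simp only [tl] at e ⊢; rw [e]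
  · have : tl (j + 1) (cc (tl j y (xi P0))) (xi P0) = tl (j + 1) y (xi P0) := by
      simp only [tl] at e ⊢; rw [fl_mono (by omega : j ≤ j + 1) e]
    change tl (j + 1) _ _ ∈ S; rw [this]; exact h2
  · exact (fl_mono h3.le e).trans h4

def GG (S : Finset Tile) (P0 : Tile) : Finset Tile :=
  (S.image (fun P => (P.1 - 1, 2 * P.2.1, fl (-(P.1 - 1)) (xi P0))) ∪
    S.image (fun P => (P.1 - 1, 2 * P.2.1 + 1, fl (-(P.1 - 1)) (xi P0)))).filter (gp S P0)
lemma mem_GG {J : Tile} : J ∈ GG S P0 ↔ gp S P0 J := by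
  refine ⟨fun h => (Finset.mem_filter.1 h).2, fun h => Finset.mem_filter.2 ⟨?_, h⟩⟩
  have e : J.2.2 = fl (-J.1) (xi P0) := by rw [← (tl_eq.1 h.2.1.symm).2]
  have h2 := h.2.2.1
  have f : fl (J.1 + 1) (cc J) = J.2.1 / 2 := by rw [fl_succ, fl_cc]
  rw [Finset.mem_union, Finset.mem_image, Finset.mem_image]
  rcases Int.emod_two_eq_zero_or_one J.2.1 with h' | h'
  · exact Or.inl ⟨_, h2, Prod.ext (by simp [tl]) (Prod.ext (by simp only [tl]; omega) (by simp [tl, e]))⟩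
  · exact Or.inr ⟨_, h2, Prod.ext (by simp [tl]) (Prod.ext (by simp only [tl]; omega) (by simp [tl, e]))⟩

lemma gp_disj (hS : Cvx S) (hP0 : P0 ∈ S) {J J' : Tile} (h : gp S P0 J) (h' : gp S P0 J') {y : ℝ}
    (hy : y ∈ II J) (hy' : y ∈ II J') : J = J' := by
  have key : ∀ J J', gp S P0 J → gp S P0 J' → y ∈ II J → y ∈ II J' → ¬ J.1 < J'.1 := by
    intro J J' h h' hy hy' hlt
    have a := gp_at h hy
    have a' := gp_at h' hy'
    have := up hS hP0 a.2.2 (show J.1 + 1 ≤ J'.1 by omega) h'.2.2.2.1.le a.2.1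
    rw [a'.1] at this; exact h'.1 this
  have e : J.1 = J'.1 := le_antisymm (not_lt.1 (key J' J h' h hy' hy)) (not_lt.1 (key J J' h h' hy hy'))
  rw [← (gp_at h hy).1, ← (gp_at h' hy').1, e]

lemma GG_disj (hS : Cvx S) (hP0 : P0 ∈ S) : (GG S P0 : Set Tile).PairwiseDisjoint II := by
  intro J hJ J' hJ' hne
  rw [Function.onFun, Set.disjoint_left]
  exact fun y hy hy' => hne (gp_disj hS hP0 (mem_GG.1 hJ) (mem_GG.1 hJ') hy hy')

lemma GG_sum (hS : Cvx S) (hP0 : P0 ∈ S) : ∑ J ∈ GG S P0, (2:ℝ) ^ J.1 ≤ 2 ^ P0.1 := by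
  have := DS (GG S P0) II (fun P _ => meas_II P) (GG_disj hS hP0) (Ω := univ) (fun P _ => II_fin P) (by simp)
    (φ := indicator (II P0) 1) ((integrable_indicator_iff (meas_II P0)).2 (integrableOn_const (II_fin P0)))
    (fun y => indicator_nonneg (fun _ _ => zero_le_one) y) (v := fun _ => 1) (fun J hJ y hy => by
      rw [indicator_of_mem (gp_at (mem_GG.1 hJ) hy).2.2]; simp)
  rw [setIntegral_univ, integral_indicator (meas_II P0)] at this
  simpa [vol_II] using this

def Om (S : Finset Tile) (P0 : Tile) (k : ℤ) : Set ℝ := {y | y ∈ II P0 ∧ tl k y (xi P0) ∈ S}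

lemma meas_Om (k : ℤ) : MeasurableSet (Om S P0 k) := by
  refine (meas_II P0).inter ?_
  have : {y | tl k y (xi P0) ∈ S} = (fun y => tl k y (xi P0)) ⁻¹' S := rfl
  change MeasurableSet {y | tl k y (xi P0) ∈ S}
  rw [this]
  refine Measurable.comp (g := id) measurable_id ?_ (Finset.measurableSet S)
  exact measurable_const.prodMk ((meas_fl k).prodMk measurable_const)

lemma Om_compl (hP0 : P0 ∈ S) {k : ℤ} (hk : k ≤ P0.1) {y : ℝ} (hy : y ∉ Om S P0 k) :
    y ∈ (II P0)ᶜ ∨ ∃ J ∈ GG S P0, k ≤ J.1 ∧ y ∈ II J := by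
  by_cases h : y ∈ II P0
  swap; · exact Or.inl h
  right
  have hn : tl k y (xi P0) ∉ S := fun h' => hy ⟨h, h'⟩
  by_contra hc
  push Not at hc
  have : ∀ j : ℕ, k + j ≤ P0.1 → tl (k + j) y (xi P0) ∉ S := by
    intro j
    induction j with
    | zero => intro _; simpa using hn
    | succ j ih =>
      intro hj hS
      push_cast at hj hS
      have i := ih (by omega)
      exact hc _ (mem_GG.2 (gp_of i (by rwa [← add_assoc] at hS) (by omega) h)) (show k ≤ k + j by omega)
        (show fl (k + j) y = _ from rfl)
  obtain ⟨j, hj⟩ := Int.le.dest hk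
  have := this j hj.le
  rw [hj, tl_top h] at this
  exact this hP0

lemma Om_int (hS : Cvx S) (hP0 : P0 ∈ S) {k : ℤ} (hk : k ≤ P0.1) {φ : ℝ → ℝ} (hφ : Integrable φ) (h0 : ∀ y, 0 ≤ φ y) :
    ∫ y in (Om S P0 k)ᶜ, φ y ≤ (∫ y in (II P0)ᶜ, φ y) + ∑ J ∈ GG S P0 with k ≤ J.1, ∫ y in II J, φ y := by
  have hd : (((GG S P0).filter (fun J => k ≤ J.1) : Finset Tile) : Set Tile).PairwiseDisjoint II :=
    (GG_disj hS hP0).subset (by intro J hJ; exact (Finset.mem_filter.1 hJ).1)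
  have hm := Finset.measurableSet_biUnion ((GG S P0).filter (fun J => k ≤ J.1)) fun J _ => meas_II J
  rw [← integral_biUnion_finset _ (fun J _ => meas_II J) hd (fun i _ => hφ.integrableOn),
    ← setIntegral_union ?_ hm hφ.integrableOn hφ.integrableOn]
  · refine setIntegral_mono_set hφ.integrableOn (Eventually.of_forall h0) (LE.le.eventuallyLE fun y hy => ?_)
    rcases Om_compl hP0 hk hy with h | ⟨J, hJ, hk, h⟩
    · exact Or.inl h
    · exact Or.inr (mem_iUnion₂.2 ⟨J, Finset.mem_filter.2 ⟨hJ, hk⟩, h⟩)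
  · rw [Set.disjoint_left]
    intro y hy hy'
    obtain ⟨J, hJ, h⟩ := mem_iUnion₂.1 hy'
    exact hy (gp_at (mem_GG.1 (Finset.mem_filter.1 hJ).1) h).2.2

/-- tree setup: selected points -/
structure TS (g : ℝ → ℂ) (S : Finset Tile) (P0 : Tile) (σ : ℝ) (Λ : Finset Tile) (x : Tile → ℝ) : Prop where
  hg : Integrable g
  hσ : 0 ≤ σ
  hS : Cvx S
  hP0 : P0 ∈ S
  hA : ∀ P ∈ S, A g P ≤ σ ^ 2 * 2 ^ P.1
  hen : en g S P0 ≤ σ ^ 2 * 2 ^ P0.1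
  mem : ∀ L ∈ Λ, L ∈ S
  lek : ∀ L ∈ Λ, L.1 ≤ P0.1
  eq : ∀ L ∈ Λ, tl L.1 (x L) (xi P0) = L
  top : ∀ L ∈ Λ, x L ∈ II P0
  min : ∀ L ∈ Λ, tl (L.1 - 1) (x L) (xi P0) ∉ S

variable {g : ℝ → ℂ} {σ : ℝ} {Λ : Finset Tile} {x : Tile → ℝ}

def cl (P0 : Tile) (x : Tile → ℝ) (L : Tile) : Tile := tl (L.1 - 1) (x L) (xi P0)
lemma TS.isgp (t : TS g S P0 σ Λ x) {L : Tile} (h : L ∈ Λ) : gp S P0 (cl P0 x L) := by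
  refine gp_of (t.min L h) ?_ (by linarith [t.lek L h]) (t.top L h)
  rw [sub_add_cancel, t.eq L h]; exact t.mem L h

lemma TS.disj (t : TS g S P0 σ Λ x) : (Λ : Set Tile).PairwiseDisjoint (fun L => II (cl P0 x L)) := by
  intro L hL L' hL' hne
  rw [Function.onFun, Set.disjoint_left]
  intro y hy hy'
  have e := gp_disj t.hS t.hP0 (t.isgp hL) (t.isgp hL') hy hy'
  have e1 : L.1 = L'.1 := by have := congrArg Prod.fst e; simp only [cl, tl] at this; linarith
  have e2 : fl (L.1 - 1) (x L) = fl (L.1 - 1) (x L') := by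
    have := congrArg (fun P => P.2.1) e; simp only [cl, tl, ← e1] at this; exact this
  apply hne
  rw [← t.eq L hL, ← t.eq L' hL', ← e1]
  simp only [tl]; rw [fl_mono (show L.1 - 1 ≤ L.1 by omega) e2]

lemma TS.sum (t : TS g S P0 σ Λ x) {s : Finset Tile} (hs : s ⊆ Λ) {k : ℤ} (hk : ∀ L ∈ s, L.1 ≤ k) {Ω : Set ℝ}
    (hΩ : ∀ L ∈ s, II (cl P0 x L) ⊆ Ω) {n : ℕ} (hn : 2 ≤ n) (z : ℝ) :
    ∑ L ∈ s, 2 ^ L.1 * w n k (z - x L) ≤ 2 ^ (n + 1) * ∫ y in Ω, w n k (z - y) := by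
  rw [← integral_const_mul]
  have := DS s (fun L => II (cl P0 x L)) (fun P _ => meas_II _) (t.disj.subset hs) (fun P _ => II_fin _) hΩ
    (φ := fun y => 2 ^ (n + 1) * w n k (z - y)) ((intwc hn k z).const_mul _)
    (fun y => by have := w_pos n k (z - y); positivity) (v := fun L => 2 * w n k (z - x L))
    (fun L hL y hy => by
      have a := II_dist hy
      have b : |x L - cc (cl P0 x L)| ≤ 2 ^ (L.1 - 1) := II_dist (P := cl P0 x L) rfl
      have c : (2:ℝ) ^ (L.1 - 1) * 2 = 2 ^ L.1 := by rw [zpow_sub_one₀ two_ne_zero]; ring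
      have e : |y - x L| ≤ 2 ^ k := by
        have : y - x L = (y - cc (cl P0 x L)) - (x L - cc (cl P0 x L)) := by ring
        rw [this]
        refine (abs_sub _ _).trans ?_
        have : (2:ℝ) ^ L.1 ≤ 2 ^ k := zpow_le_zpow_right₀ one_le_two (hk L hL)
        change |y - cc (cl P0 x L)| ≤ 2 ^ (L.1 - 1) at a
        linarith
      have := w_slow (n := n) e z
      rw [pow_succ]; linarith)
  refine le_trans (le_of_eq (Finset.sum_congr rfl fun L _ => ?_)) this
  rw [vol_II]; change _ = 2 ^ (L.1 - 1) * _
  rw [zpow_sub_one₀ two_ne_zero]; ring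

lemma TS.sum0 (t : TS g S P0 σ Λ x) : ∑ L ∈ Λ, (2:ℝ) ^ L.1 ≤ 2 * 2 ^ P0.1 := by
  have h1 := GG_sum t.hS t.hP0
  have : ∑ L ∈ Λ, (2:ℝ) ^ (L.1 - 1) ≤ ∑ J ∈ GG S P0, (2:ℝ) ^ J.1 := by
    have inj : Set.InjOn (cl P0 x) Λ := by
      intro L hL L' hL' e
      by_contra hne
      exact Set.disjoint_left.1 (t.disj hL hL' hne) (show x L ∈ II (cl P0 x L) from rfl) (by simp only [← e]; exact rfl)
    have e := Finset.sum_image (f := fun J : Tile => (2:ℝ) ^ J.1) inj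
    change _ = ∑ L ∈ Λ, (2:ℝ) ^ (L.1 - 1) at e
    rw [← e]
    refine Finset.sum_le_sum_of_subset_of_nonneg (fun J hJ => ?_) fun J _ _ => (p2 _).le
    obtain ⟨L, hL, rfl⟩ := Finset.mem_image.1 hJ
    exact mem_GG.2 (t.isgp hL)
  simp_rw [zpow_sub_one₀ (two_ne_zero (α := ℝ)), ← Finset.sum_mul] at this
  linarith

end
end
end CF


namespace CF
noncomputable section
open Complex (I)
open scoped ComplexConjugate Classical

section
variable {S : Finset Tile} {P0 : Tile} {g : ℝ → ℂ} {σ : ℝ} {Λ : Finset Tile} {x : Tile → ℝ}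

lemma TS.gapdisj (t : TS g S P0 σ Λ x) {L J : Tile} (hL : L ∈ Λ) (hJ : gp S P0 J) (hk : L.1 ≤ J.1) :
    II (cl P0 x L) ⊆ (II J)ᶜ := by
  intro y hy hy'
  have e := gp_disj t.hS t.hP0 (t.isgp hL) hJ hy hy'
  have : J.1 = L.1 - 1 := by rw [← e]; rfl
  omega

lemma TS.out_b (t : TS g S P0 σ Λ x) {k : ℤ} {J : Tile} (hJ : gp S P0 J) (hk : k ≤ J.1) :
    ∑ L ∈ Λ with L.1 ≤ k, 2 ^ L.1 * ∫ y in II J, w 4 k (x L - y) ≤ 64 * C0 ^ 2 * 2 ^ k * 2 ^ k := by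
  have c0 := C0_pos
  have hp := p2 k
  simp_rw [← integral_const_mul]
  rw [← integral_finsetSum _ (fun L _ => ((intwc (by norm_num) k (x L)).const_mul _).integrableOn)]
  have ia := intw' (n := 2) le_rfl k (cc J)
  have ib := intw' (n := 2) le_rfl k (cc J + 2 ^ J.1)
  have iab : Integrable (fun y => w 2 k (y - cc J) + w 2 k (y - (cc J + 2 ^ J.1))) := ia.add ib
  have e : ∫ y, (w 2 k (y - cc J) + w 2 k (y - (cc J + 2 ^ J.1))) = 2 * (C0 * 2 ^ k) := by
    rw [integral_add ia ib, int_w, int_w]; ring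
  calc _ ≤ ∫ y in II J, 2 ^ 5 * (C0 * 2 ^ k) * (w 2 k (y - cc J) + w 2 k (y - (cc J + 2 ^ J.1))) := by
        refine setIntegral_mono_on (integrable_finsetSum _ fun L _ => ((intwc (by norm_num) k (x L)).const_mul _)).integrableOn
          (iab.const_mul _).integrableOn (meas_II J) fun y hy => ?_
        have h1 := t.sum (s := Λ.filter (fun L => L.1 ≤ k)) (Finset.filter_subset _ _) (k := k)
          (fun L hL => (Finset.mem_filter.1 hL).2) (Ω := (II J)ᶜ) (fun L hL => by
            rw [Finset.mem_filter] at hL; exact t.gapdisj hL.1 hJ (hL.2.trans hk)) (n := 4) (by norm_num) y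
        rw [II_Ico] at h1 hy
        have h2 := OUT hy.1 hy.2.le k
        simp_rw [w_comm 4 k (x _)]
        refine h1.trans ?_
        rw [mul_assoc]; gcongr
    _ ≤ ∫ y, 2 ^ 5 * (C0 * 2 ^ k) * (w 2 k (y - cc J) + w 2 k (y - (cc J + 2 ^ J.1))) :=
        setIntegral_le_integral (iab.const_mul _) (Eventually.of_forall fun y => by
          have := w_pos 2 k (y - cc J); have := w_pos 2 k (y - (cc J + 2 ^ J.1)); positivity)
    _ = _ := by rw [integral_const_mul, e]; ring

lemma TS.out_a (t : TS g S P0 σ Λ x) {k : ℤ} :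
    ∑ L ∈ Λ with L.1 ≤ k, 2 ^ L.1 * ∫ y in (II P0)ᶜ, w 4 k (x L - y) ≤ 16 * C0 ^ 2 * 2 ^ k * 2 ^ k := by
  have c0 := C0_pos
  have hp := p2 k
  have h : ∀ z, ∑ L ∈ Λ with L.1 ≤ k, 2 ^ L.1 * w 2 k (z - x L) ≤ 8 * (C0 * 2 ^ k) := fun z => by
    have := t.sum (s := Λ.filter (fun L => L.1 ≤ k)) (Finset.filter_subset _ _) (k := k)
      (fun L hL => (Finset.mem_filter.1 hL).2) (Ω := univ) (by simp) (n := 2) le_rfl z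
    rw [setIntegral_univ, int_w'] at this
    refine this.trans (by norm_num)
  calc _ ≤ ∑ L ∈ Λ with L.1 ≤ k, C0 * 2 ^ k * (2 ^ L.1 * w 2 k (cc P0 - x L) + 2 ^ L.1 * w 2 k (cc P0 + 2 ^ P0.1 - x L)) := by
        refine Finset.sum_le_sum fun L hL => ?_
        have hx := t.top L (Finset.mem_filter.1 hL).1
        rw [II_Ico] at hx ⊢
        have := OUT hx.1 hx.2.le k
        rw [w_comm 2 k (x L), w_comm 2 k (x L)] at this
        have := mul_le_mul_of_nonneg_left this (p2 L.1).le
        linarith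
    _ ≤ C0 * 2 ^ k * (8 * (C0 * 2 ^ k) + 8 * (C0 * 2 ^ k)) := by
        rw [← Finset.mul_sum, Finset.sum_add_distrib]; gcongr <;> exact h _
    _ = _ := by ring

lemma TS.out (t : TS g S P0 σ Λ x) (R : Finset ℤ) (hR : ∀ k ∈ R, k ≤ P0.1) :
    ∑ k ∈ R, ∑ L ∈ Λ with L.1 ≤ k, 2 ^ L.1 * ((2 ^ k)⁻¹ * ∫ y in (Om S P0 k)ᶜ, w 4 k (x L - y))
      ≤ 160 * C0 ^ 2 * 2 ^ P0.1 := by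
  have c0 := C0_pos
  have h1 : ∀ k ∈ R, ∑ L ∈ Λ with L.1 ≤ k, 2 ^ L.1 * ((2 ^ k)⁻¹ * ∫ y in (Om S P0 k)ᶜ, w 4 k (x L - y))
      ≤ 16 * C0 ^ 2 * 2 ^ k + ∑ J ∈ GG S P0 with k ≤ J.1, 64 * C0 ^ 2 * 2 ^ k := by
    intro k hk
    have hp := p2 k
    calc _ ≤ ∑ L ∈ Λ with L.1 ≤ k, ((2 ^ k)⁻¹ * (2 ^ L.1 * ∫ y in (II P0)ᶜ, w 4 k (x L - y))
          + ∑ J ∈ GG S P0 with k ≤ J.1, (2 ^ k)⁻¹ * (2 ^ L.1 * ∫ y in II J, w 4 k (x L - y))) := by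
          refine Finset.sum_le_sum fun L _ => ?_
          have := Om_int t.hS t.hP0 (hR k hk) (intwc (n := 4) (by norm_num) k (x L)) (fun y => (w_pos _ _ _).le)
          have := mul_le_mul_of_nonneg_left this (mul_pos (p2 L.1) (inv_pos.2 hp)).le
          rw [← Finset.mul_sum, ← Finset.mul_sum]
          linarith
      _ = (2 ^ k)⁻¹ * ∑ L ∈ Λ with L.1 ≤ k, (2 ^ L.1 * ∫ y in (II P0)ᶜ, w 4 k (x L - y))
          + ∑ J ∈ GG S P0 with k ≤ J.1, (2 ^ k)⁻¹ * ∑ L ∈ Λ with L.1 ≤ k, (2 ^ L.1 * ∫ y in II J, w 4 k (x L - y)) := by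
          rw [Finset.sum_add_distrib, Finset.sum_comm]; simp_rw [Finset.mul_sum]
      _ ≤ (2 ^ k)⁻¹ * (16 * C0 ^ 2 * 2 ^ k * 2 ^ k) + ∑ J ∈ GG S P0 with k ≤ J.1, (2 ^ k)⁻¹ * (64 * C0 ^ 2 * 2 ^ k * 2 ^ k) := by
          gcongr with J hJ
          · exact t.out_a
          · rw [Finset.mem_filter] at hJ; exact t.out_b (mem_GG.1 hJ.1) hJ.2
      _ = _ := by
          have e1 : ((2:ℝ) ^ k)⁻¹ * (16 * C0 ^ 2 * 2 ^ k * 2 ^ k) = 16 * C0 ^ 2 * 2 ^ k := by field_simp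
          have e2 : ((2:ℝ) ^ k)⁻¹ * (64 * C0 ^ 2 * 2 ^ k * 2 ^ k) = 64 * C0 ^ 2 * 2 ^ k := by field_simp
          rw [e1, e2]
  refine (Finset.sum_le_sum h1).trans ?_
  rw [Finset.sum_add_distrib]
  have h2 : ∑ k ∈ R, ∑ J ∈ GG S P0 with k ≤ J.1, 64 * C0 ^ 2 * (2:ℝ) ^ k ≤ 128 * C0 ^ 2 * 2 ^ P0.1 := by
    simp_rw [Finset.sum_filter]
    rw [Finset.sum_comm]
    simp_rw [← Finset.sum_filter, ← Finset.mul_sum]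
    calc _ ≤ 64 * C0 ^ 2 * ∑ J ∈ GG S P0, 2 * (2:ℝ) ^ J.1 := by
          gcongr with J _
          exact GEO0 _ _ fun k hk => (Finset.mem_filter.1 hk).2
      _ = 128 * C0 ^ 2 * ∑ J ∈ GG S P0, (2:ℝ) ^ J.1 := by rw [← Finset.mul_sum]; ring
      _ ≤ _ := by gcongr; exact GG_sum t.hS t.hP0
  rw [← Finset.mul_sum]
  have h3 := mul_le_mul_of_nonneg_left (GEO0 R P0.1 hR) (show 0 ≤ 16 * C0 ^ 2 by positivity)
  linarith

end

def UU (g : ℝ → ℂ) (k : ℤ) (m N : ℝ) (y : ℝ) : ℂ := V volume (fun η => ps (2 ^ k * η - 2 ^ k * N) * Gt g k m η) y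
lemma int_UU {g : ℝ → ℂ} (hg : Integrable g) (k : ℤ) (m N : ℝ) :
    Integrable (fun η => ps (2 ^ k * η - 2 ^ k * N) * Gt g k m η) := by
  simp_rw [mul_comm (ps _)]; exact int_mulα nps (int_Gt hg k m)

lemma d_two {P : Tile} {y : ℝ} (h : y ∈ II P) : d P.1 (y - cc P) ≤ 2 := by
  have := (div_le_one (p2 P.1)).2 (II_dist h); unfold d; linarith

section
variable {g : ℝ → ℂ} (hg : Integrable g) {P : Tile} {σ : ℝ} (hσ : 0 ≤ σ) (hA : A g P ≤ σ ^ 2 * 2 ^ P.1) {y0 : ℝ} (hy : y0 ∈ II P)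
include hg hσ hA hy

lemma U_bd (N y : ℝ) : ‖UU g P.1 P.2.2 N y‖ ≤ 32 * CB * √C0 * σ * d P.1 (y - y0) ^ 5 := by
  obtain ⟨a, b, c⟩ := bsh_spec nps (2 ^ P.1 * N)
  have := PB1 a b (int_Gt hg P.1 P.2.2) P.1 (cc P) y hσ hA
  simp_rw [c] at this
  refine this.trans ?_
  have h1 : d P.1 (y - cc P) ≤ d P.1 (y - y0) * 2 :=
    (d_tri _ _ _ _).trans (mul_le_mul_of_nonneg_left (d_two hy) (d_pos _ _).le)
  have := d_pos P.1 (y - cc P)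
  have := CBp
  calc _ ≤ CB * √C0 * (d P.1 (y - y0) * 2) ^ 5 * σ := by gcongr
    _ = _ := by ring

lemma U_diff (N N' : ℝ) : ‖UU g P.1 P.2.2 N y0 - UU g P.1 P.2.2 N' y0‖
    ≤ 2 * π * |2 ^ P.1 * N - 2 ^ P.1 * N'| * (32 * CB * √C0 * σ) := by
  obtain ⟨a, b, c⟩ := bsh2_spec nps (2 ^ P.1 * N) (2 ^ P.1 * N')
  have := PB1 a b (int_Gt hg P.1 P.2.2) P.1 (cc P) y0 hσ hA
  simp_rw [c, sub_mul] at this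
  rw [V_sub (int_UU hg _ _ _) (int_UU hg _ _ _)] at this
  refine this.trans ?_
  have := d_pos P.1 (y0 - cc P)
  have := CBp
  calc _ ≤ 2 * π * |2 ^ P.1 * N - 2 ^ P.1 * N'| * CB * √C0 * 2 ^ 5 * σ := by
        gcongr; exact d_two hy
    _ = _ := by ring

omit hσ hA in
lemma U_sq (N : ℝ) : ‖UU g P.1 P.2.2 N y0‖ ^ 2 ≤ 1024 * CB ^ 2 * C0 * ((2 ^ P.1)⁻¹ * A g P) := by
  obtain ⟨a, b, c⟩ := bsh_spec nps (2 ^ P.1 * N)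
  have := PB2 a b (int_Gt hg P.1 P.2.2) P.1 (cc P) y0
  simp_rw [c] at this
  refine this.trans ?_
  have := d_pos P.1 (y0 - cc P)
  have := p2 P.1
  have := C0_pos
  have := A_nonneg g P
  calc _ ≤ CB ^ 2 * C0 * 2 ^ 10 * ((2 ^ P.1)⁻¹ * A g P) := by
        gcongr
        · exact d_two hy
        · exact le_rfl
    _ = _ := by ring
end

lemma ps_th {k m : ℤ} {η N : ℝ} (h : ps (2 ^ k * η - 2 ^ k * N) * th (2 ^ k * η - m) ≠ 0) :
    fl (-k) N = m ∧ fl (-(k + 1)) N = 2 * m + 1 := by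
  have h1 := th_supp (right_ne_zero_of_mul h)
  have h2 := left_ne_zero_of_mul h
  have h3 := psR_supp (u := -(2 ^ k * η - 2 ^ k * N)) (by unfold ps psn at h2; exact_mod_cast h2)
  rw [fl_neg_iff, fl_neg_iff, zpow_add_one₀ two_ne_zero]; push_cast
  refine ⟨⟨?_, ?_⟩, ?_, ?_⟩ <;> linarith

/-- reproducing formula -/
lemma REP {G : ℝ → ℂ} (hG : Integrable G) (k : ℤ) (m : ℝ) (h : ∀ η, ch (2 ^ k * η - m) * G η = G η) (z : ℝ) :
    V volume G z = ∫ y, V volume (fun η => ch (2 ^ k * η - m)) (z - y) * V volume G y := by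
  have hp := p2 k
  obtain ⟨C, hC⟩ := exists_nice (f := fun η => chR (2 ^ k * η - m))
    (by unfold chR; exact (stc (by fun_prop)).mul (stc (by fun_prop)))
    (hcs (a := (m + 1/10) / 2 ^ k) (b := (m + 2/5) / 2 ^ k) fun u hu => by
      have := chR_supp hu
      rw [div_lt_iff₀ hp, lt_div_iff₀ hp]; constructor <;> linarith)
  change Nice (fun η => ch (2 ^ k * η - m)) C at hC
  obtain ⟨b1, b2, -⟩ := hC.beta
  set κ := V volume (fun η => ch (2 ^ k * η - m)) with hκ
  have hi : Integrable κ := by simpa using b2.comp_neg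
  have hiz : Integrable (fun y => κ (z - y)) := hi.comp_sub_left z
  rw [DU hG hiz]
  unfold V
  congr 1; ext η
  have : ∫ y, κ (z - y) * ex (η * y) = ex (z * η) * ch (2 ^ k * η - m) := by
    have e := integral_sub_left_eq_self (fun s => κ s * ex (η * (z - s))) volume z
    simp only [sub_sub_cancel] at e
    rw [e, hC.inv η]
    have e2 := integral_neg_eq_self (fun s => κ s * ex (η * (z - s))) volume
    rw [← e2]
    change _ = ex (z * η) * ∫ s, κ (-s) * ex (η * s)
    rw [← integral_const_mul]; congr 1; ext s
    rw [show η * (z - -s) = z * η + η * s by ring, ex_add]; ring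
  rw [this]; nth_rewrite 1 [← h η]; ring

end
end CF


namespace CF
noncomputable section
open Complex (I)
open scoped ComplexConjugate Classical

lemma int_q (k : ℤ) (z : ℝ) : Integrable (fun y => q k (z - y)) ∧ ∫ y, q k (z - y) ≤ C0 := by
  have h := p2 k
  refine ⟨(intwc (by norm_num) k z).const_mul _, ?_⟩
  unfold q
  rw [integral_const_mul]
  have := int_w4 k z univ
  rw [setIntegral_univ] at this
  calc _ ≤ (2 ^ k)⁻¹ * (C0 * 2 ^ k) := by gcongr
    _ = C0 := by field_simp
lemma q_comm (k : ℤ) (x y : ℝ) : q k (x - y) = q k (y - x) := by unfold q; rw [w_comm]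
lemma q_le (k : ℤ) (z : ℝ) : q k z ≤ (2 ^ k)⁻¹ := by
  have := p2 k
  have := w_le_one 4 k z; unfold q; exact mul_le_of_le_one_right (by positivity) this
lemma cont_q (k : ℤ) : Continuous (q k) := by
  unfold q w d; have := p2 k
  refine continuous_const.mul (Continuous.inv₀ (by fun_prop) fun z => ?_)
  have : 0 ≤ |z| / 2 ^ k := by positivity
  positivity

lemma SCH {b : ℝ → ℝ} (hb : Integrable b) (hb2 : Integrable (fun y => b y ^ 2)) (k : ℤ) :
    ∫ y, b y * ∫ x, b x * q k (y - x) ≤ C0 * ∫ y, b y ^ 2 := by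
  have hkk := p2 k
  have vp := Measure.volume_eq_prod ℝ ℝ
  have ip : ∀ {f g : ℝ → ℝ}, Integrable f → Integrable g →
      Integrable (fun z : ℝ × ℝ => f z.1 * g z.2 * q k (z.1 - z.2)) (volume.prod volume) := fun hf hg =>
    (hf.mul_prod hg).mul_bdd (c := (2 ^ k)⁻¹) ((cont_q k).comp (by fun_prop)).aestronglyMeasurable
      (Eventually.of_forall fun z => by rw [Real.norm_eq_abs, abs_of_nonneg (q_nonneg _ _)]; exact q_le _ _)
  have i1 := ip hb hb
  have hqi : Integrable (q k) := by simpa using (int_q k 0).1.comp_neg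
  have i2 : Integrable (fun z : ℝ × ℝ => b z.2 ^ 2 * q k (z.1 - z.2)) (volume.prod volume) :=
    hb2.convolution_integrand (ContinuousLinearMap.mul ℝ ℝ) hqi
  have i3 : Integrable (fun z : ℝ × ℝ => b z.1 ^ 2 * q k (z.1 - z.2)) (volume.prod volume) := by
    have := i2.swap; refine this.congr (Eventually.of_forall fun z => ?_)
    simp [q_comm k z.2]
  have e2 : ∫ z : ℝ × ℝ, b z.2 ^ 2 * q k (z.1 - z.2) = ∫ z : ℝ × ℝ, b z.1 ^ 2 * q k (z.1 - z.2) := by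
    rw [vp, ← integral_prod_swap]; congr 1; ext z; simp [q_comm k z.2]
  have e3 : ∫ z : ℝ × ℝ, b z.1 ^ 2 * q k (z.1 - z.2) ≤ C0 * ∫ y, b y ^ 2 := by
    rw [Measure.volume_eq_prod, integral_prod _ i3, ← integral_const_mul]
    refine integral_mono i3.integral_prod_left (hb2.const_mul _) fun y => ?_
    simp only; rw [integral_const_mul, mul_comm]
    exact mul_le_mul_of_nonneg_right (int_q k y).2 (sq_nonneg _)
  have e1 : ∫ y, b y * ∫ x, b x * q k (y - x) = ∫ z : ℝ × ℝ, b z.1 * b z.2 * q k (z.1 - z.2) := by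
    rw [Measure.volume_eq_prod, integral_prod _ i1]; simp_rw [mul_assoc, integral_const_mul]
  rw [e1]
  calc _ ≤ ∫ z : ℝ × ℝ, ((1/2) * (b z.1 ^ 2 * q k (z.1 - z.2)) + (1/2) * (b z.2 ^ 2 * q k (z.1 - z.2))) := by
        rw [vp]; refine integral_mono i1 ((i3.const_mul _).add (i2.const_mul _)) fun z => ?_
        have := q_nonneg k (z.1 - z.2)
        simp only
        nlinarith [mul_nonneg (sq_nonneg (b z.1 - b z.2)) this]
    _ ≤ _ := by
        rw [vp] at e2 e3 ⊢
        rw [integral_add (i3.const_mul _) (i2.const_mul _), integral_const_mul, integral_const_mul, e2]; linarith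

section
variable {S : Finset Tile} {P0 : Tile} {g : ℝ → ℂ} {σ : ℝ} {Λ : Finset Tile} {x : Tile → ℝ}

lemma conj_la (u : ℝ) : conj (la u) = la u := Complex.conj_ofReal _

/-- square function bound for the dual side -/
lemma TS.TB (t : TS g S P0 σ Λ x) (κ : Tile → ℤ) (hκ : ∀ L ∈ Λ, L.1 ≤ κ L) (m : ℤ → ℝ) (c : Tile → ℂ)
    (hc : ∀ L, ‖c L‖ ≤ 2 ^ L.1) :
    Integrable (fun η => ‖∑ L ∈ Λ, c L * ex (x L * η) * la (2 ^ κ L * η - m (κ L))‖ ^ 2) ∧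
    ∫ η, ‖∑ L ∈ Λ, c L * ex (x L * η) * la (2 ^ κ L * η - m (κ L))‖ ^ 2 ≤ 128 * CB ^ 2 * C0 ^ 2 * 2 ^ P0.1 := by
  have c0 := C0_pos
  have cb := CBp
  have pe : ∀ L L' η, (c L * ex (x L * η) * la (2 ^ κ L * η - m (κ L))) * conj (c L' * ex (x L' * η) * la (2 ^ κ L' * η - m (κ L')))
      = c L * conj (c L') * (la (2 ^ κ L * η - m (κ L)) * la (2 ^ κ L' * η - m (κ L')) * ex ((x L - x L') * η)) := by
    intro L L' η
    rw [map_mul, map_mul, conj_la, conj_ex, sub_mul, sub_eq_add_neg (x L * η), ex_add]; ring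
  have ii : ∀ L L', Integrable (fun η => la (2 ^ κ L * η - m (κ L)) * la (2 ^ κ L' * η - m (κ L'))) :=
    fun L L' => int_mulα nla (int_scale nla _ _)
  obtain ⟨h1, h2⟩ := GS Λ (fun L η => c L * ex (x L * η) * la (2 ^ κ L * η - m (κ L))) (fun L _ L' _ => by
    simp_rw [pe]; exact (intg_ex (ii L L') (by fun_prop)).const_mul _)
  refine ⟨h1, h2.trans ?_⟩
  set D := CB ^ 2 * C0 with hD
  let F : Tile → Tile → ℝ := fun L L' => if κ L' ≤ κ L then 2 ^ L.1 * 2 ^ L'.1 * (D * q (κ L) (x L - x L')) else 0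
  have F0 : ∀ L L', 0 ≤ F L L' := fun L L' => by
    simp only [F]; split_ifs
    · have := q_nonneg (κ L) (x L - x L'); have := p2 L.1; have := p2 L'.1; positivity
    · exact le_rfl
  have h3 : ∀ L L', ‖∫ η, (c L * ex (x L * η) * la (2 ^ κ L * η - m (κ L))) * conj (c L' * ex (x L' * η) * la (2 ^ κ L' * η - m (κ L')))‖
      ≤ F L L' + F L' L := by
    intro L L'
    simp_rw [pe]
    rw [integral_const_mul, norm_mul, norm_mul, RCLike.norm_conj]
    change _ * ‖V volume (fun η => la (2 ^ κ L * η - m (κ L)) * la (2 ^ κ L' * η - m (κ L'))) (x L - x L')‖ ≤ _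
    have hL := hc L; have hL' := hc L'
    have := p2 L.1; have := p2 L'.1
    rcases le_total (κ L') (κ L) with h | h
    · have := PK nla h (m (κ L)) (m (κ L')) (x L - x L')
      simp_rw [mul_comm (la (2 ^ κ L' * _ - _))] at this
      refine le_trans ?_ (le_add_of_nonneg_right (F0 L' L))
      simp only [F, if_pos h]
      gcongr
    · have := PK nla h (m (κ L')) (m (κ L)) (x L - x L')
      rw [q_comm] at this
      refine le_trans ?_ (le_add_of_nonneg_left (F0 L L'))
      simp only [F, if_pos h]
      rw [mul_comm ((2:ℝ) ^ L'.1)]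
      gcongr
  have h4 : ∑ L ∈ Λ, ∑ L' ∈ Λ, F L L' ≤ 64 * CB ^ 2 * C0 ^ 2 * 2 ^ P0.1 := by
    calc _ ≤ ∑ L ∈ Λ, 2 ^ L.1 * (32 * D * C0) := by
          refine Finset.sum_le_sum fun L hL => ?_
          simp only [F]; rw [← Finset.sum_filter]
          have hk := p2 (κ L)
          have := t.sum (s := Λ.filter (fun L' => κ L' ≤ κ L)) (Finset.filter_subset _ _) (k := κ L)
            (fun L' hL' => by rw [Finset.mem_filter] at hL'; exact (hκ L' hL'.1).trans hL'.2) (Ω := univ) (by simp) (n := 4) (by norm_num) (x L)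
          have i := int_w4 (κ L) (x L) univ
          calc _ = 2 ^ L.1 * (D * (2 ^ κ L)⁻¹ * ∑ L' ∈ Λ with κ L' ≤ κ L, 2 ^ L'.1 * w 4 (κ L) (x L - x L')) := by
                rw [Finset.mul_sum, Finset.mul_sum]; refine Finset.sum_congr rfl fun L' _ => ?_
                unfold q; ring
            _ ≤ 2 ^ L.1 * (D * (2 ^ κ L)⁻¹ * (2 ^ 5 * (C0 * 2 ^ κ L))) := by
                have pl := p2 L.1
                gcongr; refine this.trans ?_; gcongr
            _ = _ := by field_simp; ring
      _ ≤ (2 * 2 ^ P0.1) * (32 * D * C0) := by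
          rw [← Finset.sum_mul]; have := t.sum0; gcongr
      _ = _ := by rw [hD]; ring
  calc _ ≤ ∑ L ∈ Λ, ∑ L' ∈ Λ, (F L L' + F L' L) := by gcongr; exact h3 _ _
    _ = 2 * ∑ L ∈ Λ, ∑ L' ∈ Λ, F L L' := by
        simp_rw [Finset.sum_add_distrib]; rw [Finset.sum_comm (f := fun L L' => F L' L)]; ring
    _ ≤ _ := by linarith

lemma unim (z : ℂ) : ∃ e : ℂ, ‖e‖ ≤ 1 ∧ e * z = ‖z‖ := by
  by_cases h : z = 0
  · exact ⟨0, by simp, by simp [h]⟩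
  · refine ⟨conj z / ‖z‖, ?_, ?_⟩
    · rw [norm_div, RCLike.norm_conj]; simp [h]
    · rw [div_mul_eq_mul_div, Complex.conj_mul']
      have : (‖z‖ : ℂ) ≠ 0 := by exact_mod_cast norm_ne_zero_iff.2 h
      field_simp

lemma TS.TM (t : TS g S P0 σ Λ x) (κ : Tile → ℤ) (hκ : ∀ L ∈ Λ, L.1 ≤ κ L) (m : ℤ → ℝ) {Φ : ℝ → ℂ}
    (hΦ : Integrable Φ) (hΦ2 : Integrable (fun η => ‖Φ η‖ ^ 2)) :
    (∑ L ∈ Λ, 2 ^ L.1 * ‖V volume (fun η => Φ η * la (2 ^ κ L * η - m (κ L))) (x L)‖) ^ 2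
      ≤ 128 * CB ^ 2 * C0 ^ 2 * 2 ^ P0.1 * ∫ η, ‖Φ η‖ ^ 2 := by
  choose e he1 he2 using fun L => unim (V volume (fun η => Φ η * la (2 ^ κ L * η - m (κ L))) (x L))
  obtain ⟨h1, h2⟩ := t.TB κ hκ m (fun L => ((2 ^ L.1 : ℝ) : ℂ) * e L) (fun L => by
    have := p2 L.1
    rw [norm_mul, Complex.norm_real, Real.norm_eq_abs, abs_of_pos this]; exact mul_le_of_le_one_right this.le (he1 L))
  set B : ℝ → ℂ := fun η => ∑ L ∈ Λ, ((2 ^ L.1 : ℝ) : ℂ) * e L * ex (x L * η) * la (2 ^ κ L * η - m (κ L)) with hB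
  have eq : ((∑ L ∈ Λ, 2 ^ L.1 * ‖V volume (fun η => Φ η * la (2 ^ κ L * η - m (κ L))) (x L)‖ : ℝ) : ℂ) = ∫ η, Φ η * B η := by
    push_cast
    simp_rw [hB, Finset.mul_sum]
    rw [integral_finsetSum]
    · refine Finset.sum_congr rfl fun L _ => ?_
      rw [← he2 L, V, ← mul_assoc, ← integral_const_mul]; congr 1; ext η; push_cast; ring
    · intro L _
      have := (intg_ex (int_mulα nla hΦ (r := 2 ^ κ L) (c := m (κ L))) (φ := fun η => x L * η) (by fun_prop)).const_mul (((2 ^ L.1 : ℝ) : ℂ) * e L)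
      refine this.congr (Eventually.of_forall fun η => ?_); simp only; ring
  have cB : Continuous B := by
    refine continuous_finsetSum _ fun L _ => ?_
    exact (continuous_const.mul (cont_ex.comp (by fun_prop))).mul (nla.cont.comp (by fun_prop))
  obtain ⟨-, cs⟩ := CS (ν := volume) hΦ.1.norm cB.norm.aestronglyMeasurable hΦ2 h1
  have n0 : 0 ≤ ∑ L ∈ Λ, 2 ^ L.1 * ‖V volume (fun η => Φ η * la (2 ^ κ L * η - m (κ L))) (x L)‖ :=
    Finset.sum_nonneg fun L _ => by have := p2 L.1; positivity
  have le1 : ∑ L ∈ Λ, 2 ^ L.1 * ‖V volume (fun η => Φ η * la (2 ^ κ L * η - m (κ L))) (x L)‖ ≤ ∫ η, ‖Φ η‖ * ‖B η‖ := by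
    have := norm_integral_le_integral_norm (μ := volume) (fun η => Φ η * B η)
    rw [← eq, Complex.norm_real, Real.norm_eq_abs, abs_of_nonneg n0] at this
    simpa [norm_mul] using this
  calc _ ≤ (∫ η, ‖Φ η‖ * ‖B η‖) ^ 2 := by gcongr
    _ ≤ _ := cs
    _ ≤ (∫ η, ‖Φ η‖ ^ 2) * (128 * CB ^ 2 * C0 ^ 2 * 2 ^ P0.1) := by gcongr
    _ = _ := by ring
end
end
end CF


namespace CF
noncomputable section
open Complex (I)
open scoped ComplexConjugate Classical

def mm (P0 : Tile) (k : ℤ) : ℤ := fl (-k) (xi P0)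
def ty (P0 : Tile) (k : ℤ) : Prop := fl (-(k + 1)) (xi P0) = 2 * mm P0 k + 1
def HH (g : ℝ → ℂ) (P0 : Tile) (k : ℤ) (y : ℝ) : ℂ := UU g k (mm P0 k) (xi P0) y
def RR (S : Finset Tile) (P0 : Tile) : Finset ℤ := (S.image Prod.fst).filter (fun k => k < P0.1 ∧ ty P0 k)
def bk (g : ℝ → ℂ) (S : Finset Tile) (P0 : Tile) (k : ℤ) : ℝ → ℂ := indicator (Om S P0 k) (HH g P0 k)
def bn (g : ℝ → ℂ) (S : Finset Tile) (P0 : Tile) (k : ℤ) (y : ℝ) : ℂ := bk g S P0 k (-y)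
def cht (P0 : Tile) (k : ℤ) (η : ℝ) : ℂ := ch (2 ^ k * η - mm P0 k)
def lat (P0 : Tile) (k : ℤ) (η : ℝ) : ℂ := la (2 ^ k * η - mm P0 k)
def Ph (g : ℝ → ℂ) (S : Finset Tile) (P0 : Tile) (η : ℝ) : ℂ := ∑ k ∈ RR S P0, cht P0 k η * V volume (bn g S P0 k) η

section
variable {S : Finset Tile} {P0 : Tile} {g : ℝ → ℂ} {σ : ℝ} {Λ : Finset Tile} {x : Tile → ℝ}

lemma HH_zero {k : ℤ} (h : ¬ ty P0 k) (y : ℝ) : HH g P0 k y = 0 := by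
  unfold HH UU V
  rw [integral_eq_zero_of_ae]
  refine Eventually.of_forall fun η => ?_
  simp only [Pi.zero_apply]
  by_contra hc
  have : ps (2 ^ k * η - 2 ^ k * xi P0) * th (2 ^ k * η - mm P0 k) ≠ 0 := by
    intro h0; apply hc; unfold Gt; linear_combination (g η * ex (y * η)) * h0
  exact h (ps_th this).2

lemma ch_supp {u : ℝ} (h : ch u ≠ 0) : 1/10 < u ∧ u < 2/5 := chR_supp (by unfold ch at h; exact_mod_cast h)
lemma cht_fl {k : ℤ} {η : ℝ} (h : cht P0 k η ≠ 0) : fl (-k) η = mm P0 k ∧ fl (-(k + 1)) η = 2 * mm P0 k := by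
  have := ch_supp h
  rw [fl_neg_iff, fl_neg_iff, zpow_add_one₀ two_ne_zero]; push_cast
  refine ⟨⟨?_, ?_⟩, ?_, ?_⟩ <;> linarith

lemma cht_cht {k k' : ℤ} (hk : ty P0 k) (hk' : ty P0 k') (hne : k ≠ k') (η : ℝ) : cht P0 k η * cht P0 k' η = 0 := by
  have key : ∀ {k k'}, ty P0 k → k < k' → cht P0 k η * cht P0 k' η = 0 := by
    intro k k' hk hlt
    by_contra h
    have h1 := cht_fl (left_ne_zero_of_mul h)
    have h2 := cht_fl (right_ne_zero_of_mul h)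
    have := fl_mono (show -k' ≤ -(k + 1) by omega) h2.1
    rw [h1.2, hk] at this; omega
  rcases lt_or_gt_of_ne hne with h | h
  · exact key hk h
  · rw [mul_comm]; exact key hk' h

lemma la_one {u : ℝ} (h1 : 0 ≤ u) (h2 : u ≤ 1) : la u = 1 := by unfold la; rw [laR_one h1 h2]; simp
lemma la_zero {u : ℝ} (h1 : u ≤ -(1/5)) : la u = 0 := by
  unfold la; by_contra h
  have := laR_supp (u := u) (by exact_mod_cast h)
  linarith

lemma cht_lat {k k' : ℤ} (hk : ty P0 k) (η : ℝ) : cht P0 k η * lat P0 k' η = if k' ≤ k then cht P0 k η else 0 := by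
  by_cases h : cht P0 k η = 0
  · rw [h]; simp
  have h1 := cht_fl h
  split_ifs with hh
  · have e : fl (-k') η = mm P0 k' := fl_mono (show -k ≤ -k' by omega) h1.1
    rw [fl_neg_iff] at e
    rw [lat, la_one (by linarith) (by linarith), mul_one]
  · rw [lat, la_zero, mul_zero]
    have h2 := (ch_supp h).2
    obtain ⟨j, rfl⟩ := Int.le.dest (show k + 1 ≤ k' by omega)
    have a : mm P0 (k + 1 + j) / 2 ^ j = 2 * mm P0 k + 1 := by
      rw [mm, ← fl_add, ← hk]; congr 1; ring
    have b : (2 * mm P0 k + 1) * 2 ^ j ≤ mm P0 (k + 1 + j) := by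
      rw [← a]; exact Int.ediv_mul_le _ (by positivity)
    have b' : ((2 * mm P0 k + 1 : ℝ)) * 2 ^ j ≤ mm P0 (k + 1 + j) := by exact_mod_cast b
    rw [zpow_add₀ two_ne_zero, zpow_add_one₀ two_ne_zero, zpow_natCast]
    have p : (1:ℝ) ≤ 2 ^ j := one_le_pow₀ one_le_two
    nlinarith

lemma cht_HH {k : ℤ} (η : ℝ) : ch (2 ^ k * η - mm P0 k) * (ps (2 ^ k * η - 2 ^ k * xi P0) * Gt g k (mm P0 k) η)
    = ps (2 ^ k * η - 2 ^ k * xi P0) * Gt g k (mm P0 k) η := by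
  by_cases h : th (2 ^ k * η - mm P0 k) = 0
  · simp [Gt, h]
  · have := th_supp h
    rw [ch, chR_one this.1.le this.2.le]; simp

lemma cont_HH (hg : Integrable g) (k : ℤ) : Continuous (HH g P0 k) := cont_V (int_UU hg _ _ _)
lemma bd_HH (k : ℤ) : ∃ M, ∀ y, ‖HH g P0 k y‖ ≤ M := ⟨_, fun _ => norm_V_le _ _⟩
lemma Om_fin (k : ℤ) : volume (Om S P0 k) ≠ ⊤ := ((measure_mono fun _ h => h.1).trans_lt (II_fin P0).lt_top).ne
lemma int_bk (hg : Integrable g) (k : ℤ) : Integrable (bk g S P0 k) := by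
  obtain ⟨M, hM⟩ := bd_HH (g := g) (P0 := P0) k
  rw [bk, integrable_indicator_iff (meas_Om k)]
  exact IntegrableOn.of_bound (Om_fin k).lt_top (cont_HH hg k).aestronglyMeasurable M (Eventually.of_forall hM)
lemma int_bk2 (hg : Integrable g) (k : ℤ) : Integrable (fun y => ‖bk g S P0 k y‖ ^ 2) := by
  obtain ⟨M, hM⟩ := bd_HH (g := g) (P0 := P0) k
  have := (int_bk (S := S) (P0 := P0) hg k).norm.bdd_mul (c := M) (int_bk (S := S) (P0 := P0) hg k).1.norm (Eventually.of_forall fun y => by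
    rw [norm_norm, bk]; exact (norm_indicator_le_norm_self _ _).trans (hM y))
  simpa [sq] using this

lemma T2_of {k : ℤ} (hk : k ∈ RR S P0) {y : ℝ} (hy : y ∈ Om S P0 k) : tl k y (xi P0) ∈ T2 S P0 := by
  obtain ⟨_, h2, h3⟩ := Finset.mem_filter.1 hk
  refine Finset.mem_filter.2 ⟨hy.2, ?_, h3⟩
  have := le_tl h2.le y (xi P0); rwa [tl_top hy.1] at this

lemma bk_en (hg : Integrable g) : ∑ k ∈ RR S P0, ∫ y, ‖bk g S P0 k y‖ ^ 2 ≤ 1024 * CB ^ 2 * C0 * en g S P0 := by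
  have c0 := C0_pos
  have h : ∀ k ∈ RR S P0, ∫ y, ‖bk g S P0 k y‖ ^ 2 ≤ ∑ P ∈ T2 S P0 with P.1 = k, 1024 * CB ^ 2 * C0 * A g P := by
    intro k hk
    have ii : ∀ P : Tile, Integrable (indicator (II P) fun _ => 1024 * CB ^ 2 * C0 * ((2 ^ k)⁻¹ * A g P)) := fun P =>
      (integrable_indicator_iff (meas_II P)).2 (integrableOn_const (II_fin P))
    calc _ ≤ ∫ y, ∑ P ∈ T2 S P0 with P.1 = k, indicator (II P) (fun _ => 1024 * CB ^ 2 * C0 * ((2 ^ k)⁻¹ * A g P)) y := by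
          refine integral_mono (int_bk2 hg k) (integrable_finsetSum _ fun P _ => ii P) fun y => ?_
          have nn : ∀ P ∈ (T2 S P0).filter (fun P => P.1 = k), 0 ≤ indicator (II P) (fun _ => 1024 * CB ^ 2 * C0 * ((2 ^ k)⁻¹ * A g P)) y :=
            fun P _ => indicator_nonneg (fun _ _ => by have := p2 k; have := A_nonneg g P; positivity) y
          by_cases hy : y ∈ Om S P0 k
          · have m := T2_of hk hy
            refine le_trans ?_ (Finset.single_le_sum nn (Finset.mem_filter.2 ⟨m, rfl⟩))
            rw [indicator_of_mem (show y ∈ II (tl k y (xi P0)) from rfl)]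
            simp only [bk]; rw [indicator_of_mem hy]
            exact U_sq hg (P := tl k y (xi P0)) rfl (xi P0)
          · simp only [bk]; rw [indicator_of_notMem hy]; simp only [norm_zero, ne_eq, OfNat.ofNat_ne_zero, not_false_eq_true, zero_pow]
            exact Finset.sum_nonneg nn
      _ = _ := by
          rw [integral_finsetSum _ fun P _ => ii P]
          refine Finset.sum_congr rfl fun P hP => ?_
          have e := (Finset.mem_filter.1 hP).2
          have := p2 P.1
          rw [integral_indicator (meas_II P), setIntegral_const, vol_II, ← e, smul_eq_mul]; field_simp
  refine (Finset.sum_le_sum h).trans ?_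
  rw [en, Finset.mul_sum]
  exact Finset.sum_fiberwise_le_sum_of_sum_fiber_nonneg fun k _ => Finset.sum_nonneg fun P _ => by
    have := A_nonneg g P; positivity

lemma int_bn (hg : Integrable g) (k : ℤ) : Integrable (bn g S P0 k) := (int_bk hg k).comp_neg
lemma int_cht (k : ℤ) : Integrable (cht P0 k) := int_scale nch _ _
lemma conj_ch (u : ℝ) : conj (ch u) = ch u := Complex.conj_ofReal _
lemma int_chV (hg : Integrable g) (k : ℤ) : Integrable (fun η => cht P0 k η * V volume (bn g S P0 k) η) :=
  (int_cht k).mul_bdd (c := ∫ y, ‖bn g S P0 k y‖) (cont_V (int_bn hg k)).aestronglyMeasurable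
    (Eventually.of_forall fun _ => norm_V_le _ _)
lemma int_Ph (hg : Integrable g) : Integrable (Ph g S P0) := integrable_finsetSum _ fun k _ => int_chV hg k

lemma Ph_L2 (hg : Integrable g) : Integrable (fun η => ‖Ph g S P0 η‖ ^ 2) ∧
    ∫ η, ‖Ph g S P0 η‖ ^ 2 ≤ 1024 * CB ^ 4 * C0 ^ 3 * en g S P0 := by
  have c0 := C0_pos
  have cb := CBp
  have pe : ∀ k k' η, (cht P0 k η * V volume (bn g S P0 k) η) * conj (cht P0 k' η * V volume (bn g S P0 k') η)
      = (cht P0 k η * cht P0 k' η) * V volume (bn g S P0 k) η * conj (V volume (bn g S P0 k') η) := by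
    intro k k' η; rw [map_mul]; unfold cht; rw [conj_ch]; ring
  have i2 : ∀ k k', Integrable (fun η => cht P0 k η * cht P0 k' η) := fun k k' => int_mulα nch (int_cht k)
  obtain ⟨h1, h2⟩ := GS (RR S P0) (fun k η => cht P0 k η * V volume (bn g S P0 k) η) (fun k _ k' _ => by
    simp_rw [pe, mul_assoc (cht P0 k _ * _)]
    refine (i2 k k').mul_bdd (c := (∫ y, ‖bn g S P0 k y‖) * ∫ y, ‖bn g S P0 k' y‖)
      ((cont_V (int_bn hg k)).mul (Complex.continuous_conj.comp (cont_V (int_bn hg k')))).aestronglyMeasurable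
      (Eventually.of_forall fun η => ?_)
    rw [norm_mul, RCLike.norm_conj]
    have a := norm_V_le (ν := volume) (bn g S P0 k) η
    have b := norm_V_le (ν := volume) (bn g S P0 k') η
    gcongr)
  refine ⟨h1, h2.trans ?_⟩
  have h3 : ∀ k ∈ RR S P0, ∑ k' ∈ RR S P0, ‖∫ η, (cht P0 k η * V volume (bn g S P0 k) η) * conj (cht P0 k' η * V volume (bn g S P0 k') η)‖
      ≤ CB ^ 2 * C0 ^ 2 * ∫ y, ‖bk g S P0 k y‖ ^ 2 := by
    intro k hk
    rw [Finset.sum_eq_single k]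
    · simp_rw [pe]
      have g1 := GP (φ := fun η => cht P0 k η * cht P0 k η) (i2 k k) (PK nch le_rfl (mm P0 k) (mm P0 k))
        (int_bn (S := S) (P0 := P0) hg k) (int_bn (S := S) (P0 := P0) hg k)
      refine g1.trans ?_
      have s1 := SCH (int_bk (S := S) (P0 := P0) hg k).norm.comp_neg (int_bk2 (S := S) (P0 := P0) hg k).comp_neg k
      rw [integral_neg_eq_self (fun y => ‖bk g S P0 k y‖ ^ 2)] at s1
      calc _ ≤ CB ^ 2 * C0 * (C0 * ∫ y, ‖bk g S P0 k y‖ ^ 2) := by gcongr; exact s1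
        _ = _ := by ring
    · intro k' hk' hne
      simp_rw [pe, cht_cht (Finset.mem_filter.1 hk).2.2 (Finset.mem_filter.1 hk').2.2 hne.symm]; simp
    · exact fun h => absurd hk h
  refine (Finset.sum_le_sum h3).trans ?_
  rw [← Finset.mul_sum]
  calc _ ≤ CB ^ 2 * C0 ^ 2 * (1024 * CB ^ 2 * C0 * en g S P0) := by gcongr; exact bk_en hg
    _ = _ := by ring

/-- Fubini for the main part -/
lemma main_fub (hg : Integrable g) (k : ℤ) (z : ℝ) :
    ∫ y in Om S P0 k, V volume (cht P0 k) (z - y) * HH g P0 k y = V volume (fun η => cht P0 k η * V volume (bn g S P0 k) η) z := by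
  have := fub (int_cht (P0 := P0) k) (int_bk (S := S) (P0 := P0) hg k) (φ := fun y η => (z - y) * η) (by fun_prop)
  rw [← integral_indicator (meas_Om k)]
  have e : ∀ y, indicator (Om S P0 k) (fun y => V volume (cht P0 k) (z - y) * HH g P0 k y) y
      = bk g S P0 k y * ∫ η, cht P0 k η * ex ((z - y) * η) := by
    intro y; unfold bk
    by_cases hy : y ∈ Om S P0 k
    · rw [indicator_of_mem hy, indicator_of_mem hy, mul_comm]; rfl
    · rw [indicator_of_notMem hy, indicator_of_notMem hy, zero_mul]
  simp_rw [e]; rw [this, V]; congr 1; ext η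
  rw [mul_assoc]; congr 1
  rw [V, ← integral_neg_eq_self, ← integral_mul_const]
  congr 1; ext y; simp only [bn]
  rw [mul_assoc, ← ex_add]; congr 2; ring

lemma TS.split (t : TS g S P0 σ Λ x) {L : Tile} (hL : L ∈ Λ) {k : ℤ} (h1 : L.1 ≤ k) (h2 : k ≤ P0.1) :
    ‖HH g P0 k (x L) - V volume (fun η => cht P0 k η * V volume (bn g S P0 k) η) (x L)‖
      ≤ 32 * CB ^ 2 * √C0 * σ * ((2 ^ k)⁻¹ * ∫ y in (Om S P0 k)ᶜ, w 4 k (x L - y)) := by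
  have cb := CBp
  have pk := p2 k
  have hσ := t.hσ
  have hS : tl k (x L) (xi P0) ∈ S := up t.hS t.hP0 (t.top L hL) h1 h2 (by rw [t.eq L hL]; exact t.mem L hL)
  have hb : ∀ y, ‖V volume (cht P0 k) (x L - y) * HH g P0 k y‖ ≤ 32 * CB ^ 2 * √C0 * σ * (2 ^ k)⁻¹ * w 4 k (x L - y) := by
    intro y
    rw [norm_mul]
    have a := V_scale nch k (mm P0 k) (x L - y)
    have b := U_bd t.hg (P := tl k (x L) (xi P0)) hσ (t.hA _ hS) (y0 := x L) rfl (xi P0) y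
    have e : w 10 k (x L - y) * d k (y - x L) ^ 5 ≤ w 4 k (x L - y) := by
      rw [d_comm]
      have w5 : w 10 k (x L - y) * d k (x L - y) ^ 5 = w 5 k (x L - y) := by
        have := d_pos k (x L - y); unfold w; field_simp
      rw [w5]; exact w_anti (by norm_num) _ _
    calc _ ≤ (CB * (2 ^ k)⁻¹ * w 10 k (x L - y)) * (32 * CB * √C0 * σ * d k (y - x L) ^ 5) := by
          exact mul_le_mul a b (norm_nonneg _) ((norm_nonneg _).trans a)
      _ = 32 * CB ^ 2 * √C0 * σ * (2 ^ k)⁻¹ * (w 10 k (x L - y) * d k (y - x L) ^ 5) := by ring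
      _ ≤ _ := by gcongr
  have hi : Integrable (fun y => V volume (cht P0 k) (x L - y) * HH g P0 k y) :=
    ((intwc (n := 4) (by norm_num) k (x L)).const_mul (32 * CB ^ 2 * √C0 * σ * (2 ^ k)⁻¹)).mono'
      (((cont_V (int_cht k)).comp (by fun_prop : Continuous fun y => x L - y)).mul (cont_HH t.hg k)).aestronglyMeasurable
      (Eventually.of_forall hb)
  have r := REP (int_UU t.hg k (mm P0 k) (xi P0)) k (mm P0 k) cht_HH (x L)
  change HH g P0 k (x L) = ∫ y, V volume (cht P0 k) (x L - y) * HH g P0 k y at r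
  rw [r, ← main_fub t.hg, ← integral_add_compl (meas_Om (S := S) (P0 := P0) k) hi, add_sub_cancel_left]
  refine (norm_integral_le_of_norm_le ((intwc (n := 4) (by norm_num) k (x L)).const_mul (32 * CB ^ 2 * √C0 * σ * (2 ^ k)⁻¹)).integrableOn
    (Eventually.of_forall hb)).trans_eq ?_
  rw [integral_const_mul]; ring

end
end
end CF


namespace CF
noncomputable section
open Complex (I)
open scoped ComplexConjugate Classical

def CT1 : ℝ := 32 * CB ^ 2 * √C0 * (160 * C0 ^ 2) + 2 * √(131072 * CB ^ 6 * C0 ^ 5)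
def CT : ℝ := CT1 + 2 * (32 * CB * √C0 + 4 * π * (32 * CB * √C0))
lemma CT_pos : 0 < CT := by
  have := C0_pos; have := CBp; have := pi_pos; unfold CT CT1; positivity

section
variable {S : Finset Tile} {P0 : Tile} {g : ℝ → ℂ} {σ : ℝ} {Λ : Finset Tile} {x : Tile → ℝ}

def Mk (g : ℝ → ℂ) (S : Finset Tile) (P0 : Tile) (k : ℤ) (z : ℝ) : ℂ :=
  V volume (fun η => cht P0 k η * V volume (bn g S P0 k) η) z

lemma Ph_la (hg : Integrable g) (j : ℤ) (z : ℝ) :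
    V volume (fun η => Ph g S P0 η * la (2 ^ j * η - mm P0 j)) z = ∑ k ∈ RR S P0 with j ≤ k, Mk g S P0 k z := by
  have e : ∀ η, Ph g S P0 η * la (2 ^ j * η - mm P0 j) * ex (z * η)
      = ∑ k ∈ RR S P0 with j ≤ k, cht P0 k η * V volume (bn g S P0 k) η * ex (z * η) := by
    intro η
    rw [Ph, Finset.sum_mul, Finset.sum_mul, Finset.sum_filter]
    refine Finset.sum_congr rfl fun k hk => ?_
    have := cht_lat (k' := j) (Finset.mem_filter.1 hk).2.2 η
    unfold lat at this
    split_ifs at this ⊢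
    · linear_combination (V volume (bn g S P0 k) η * ex (z * η)) * this
    · linear_combination (V volume (bn g S P0 k) η * ex (z * η)) * this
  unfold Mk; rw [V]; simp_rw [e]
  rw [integral_finsetSum _ fun k _ => intg_ex (int_chV hg k) (by fun_prop)]
  rfl

lemma TS.main (t : TS g S P0 σ Λ x) (K : Tile → ℤ) (hK1 : ∀ L ∈ Λ, L.1 ≤ K L) (hK2 : ∀ L ∈ Λ, K L ≤ P0.1) :
    ∑ L ∈ Λ, 2 ^ L.1 * ‖∑ k ∈ Finset.Ico L.1 (K L), HH g P0 k (x L)‖ ≤ CT1 * σ * 2 ^ P0.1 := by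
  have c0 := C0_pos; have cb := CBp; have hσ := t.hσ
  have p0 := p2 P0.1
  have tm : ∀ κ : Tile → ℤ, (∀ L ∈ Λ, L.1 ≤ κ L) →
      ∑ L ∈ Λ, 2 ^ L.1 * ‖∑ k ∈ RR S P0 with κ L ≤ k, Mk g S P0 k (x L)‖ ≤ √(131072 * CB ^ 6 * C0 ^ 5) * σ * 2 ^ P0.1 := by
    intro κ hκ
    have h := t.TM κ hκ (fun k => mm P0 k) (int_Ph (S := S) (P0 := P0) t.hg) (Ph_L2 t.hg).1
    simp_rw [Ph_la t.hg] at h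
    refine le_of_sq_le_sq (h.trans ?_) (by positivity)
    calc _ ≤ 128 * CB ^ 2 * C0 ^ 2 * 2 ^ P0.1 * (1024 * CB ^ 4 * C0 ^ 3 * (σ ^ 2 * 2 ^ P0.1)) := by
          gcongr; refine (Ph_L2 t.hg).2.trans ?_; gcongr; exact t.hen
      _ = _ := by
          rw [mul_pow, mul_pow, sq_sqrt (by positivity)]; ring
  have dec : ∀ L ∈ Λ, 2 ^ L.1 * ‖∑ k ∈ Finset.Ico L.1 (K L), HH g P0 k (x L)‖ ≤
      (∑ k ∈ RR S P0 with L.1 ≤ k, 32 * CB ^ 2 * √C0 * σ * (2 ^ L.1 * ((2 ^ k)⁻¹ * ∫ y in (Om S P0 k)ᶜ, w 4 k (x L - y))))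
      + (2 ^ L.1 * ‖∑ k ∈ RR S P0 with L.1 ≤ k, Mk g S P0 k (x L)‖ + 2 ^ L.1 * ‖∑ k ∈ RR S P0 with K L ≤ k, Mk g S P0 k (x L)‖) := by
    intro L hL
    have pL := p2 L.1
    have e1 : ∑ k ∈ Finset.Ico L.1 (K L), HH g P0 k (x L) = ∑ k ∈ RR S P0 with L.1 ≤ k ∧ k < K L, HH g P0 k (x L) := by
      symm
      refine Finset.sum_subset (fun k hk => ?_) (fun k hk hn => ?_)
      · rw [Finset.mem_filter] at hk; exact Finset.mem_Ico.2 hk.2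
      · rw [Finset.mem_Ico] at hk
        apply HH_zero
        intro hty
        apply hn
        have := hK2 L hL
        have hS : tl k (x L) (xi P0) ∈ S := up t.hS t.hP0 (t.top L hL) hk.1 (by omega) (by rw [t.eq L hL]; exact t.mem L hL)
        exact Finset.mem_filter.2 ⟨Finset.mem_filter.2 ⟨Finset.mem_image.2 ⟨_, hS, rfl⟩, by omega, hty⟩, hk⟩
    have e2 : ∑ k ∈ RR S P0 with L.1 ≤ k ∧ k < K L, Mk g S P0 k (x L)
        = ∑ k ∈ RR S P0 with L.1 ≤ k, Mk g S P0 k (x L) - ∑ k ∈ RR S P0 with K L ≤ k, Mk g S P0 k (x L) := by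
      simp_rw [Finset.sum_filter]; rw [← Finset.sum_sub_distrib]
      refine Finset.sum_congr rfl fun k _ => ?_
      have := hK1 L hL
      split_ifs <;> first | omega | simp
    have e3 : ∑ k ∈ RR S P0 with L.1 ≤ k ∧ k < K L, HH g P0 k (x L) =
        ∑ k ∈ RR S P0 with L.1 ≤ k ∧ k < K L, (HH g P0 k (x L) - Mk g S P0 k (x L)) +
        ∑ k ∈ RR S P0 with L.1 ≤ k ∧ k < K L, Mk g S P0 k (x L) := by
      rw [← Finset.sum_add_distrib]; simp
    have b1 : ‖∑ k ∈ RR S P0 with L.1 ≤ k ∧ k < K L, (HH g P0 k (x L) - Mk g S P0 k (x L))‖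
        ≤ ∑ k ∈ RR S P0 with L.1 ≤ k, 32 * CB ^ 2 * √C0 * σ * ((2 ^ k)⁻¹ * ∫ y in (Om S P0 k)ᶜ, w 4 k (x L - y)) := by
      refine (norm_sum_le _ _).trans ((Finset.sum_le_sum fun k hk => ?_).trans
        (Finset.sum_le_sum_of_subset_of_nonneg (fun k hk => ?_) fun k _ _ => ?_))
      · rw [Finset.mem_filter] at hk
        have := hK2 L hL
        exact t.split hL hk.2.1 (by omega)
      · rw [Finset.mem_filter] at hk ⊢; exact ⟨hk.1, hk.2.1⟩
      · have := p2 k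
        have : 0 ≤ ∫ y in (Om S P0 k)ᶜ, w 4 k (x L - y) := integral_nonneg fun y => (w_pos _ _ _).le
        positivity
    have b2 := norm_sub_le (∑ k ∈ RR S P0 with L.1 ≤ k, Mk g S P0 k (x L)) (∑ k ∈ RR S P0 with K L ≤ k, Mk g S P0 k (x L))
    calc _ ≤ 2 ^ L.1 * ((∑ k ∈ RR S P0 with L.1 ≤ k, 32 * CB ^ 2 * √C0 * σ * ((2 ^ k)⁻¹ * ∫ y in (Om S P0 k)ᶜ, w 4 k (x L - y)))
          + (‖∑ k ∈ RR S P0 with L.1 ≤ k, Mk g S P0 k (x L)‖ + ‖∑ k ∈ RR S P0 with K L ≤ k, Mk g S P0 k (x L)‖)) := by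
          rw [e1, e3, e2]; gcongr; exact (norm_add_le _ _).trans (add_le_add b1 b2)
      _ = _ := by
          rw [mul_add, mul_add, Finset.mul_sum]; congr 1
          refine Finset.sum_congr rfl fun k _ => ?_
          ring
  refine (Finset.sum_le_sum dec).trans ?_
  rw [Finset.sum_add_distrib, Finset.sum_add_distrib]
  have o : ∑ L ∈ Λ, ∑ k ∈ RR S P0 with L.1 ≤ k, 32 * CB ^ 2 * √C0 * σ * (2 ^ L.1 * ((2 ^ k)⁻¹ * ∫ y in (Om S P0 k)ᶜ, w 4 k (x L - y)))
      ≤ 32 * CB ^ 2 * √C0 * σ * (160 * C0 ^ 2 * 2 ^ P0.1) := by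
    have := t.out (RR S P0) fun k hk => (Finset.mem_filter.1 hk).2.1.le
    simp_rw [← Finset.mul_sum]
    refine mul_le_mul_of_nonneg_left (le_trans (le_of_eq ?_) this) (by positivity)
    simp_rw [Finset.mul_sum, Finset.sum_filter]
    exact Finset.sum_comm
  have := tm Prod.fst fun L _ => le_rfl
  have := tm K hK1
  unfold CT1
  calc _ ≤ 32 * CB ^ 2 * √C0 * σ * (160 * C0 ^ 2 * 2 ^ P0.1) + (√(131072 * CB ^ 6 * C0 ^ 5) * σ * 2 ^ P0.1 + √(131072 * CB ^ 6 * C0 ^ 5) * σ * 2 ^ P0.1) := by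
        gcongr
    _ = _ := by ring

lemma TS.tree (t : TS g S P0 σ Λ x) (K : Tile → ℤ) (hK1 : ∀ L ∈ Λ, L.1 ≤ K L) (hK2 : ∀ L ∈ Λ, K L ≤ P0.1)
    (N : Tile → ℝ) (hN : ∀ L ∈ Λ, fl (-K L) (N L) = fl (-K L) (xi P0)) :
    ∑ L ∈ Λ, 2 ^ L.1 * ‖∑ k ∈ Finset.Icc L.1 (K L), UU g k (mm P0 k) (N L) (x L)‖ ≤ CT * σ * 2 ^ P0.1 := by
  have c0 := C0_pos; have cb := CBp; have hσ := t.hσ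
  have p0 := p2 P0.1; have pp := pi_pos
  set u := 32 * CB * √C0 * σ with hu
  have dec : ∀ L ∈ Λ, 2 ^ L.1 * ‖∑ k ∈ Finset.Icc L.1 (K L), UU g k (mm P0 k) (N L) (x L)‖
      ≤ 2 ^ L.1 * ‖∑ k ∈ Finset.Ico L.1 (K L), HH g P0 k (x L)‖ + 2 ^ L.1 * (u + 4 * π * u) := by
    intro L hL
    have pL := p2 L.1
    have k1 := hK1 L hL; have k2 := hK2 L hL
    have hS : ∀ k, L.1 ≤ k → k ≤ K L → tl k (x L) (xi P0) ∈ S := fun k h1 h2 =>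
      up t.hS t.hP0 (t.top L hL) h1 (by omega) (by rw [t.eq L hL]; exact t.mem L hL)
    rw [← mul_add]; gcongr
    rw [← Finset.Ico_insert_right k1, Finset.sum_insert (by simp)]
    have a1 : ‖UU g (K L) (mm P0 (K L)) (N L) (x L)‖ ≤ u := by
      have := U_bd t.hg (P := tl (K L) (x L) (xi P0)) hσ (t.hA _ (hS _ k1 le_rfl)) (y0 := x L) rfl (N L) (x L)
      rw [sub_self] at this
      simpa [d, tl, mm] using this
    have a2 : ‖∑ k ∈ Finset.Ico L.1 (K L), (UU g k (mm P0 k) (N L) (x L) - HH g P0 k (x L))‖ ≤ 4 * π * u := by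
      have pK := p2 (K L)
      have hd : |2 ^ K L * N L - 2 ^ K L * xi P0| ≤ 1 := by
        have a := fl_neg_iff.1 (hN L hL); have b := fl_neg_iff.1 (rfl : fl (-K L) (xi P0) = _)
        rw [abs_le]; constructor <;> linarith
      calc _ ≤ ∑ k ∈ Finset.Ico L.1 (K L), 2 * π * u * (2 ^ K L)⁻¹ * 2 ^ k := by
            refine norm_sum_le_of_le _ fun k hk => ?_
            rw [Finset.mem_Ico] at hk
            have pk := p2 k
            have := U_diff t.hg (P := tl k (x L) (xi P0)) hσ (t.hA _ (hS _ hk.1 hk.2.le)) (y0 := x L) rfl (N L) (xi P0)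
            refine this.trans ?_
            have e : |2 ^ k * N L - 2 ^ k * xi P0| ≤ (2 ^ K L)⁻¹ * 2 ^ k := by
              have : 2 ^ k * N L - 2 ^ k * xi P0 = (2 ^ K L)⁻¹ * 2 ^ k * (2 ^ K L * N L - 2 ^ K L * xi P0) := by
                field_simp
              rw [this, abs_mul, abs_of_pos (by positivity)]
              exact mul_le_of_le_one_right (by positivity) hd
            calc _ ≤ 2 * π * ((2 ^ K L)⁻¹ * 2 ^ k) * u := by
                  have : (tl k (x L) (xi P0)).1 = k := rfl
                  rw [this]; gcongr
              _ = _ := by ring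
        _ ≤ 2 * π * u * (2 ^ K L)⁻¹ * (2 * 2 ^ K L) := by
            rw [← Finset.mul_sum]; gcongr
            exact GEO0 _ _ fun k hk => (Finset.mem_Ico.1 hk).2.le
        _ = _ := by field_simp; ring
    rw [Finset.sum_sub_distrib] at a2
    have := norm_sub_norm_le (∑ k ∈ Finset.Ico L.1 (K L), UU g k (mm P0 k) (N L) (x L)) (∑ k ∈ Finset.Ico L.1 (K L), HH g P0 k (x L))
    have := norm_add_le (UU g (K L) (mm P0 (K L)) (N L) (x L)) (∑ k ∈ Finset.Ico L.1 (K L), UU g k (mm P0 k) (N L) (x L))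
    linarith
  refine (Finset.sum_le_sum dec).trans ?_
  rw [Finset.sum_add_distrib, ← Finset.sum_mul]
  have := t.main K hK1 hK2
  calc _ ≤ CT1 * σ * 2 ^ P0.1 + (2 * 2 ^ P0.1) * (u + 4 * π * u) := by gcongr; exact t.sum0
    _ = _ := by rw [hu]; unfold CT; ring
end
end
end CF


namespace CF
noncomputable section
open Complex (I)
open scoped ComplexConjugate Classical

lemma UU_cont {g : ℝ → ℂ} (hg : Integrable g) (k : ℤ) (m : ℝ) : Continuous (fun z : ℝ × ℝ => UU g k m z.1 z.2) := by
  unfold UU V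
  refine continuous_of_dominated (bound := fun η => CB * ‖Gt g k m η‖) (fun z => ?_) (fun z => ?_) ((int_Gt hg k m).norm.const_mul _) ?_
  · exact (intg_ex (int_UU hg k m z.1) (by fun_prop)).aestronglyMeasurable
  · refine Eventually.of_forall fun η => ?_
    rw [norm_mul, norm_ex, mul_one, norm_mul]
    gcongr; exact nps.bd _
  · refine Eventually.of_forall fun η => ?_
    exact ((nps.cont.comp (by fun_prop)).mul continuous_const).mul (cont_ex.comp (by fun_prop))
lemma UU_bd {g : ℝ → ℂ} (hg : Integrable g) (k : ℤ) (m N y : ℝ) : ‖UU g k m N y‖ ≤ CB * ∫ η, ‖Gt g k m η‖ := by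
  refine (norm_V_le _ _).trans ?_
  rw [← integral_const_mul]
  refine integral_mono (int_UU hg k m N).norm ((int_Gt hg k m).norm.const_mul _) fun η => ?_
  simp only [norm_mul (ps _)]; gcongr; exact nps.bd _

def yy (g : ℝ → ℂ) (N : ℝ → ℝ) (P : Tile) (x : ℝ) : ℂ := if P = tl P.1 x (N x) then UU g P.1 P.2.2 (N x) x else 0

section
variable {g : ℝ → ℂ} {N : ℝ → ℝ}
lemma yy_meas (hg : Integrable g) (hN : Measurable N) (P : Tile) : Measurable (yy g N P) := by
  have h : Measurable fun x => UU g P.1 P.2.2 (N x) x := by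
    have h0 : Measurable (fun x => (N x, x)) := hN.prodMk measurable_id
    have h1 := (UU_cont hg P.1 (P.2.2:ℝ)).measurable
    have h2 := Measurable.comp h1 h0
    simp only [Function.comp_def] at h2
    exact h2
  exact Measurable.ite (meas_tile hN P) h measurable_const
lemma yy_bd (hg : Integrable g) (P : Tile) (x : ℝ) : ‖yy g N P x‖ ≤ CB * ∫ η, ‖Gt g P.1 P.2.2 η‖ := by
  unfold yy; split_ifs
  · exact UU_bd hg _ _ _ _
  · rw [norm_zero]; have := CBp; have : 0 ≤ ∫ η, ‖Gt g P.1 P.2.2 η‖ := integral_nonneg fun _ => norm_nonneg _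
    positivity
lemma yy_int (hg : Integrable g) (hN : Measurable N) (P : Tile) {E : Set ℝ} (hEf : volume E ≠ ⊤) : IntegrableOn (yy g N P) E :=
  IntegrableOn.of_bound hEf.lt_top (yy_meas hg hN P).aestronglyMeasurable _ (Eventually.of_forall (yy_bd hg P))

def FT (g : ℝ → ℂ) (N : ℝ → ℝ) (S : Finset Tile) (P0 : Tile) (x : ℝ) : ℂ := ∑ P ∈ S with le P P0, yy g N P x
lemma FT_int (hg : Integrable g) (hN : Measurable N) (S P0) {E : Set ℝ} (hEf : volume E ≠ ⊤) : IntegrableOn (FT g N S P0) E :=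
  integrable_finsetSum _ fun P _ => yy_int hg hN P hEf

def AL (N : ℝ → ℝ) (E : Set ℝ) (S : Finset Tile) (P0 L : Tile) : Set ℝ :=
  {x | (x ∈ E ∧ L = tl L.1 x (N x)) ∧ x ∈ II P0 ∧ L = tl L.1 x (xi P0) ∧ tl (L.1 - 1) x (xi P0) ∉ S}

variable {S : Finset Tile} {P0 : Tile}

lemma meas_AL (hN : Measurable N) {E : Set ℝ} (hE : MeasurableSet E) (L : Tile) : MeasurableSet (AL N E S P0 L) := by
  refine (hE.inter (meas_tile hN L)).inter ((meas_II P0).inter ((meas_tile measurable_const L).inter ?_))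
  refine MeasurableSet.compl ?_
  change MeasurableSet {y | tl (L.1 - 1) y (xi P0) ∈ S}
  have : {y | tl (L.1 - 1) y (xi P0) ∈ S} = (fun y => tl (L.1 - 1) y (xi P0)) ⁻¹' S := rfl
  rw [this]
  exact Measurable.comp (g := id) measurable_id (measurable_const.prodMk ((meas_fl _).prodMk measurable_const)) (Finset.measurableSet S)

lemma tile_iff {P : Tile} {x : ℝ} {n : ℝ} : (le P P0 ∧ P = tl P.1 x n) ↔
    P.1 ≤ P0.1 ∧ x ∈ II P0 ∧ P = tl P.1 x (xi P0) ∧ fl (-P.1) n = fl (-P.1) (xi P0) := by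
  constructor
  · rintro ⟨h1, h2⟩
    obtain ⟨a, b⟩ := tl_eq.1 h2
    obtain ⟨c1, c2, c3⟩ := (le_iff a (fl_xi P0)).1 h1
    exact ⟨c1, c2, tl_eq.2 ⟨a, c3⟩, b.trans c3.symm⟩
  · rintro ⟨h1, h2, h3, h4⟩
    obtain ⟨a, b⟩ := tl_eq.1 h3
    exact ⟨(le_iff a (fl_xi P0)).2 ⟨h1, h2, b⟩, tl_eq.2 ⟨a, h4.trans b⟩⟩

lemma FT_cover {E : Set ℝ} {x : ℝ} (hx : x ∈ E) (h : FT g N S P0 x ≠ 0) : ∃ L ∈ S, x ∈ AL N E S P0 L := by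
  obtain ⟨P, hP, hy⟩ := Finset.exists_ne_zero_of_sum_ne_zero h
  rw [Finset.mem_filter] at hP
  have hP2 : P = tl P.1 x (N x) := by by_contra hc; exact hy (if_neg hc)
  obtain ⟨h1, h2, h3, h4⟩ := tile_iff.1 ⟨hP.2, hP2⟩
  obtain ⟨L, hL, hmin⟩ := Finset.exists_min_image (S.filter (fun P => P = tl P.1 x (xi P0))) Prod.fst ⟨P, Finset.mem_filter.2 ⟨hP.1, h3⟩⟩
  rw [Finset.mem_filter] at hL
  have hl := hmin P (Finset.mem_filter.2 ⟨hP.1, h3⟩)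
  refine ⟨L, hL.1, ⟨hx, ?_⟩, h2, hL.2, fun hc => ?_⟩
  · rw [tl_eq] at hL ⊢
    exact ⟨hL.2.1, (fl_mono (neg_le_neg hl) h4).trans hL.2.2⟩
  · have := hmin _ (Finset.mem_filter.2 ⟨hc, rfl⟩)
    simp only [tl] at this; omega

lemma FT_eq (hS : Cvx S) (hP0 : P0 ∈ S) {E : Set ℝ} {L : Tile} (hL : L ∈ S) (hL0 : L.1 ≤ P0.1) {x : ℝ} (hx : x ∈ AL N E S P0 L) :
    ∃ K, L.1 ≤ K ∧ K ≤ P0.1 ∧ fl (-K) (N x) = fl (-K) (xi P0) ∧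
      FT g N S P0 x = ∑ k ∈ Finset.Icc L.1 K, UU g k (mm P0 k) (N x) x := by
  obtain ⟨⟨hE, h1⟩, h2, h3, h4⟩ := hx
  have hNL : fl (-L.1) (N x) = fl (-L.1) (xi P0) := by
    rw [(tl_eq.1 h1).2, (tl_eq.1 h3).2]
  obtain ⟨K, hK, hmax⟩ := Finset.exists_max_image ((Finset.Icc L.1 P0.1).filter (fun k => fl (-k) (N x) = fl (-k) (xi P0))) id
    ⟨L.1, by simp [hL0, hNL]⟩
  rw [Finset.mem_filter, Finset.mem_Icc] at hK
  refine ⟨K, hK.1.1, hK.1.2, hK.2, ?_⟩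
  have himg : (S.filter (fun P => le P P0)).filter (fun P => P = tl P.1 x (N x)) = (Finset.Icc L.1 K).image (fun k => tl k x (xi P0)) := by
    ext P
    rw [Finset.filter_filter, Finset.mem_filter, tile_iff, Finset.mem_image]
    constructor
    · rintro ⟨hP, a, b, c, e⟩
      have hPL : L.1 ≤ P.1 := by
        by_contra hc
        apply h4
        exact up hS hP0 h2 (show P.1 ≤ L.1 - 1 by omega) (by omega) (c ▸ hP)
      exact ⟨P.1, Finset.mem_Icc.2 ⟨hPL, hmax P.1 (Finset.mem_filter.2 ⟨Finset.mem_Icc.2 ⟨hPL, a⟩, e⟩)⟩, c.symm⟩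
    · rintro ⟨k, hk, rfl⟩
      rw [Finset.mem_Icc] at hk
      exact ⟨up hS hP0 h2 hk.1 (hk.2.trans hK.1.2) (h3 ▸ hL), hk.2.trans hK.1.2, h2, rfl, fl_mono (neg_le_neg hk.2) hK.2⟩
  unfold FT yy
  rw [← Finset.sum_filter, himg, Finset.sum_image]
  · rfl
  · intro a _ b _ h; exact congrArg Prod.fst h

lemma TL (hg : Integrable g) (hN : Measurable N) {E : Set ℝ} (hE : MeasurableSet E) (hEf : volume E ≠ ⊤)
    {σ μ : ℝ} (hσ : 0 ≤ σ) (hμ : 0 ≤ μ) (hS : Cvx S) (hP0 : P0 ∈ S) (hA : ∀ P ∈ S, A g P ≤ σ ^ 2 * 2 ^ P.1)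
    (hen : en g S P0 ≤ σ ^ 2 * 2 ^ P0.1) (hdn : ∀ P ∈ S, dn N E P ≤ μ * 2 ^ P.1) :
    ∫ x in E, ‖FT g N S P0 x‖ ≤ CT * σ * μ * 2 ^ P0.1 := by
  have sub : ∀ L, AL N E S P0 L ⊆ E := fun L x hx => hx.1.1
  have fin : ∀ L, volume (AL N E S P0 L) ≠ ⊤ := fun L => ((measure_mono (sub L)).trans_lt hEf.lt_top).ne
  have fi : ∀ L, IntegrableOn (fun x => ‖FT g N S P0 x‖) (AL N E S P0 L) := fun L => (FT_int hg hN S P0 (fin L)).norm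
  have hex : ∀ L, ∃ x, volume (AL N E S P0 L) ≠ 0 → x ∈ AL N E S P0 L ∧
      ∫ x in AL N E S P0 L, ‖FT g N S P0 x‖ ≤ volume.real (AL N E S P0 L) * ‖FT g N S P0 x‖ := by
    intro L
    by_cases h : volume (AL N E S P0 L) = 0
    · exact ⟨0, fun h' => absurd h h'⟩
    · obtain ⟨x, hx, hle⟩ := exists_setAverage_le h (fin L) (fi L)
      refine ⟨x, fun _ => ⟨hx, ?_⟩⟩
      rw [setAverage_eq, smul_eq_mul, inv_mul_le_iff₀ (show 0 < volume.real (AL N E S P0 L) from ENNReal.toReal_pos h (fin L))] at hle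
      exact hle
  choose x hx using hex
  set Λ := S.filter (fun L => volume (AL N E S P0 L) ≠ 0) with hΛ
  have hxL : ∀ L ∈ Λ, x L ∈ AL N E S P0 L := fun L hL => (hx L (Finset.mem_filter.1 hL).2).1
  have lek : ∀ L ∈ Λ, L.1 ≤ P0.1 := by
    intro L hL
    obtain ⟨-, h2, h3, h4⟩ := hxL L hL
    by_contra hc
    apply h4
    have := hS (x L) (xi P0) P0.1 (L.1 - 1) L.1 (by omega) (by omega) (by rw [tl_top h2]; exact hP0) (h3 ▸ (Finset.mem_filter.1 hL).1)
    exact this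
  have t : TS g S P0 σ Λ x := ⟨hg, hσ, hS, hP0, hA, hen, fun L hL => (Finset.mem_filter.1 hL).1, lek,
    fun L hL => (hxL L hL).2.2.1.symm, fun L hL => (hxL L hL).2.1, fun L hL => (hxL L hL).2.2.2⟩
  have hK : ∀ L, ∃ K, L ∈ Λ → L.1 ≤ K ∧ K ≤ P0.1 ∧ fl (-K) (N (x L)) = fl (-K) (xi P0) ∧
      FT g N S P0 (x L) = ∑ k ∈ Finset.Icc L.1 K, UU g k (mm P0 k) (N (x L)) (x L) := by
    intro L
    by_cases hL : L ∈ Λ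
    · obtain ⟨K, h⟩ := FT_eq (g := g) hS hP0 (t.mem L hL) (lek L hL) (hxL L hL)
      exact ⟨K, fun _ => h⟩
    · exact ⟨0, fun h => absurd h hL⟩
  choose K hK using hK
  have tr := t.tree K (fun L hL => (hK L hL).1) (fun L hL => (hK L hL).2.1) (fun L => N (x L)) (fun L hL => (hK L hL).2.2.1)
  have ii : ∀ L, Integrable (indicator (AL N E S P0 L) (fun x => ‖FT g N S P0 x‖)) := fun L =>
    (integrable_indicator_iff (meas_AL hN hE L)).2 (fi L)
  calc ∫ x in E, ‖FT g N S P0 x‖ ≤ ∫ x in E, ∑ L ∈ S, indicator (AL N E S P0 L) (fun x => ‖FT g N S P0 x‖) x := by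
        refine setIntegral_mono_on (FT_int hg hN S P0 hEf).norm (integrable_finsetSum _ fun L _ => (ii L)).integrableOn hE fun z hz => ?_
        have nn : ∀ L ∈ S, 0 ≤ indicator (AL N E S P0 L) (fun x => ‖FT g N S P0 x‖) z := fun L _ => indicator_nonneg (fun _ _ => norm_nonneg _) z
        by_cases h : FT g N S P0 z = 0
        · rw [h, norm_zero]; exact Finset.sum_nonneg nn
        · obtain ⟨L, hL, hz⟩ := FT_cover hz h
          refine le_trans (le_of_eq ?_) (Finset.single_le_sum nn hL)
          rw [indicator_of_mem hz]
    _ = ∑ L ∈ S, ∫ x in AL N E S P0 L, ‖FT g N S P0 x‖ := by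
        rw [integral_finsetSum _ fun L _ => (ii L).integrableOn]
        refine Finset.sum_congr rfl fun L _ => ?_
        rw [setIntegral_indicator (meas_AL hN hE L), inter_eq_self_of_subset_right (sub L)]
    _ = ∑ L ∈ Λ, ∫ x in AL N E S P0 L, ‖FT g N S P0 x‖ := by
        symm
        refine Finset.sum_subset (Finset.filter_subset _ _) fun L hL hn => ?_
        have : volume (AL N E S P0 L) = 0 := by by_contra h; exact hn (Finset.mem_filter.2 ⟨hL, h⟩)
        exact setIntegral_measure_zero _ this
    _ ≤ ∑ L ∈ Λ, μ * (2 ^ L.1 * ‖∑ k ∈ Finset.Icc L.1 (K L), UU g k (mm P0 k) (N (x L)) (x L)‖) := by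
        refine Finset.sum_le_sum fun L hL => ?_
        refine (hx L (Finset.mem_filter.1 hL).2).2.trans ?_
        rw [← (hK L hL).2.2.2, ← mul_assoc]
        gcongr
        refine le_trans (measureReal_mono (fun z hz => hz.1) ?_) (hdn L (t.mem L hL))
        exact ((measure_mono fun z hz => hz.1).trans_lt hEf.lt_top).ne
    _ ≤ μ * (CT * σ * 2 ^ P0.1) := by rw [← Finset.mul_sum]; gcongr
    _ = _ := by ring
end
end
end CF


namespace CF
noncomputable section
open Complex (I)
open scoped ComplexConjugate Classical

lemma dn_le (N : ℝ → ℝ) (E : Set ℝ) (P : Tile) : dn N E P ≤ 2 ^ P.1 := by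
  rw [← vol_II]
  exact measureReal_mono (fun x hx => (tl_eq.1 hx.2).1) (II_fin P)

def Phi (j : ℤ) : ℝ := if j ≤ 0 then 3 - 2 ^ j else 2 * (2 ^ j)⁻¹
lemma Phi_nonneg (j : ℤ) : 0 ≤ Phi j := by
  unfold Phi; have := p2 j
  split_ifs with h
  · have : (2:ℝ) ^ j ≤ 1 := zpow_le_one_of_nonpos₀ (by norm_num) h
    linarith
  · positivity
lemma Phi_le (j : ℤ) (hj : j ≤ 0) : Phi j ≤ 3 := by
  unfold Phi; have := p2 j
  rw [if_pos hj]; linarith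
lemma Phi_step (j : ℤ) : 2 ^ j * min 1 (4 ^ j)⁻¹ ≤ Phi j - Phi (j + 1) := by
  have h4 : (4:ℝ) ^ j = 2 ^ j * 2 ^ j := by rw [← mul_zpow]; norm_num
  have := p2 j
  have e : (2:ℝ) ^ (j + 1) = 2 ^ j * 2 := zpow_add_one₀ two_ne_zero _
  rcases lt_trichotomy j 0 with h | h | h
  · have : Phi j - Phi (j+1) = 2 ^ j := by
      unfold Phi; rw [if_pos h.le, if_pos (by omega), e]; ring
    rw [this]
    exact mul_le_of_le_one_right (p2 j).le (min_le_left _ _)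
  · subst h; norm_num [Phi]
  · have : Phi j - Phi (j+1) = (2 ^ j)⁻¹ := by
      unfold Phi; rw [if_neg (by omega), if_neg (by omega), e]; field_simp; norm_num
    rw [this]
    refine (mul_le_mul_of_nonneg_left (min_le_right _ _) (p2 j).le).trans (le_of_eq ?_)
    rw [h4]; field_simp

section
variable {g : ℝ → ℂ} {N : ℝ → ℝ} {E : Set ℝ} {G e : ℝ}

structure St (g : ℝ → ℂ) (N : ℝ → ℝ) (E : Set ℝ) (r : ℝ) (j : ℤ) (S : Finset Tile) : Prop where
  cvx : Cvx S
  en : ∀ P ∈ S, en g S P ≤ ((2 ^ j)⁻¹ * r) ^ 2 * 2 ^ P.1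
  dn : ∀ P ∈ S, dn N E P ≤ min 1 (4 ^ j)⁻¹ * 2 ^ P.1

lemma St.A {r : ℝ} {j : ℤ} {S : Finset Tile} (s : St g N E r j S) : ∀ P ∈ S, A g P ≤ ((2 ^ j)⁻¹ * r) ^ 2 * 2 ^ P.1 := by
  intro P hP
  refine le_trans ?_ (s.en P hP)
  exact Finset.single_le_sum (f := CF.A g) (fun Q _ => A_nonneg g Q) (Finset.mem_filter.2 ⟨hP, le_refl' P, fl_xi' P⟩)

def C1 : ℝ := 4 * CT * (1 + CS1)

/-- cost of a forest -/
lemma forest (hg : Integrable g) (hN : Measurable N) (hE : MeasurableSet E) (hEf : volume E ≠ ⊤)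
    {r : ℝ} (hr : 0 ≤ r) {j : ℤ} {S S' Sx Tp : Finset Tile} {T f B} (s : St g N E r j S) (hx : Sx ⊆ S) (D : Dec f B Sx S' Tp T) :
    ∫ x in E, ‖∑ P ∈ Sx, yy g N P x‖ ≤ (∫ x in E, ‖∑ P ∈ S', yy g N P x‖) +
      CT * ((2 ^ j)⁻¹ * r) * min 1 (4 ^ j)⁻¹ * ∑ P ∈ Tp, (2:ℝ) ^ P.1 := by
  have i1 : ∀ S : Finset Tile, IntegrableOn (fun x => ‖∑ P ∈ S, yy g N P x‖) E := fun S =>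
    (integrable_finsetSum S fun P _ => yy_int hg hN P hEf).norm
  have i2 : ∀ P0, IntegrableOn (fun x => ‖FT g N (T P0) P0 x‖) E := fun P0 => (FT_int hg hN _ _ hEf).norm
  have i3 : IntegrableOn (fun x => ∑ P0 ∈ Tp, ‖FT g N (T P0) P0 x‖) E := integrable_finsetSum _ fun P _ => i2 P
  calc ∫ x in E, ‖∑ P ∈ Sx, yy g N P x‖ ≤ ∫ x in E, (‖∑ P ∈ S', yy g N P x‖ + ∑ P0 ∈ Tp, ‖FT g N (T P0) P0 x‖) := by
        refine integral_mono (i1 _) ((i1 _).add i3) fun x => ?_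
        simp only
        rw [D.sum]
        exact (norm_add_le _ _).trans (add_le_add le_rfl (norm_sum_le _ _))
    _ = (∫ x in E, ‖∑ P ∈ S', yy g N P x‖) + ∑ P0 ∈ Tp, ∫ x in E, ‖FT g N (T P0) P0 x‖ := by
        rw [integral_add (i1 _) i3, integral_finsetSum _ fun P _ => i2 P]
    _ ≤ _ := by
        rw [Finset.mul_sum]
        gcongr with P0 h0
        have sub := (D.Tsub P0 h0).trans hx
        refine TL hg hN hE hEf (by positivity) (by positivity) (D.Tcvx P0 h0) (D.top P0 h0) (fun P hP => s.A P (sub hP)) ?_ fun P hP => s.dn P (sub hP)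
        exact (en_mono g sub P0).trans (s.en P0 (sub (D.top P0 h0)))

lemma step (hg : Integrable g) (hg2 : Integrable (fun x => ‖g x‖ ^ 2)) (hN : Measurable N) (hE : MeasurableSet E) (hEf : volume E ≠ ⊤)
    (hG : 0 < G) (he : 0 < e) (hG2 : ∫ x, ‖g x‖ ^ 2 ≤ G ^ 2) (he2 : volume.real E ≤ e ^ 2) {j : ℤ} {S : Finset Tile} (s : St g N E (G / e) j S) :
    ∃ S' ⊆ S, St g N E (G / e) (j + 1) S' ∧ ∫ x in E, ‖∑ P ∈ S, yy g N P x‖ ≤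
      (∫ x in E, ‖∑ P ∈ S', yy g N P x‖) + C1 * e * G * (Phi j - Phi (j + 1)) := by
  have p4 : (0:ℝ) < 4 ^ (j + 1) := by positivity
  have h4 : (4:ℝ) ^ j = 2 ^ j * 2 ^ j := by rw [← mul_zpow]; norm_num
  have e2 : (2:ℝ) ^ (j + 1) = 2 ^ j * 2 := zpow_add_one₀ two_ne_zero _
  have e4 : (4:ℝ) ^ (j + 1) = 4 ^ j * 4 := zpow_add_one₀ four_ne_zero _
  have pj := p2 j
  have cT := CT_pos
  have c1 := CS1p
  obtain ⟨S1, Tp1, T1, D1, h1⟩ := MASS (μ := (4 ^ (j + 1))⁻¹) hN hE hEf s.cvx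
  obtain ⟨S2, Tp2, T2, D2, h2⟩ := SIZE (σ := (2 ^ j)⁻¹ * (G / e)) (by positivity) hg hg2 D1.cvx (fun P hP => s.A P (D1.sub hP))
  have f1 := forest hg hN hE hEf (by positivity) s subset_rfl D1
  have f2 := forest hg hN hE hEf (by positivity) s D1.sub D2
  refine ⟨S2, D2.sub.trans D1.sub, ⟨D2.cvx, fun P hP => ?_, fun P hP => ?_⟩, ?_⟩
  · have := D2.good P hP
    push Not at this
    refine this.trans (le_of_eq ?_)
    rw [e2]; field_simp; norm_num
  · rw [min_mul_of_nonneg _ _ (p2 _).le, one_mul]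
    refine le_min (dn_le _ _ _) ?_
    have := D1.good P (D2.sub hP)
    push Not at this
    exact this
  · have g1 : ∑ P ∈ Tp1, (2:ℝ) ^ P.1 ≤ 4 * (2 ^ j * 2 ^ j) * e ^ 2 := by
      rw [inv_mul_le_iff₀ p4, e4, h4] at h1
      refine h1.trans ?_
      rw [mul_comm 4]
      gcongr
    have g2 : ∑ P ∈ Tp2, (2:ℝ) ^ P.1 ≤ 4 * CS1 * (2 ^ j * 2 ^ j) * e ^ 2 := by
      have h3 := h2.trans (mul_le_mul_of_nonneg_left hG2 (by positivity : 0 ≤ 4 * CS1))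
      rw [← le_div_iff₀' (by positivity)] at h3
      refine h3.trans (le_of_eq ?_)
      field_simp
    have m0 : (0:ℝ) ≤ min 1 (4 ^ j)⁻¹ := by positivity
    calc _ ≤ (∫ x in E, ‖∑ P ∈ S2, yy g N P x‖) + (CT * ((2 ^ j)⁻¹ * (G / e)) * min 1 (4 ^ j)⁻¹ * ∑ P ∈ Tp2, (2:ℝ) ^ P.1
          + CT * ((2 ^ j)⁻¹ * (G / e)) * min 1 (4 ^ j)⁻¹ * ∑ P ∈ Tp1, (2:ℝ) ^ P.1) := by linarith
      _ ≤ (∫ x in E, ‖∑ P ∈ S2, yy g N P x‖) + (CT * ((2 ^ j)⁻¹ * (G / e)) * min 1 (4 ^ j)⁻¹ * (4 * CS1 * (2 ^ j * 2 ^ j) * e ^ 2)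
          + CT * ((2 ^ j)⁻¹ * (G / e)) * min 1 (4 ^ j)⁻¹ * (4 * (2 ^ j * 2 ^ j) * e ^ 2)) := by gcongr
      _ = (∫ x in E, ‖∑ P ∈ S2, yy g N P x‖) + C1 * e * G * (2 ^ j * min 1 (4 ^ j)⁻¹) := by
          unfold C1; field_simp; ring
      _ ≤ _ := by
          have := Phi_step j
          unfold C1
          gcongr

lemma steps (hg : Integrable g) (hg2 : Integrable (fun x => ‖g x‖ ^ 2)) (hN : Measurable N) (hE : MeasurableSet E) (hEf : volume E ≠ ⊤)
    (hG : 0 < G) (he : 0 < e) (hG2 : ∫ x, ‖g x‖ ^ 2 ≤ G ^ 2) (he2 : volume.real E ≤ e ^ 2) {j : ℤ} {S : Finset Tile} (s : St g N E (G / e) j S) (n : ℕ) :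
    ∃ S' ⊆ S, St g N E (G / e) (j + n) S' ∧ ∫ x in E, ‖∑ P ∈ S, yy g N P x‖ ≤
      (∫ x in E, ‖∑ P ∈ S', yy g N P x‖) + C1 * e * G * (Phi j - Phi (j + n)) := by
  induction n with
  | zero => exact ⟨S, subset_rfl, by simpa using s, by simp⟩
  | succ n ih =>
    obtain ⟨S1, h1, s1, b1⟩ := ih
    obtain ⟨S2, h2, s2, b2⟩ := step hg hg2 hN hE hEf hG he hG2 he2 s1
    rw [add_assoc] at s2 b2
    push_cast
    exact ⟨S2, h2.trans h1, s2, by linarith⟩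

lemma IT (hg : Integrable g) (hg2 : Integrable (fun x => ‖g x‖ ^ 2)) (hN : Measurable N) (hE : MeasurableSet E) (hEf : volume E ≠ ⊤)
    (hG : 0 < G) (he : 0 < e) (hG2 : ∫ x, ‖g x‖ ^ 2 ≤ G ^ 2) (he2 : volume.real E ≤ e ^ 2) {S : Finset Tile} (hS : Cvx S) :
    ∫ x in E, ‖∑ P ∈ S, yy g N P x‖ ≤ 3 * C1 * e * G := by
  have cT := CT_pos
  have c1 := CS1p
  have hC : 0 ≤ C1 := by unfold C1; positivity
  set M : Tile → ℝ := fun P => CB * ∫ η, ‖Gt g P.1 P.2.2 η‖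
  have M0 : ∀ P, 0 ≤ M P := fun P => mul_nonneg CBp.le (integral_nonneg fun _ => norm_nonneg _)
  obtain ⟨n, hn⟩ : ∃ n : ℕ, ∀ P ∈ S, en g S P ≤ ((2:ℝ) ^ n * (G / e)) ^ 2 * 2 ^ P.1 := by
    have : ∀ P ∈ S, ∀ᶠ n : ℕ in atTop, en g S P ≤ ((2:ℝ) ^ n * (G / e)) ^ 2 * 2 ^ P.1 := by
      intro P _
      have t : Tendsto (fun n : ℕ => ((2:ℝ) ^ n * (G / e)) ^ 2 * 2 ^ P.1) atTop atTop := by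
        refine Tendsto.atTop_mul_const (p2 _) ((tendsto_pow_atTop two_ne_zero).comp ?_)
        exact Tendsto.atTop_mul_const (by positivity) (tendsto_pow_atTop_atTop_of_one_lt (by norm_num))
      exact t.eventually_ge_atTop _
    exact ((Filter.eventually_all_finset S).2 this).exists
  have s : St g N E (G / e) (-n) S := by
    refine ⟨hS, fun P hP => ?_, fun P _ => ?_⟩
    · simpa using hn P hP
    · rw [min_eq_left, one_mul]
      · exact dn_le _ _ _
      · rw [zpow_neg, inv_inv, zpow_natCast]; exact one_le_pow₀ (by norm_num)
  have key : ∀ m : ℕ, ∫ x in E, ‖∑ P ∈ S, yy g N P x‖ ≤ (1/4) ^ m * (∑ P ∈ S, M P * 2 ^ P.1) + 3 * C1 * e * G := by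
    intro m
    obtain ⟨S', h', s', b⟩ := steps hg hg2 hN hE hEf hG he hG2 he2 s (n + m)
    have hj : -(n:ℤ) + ((n + m : ℕ) : ℤ) = m := by push_cast; ring
    rw [hj] at s' b
    have b2 : C1 * e * G * (Phi (-n) - Phi m) ≤ C1 * e * G * 3 := by
      have := Phi_nonneg m; have := Phi_le (-n) (by simp)
      gcongr; linarith
    have b3 : ∫ x in E, ‖∑ P ∈ S', yy g N P x‖ ≤ (1/4) ^ m * (∑ P ∈ S, M P * 2 ^ P.1) := by
      calc ∫ x in E, ‖∑ P ∈ S', yy g N P x‖ ≤ ∫ x in E, ∑ P ∈ S', ‖yy g N P x‖ := by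
            refine integral_mono ((integrable_finsetSum S' fun P _ => yy_int hg hN P hEf).norm) (integrable_finsetSum S' fun P _ => (yy_int hg hN P hEf).norm) fun x => ?_
            exact norm_sum_le _ _
        _ = ∑ P ∈ S', ∫ x in E, ‖yy g N P x‖ := integral_finsetSum _ fun P _ => (yy_int hg hN P hEf).norm
        _ ≤ ∑ P ∈ S', (1/4) ^ m * (M P * 2 ^ P.1) := by
            refine Finset.sum_le_sum fun P hP => ?_
            have mt := meas_tile hN P
            have : ∫ x in E, ‖yy g N P x‖ ≤ ∫ x in E, indicator {x | P = tl P.1 x (N x)} (fun _ => M P) x := by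
              have fi : IsFiniteMeasure (volume.restrict E) := ⟨by simpa using hEf.lt_top⟩
              refine integral_mono (yy_int hg hN P hEf).norm ((integrable_const _).indicator mt) fun x => ?_
              by_cases h : P = tl P.1 x (N x)
              · rw [indicator_of_mem (by exact h)]; exact yy_bd hg P x
              · rw [indicator_of_notMem (by exact h)]; simp only [yy]; rw [if_neg h, norm_zero]
            refine this.trans ?_
            rw [setIntegral_indicator mt, setIntegral_const, smul_eq_mul]
            change dn N E P * M P ≤ _
            have := s'.dn P hP
            have : dn N E P ≤ (1/4)^m * 2 ^ P.1 := this.trans (by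
              gcongr; refine (min_le_right _ _).trans (le_of_eq ?_); simp)
            calc _ ≤ ((1/4)^m * 2 ^ P.1) * M P := by gcongr; exact M0 P
              _ = _ := by ring
        _ ≤ _ := by
            rw [← Finset.mul_sum]
            gcongr
            exact fun P _ _ => mul_nonneg (M0 P) (p2 _).le
    linarith
  have t : Tendsto (fun m : ℕ => (1/4:ℝ) ^ m * (∑ P ∈ S, M P * 2 ^ P.1) + 3 * C1 * e * G) atTop (nhds (0 * (∑ P ∈ S, M P * 2 ^ P.1) + 3 * C1 * e * G)) :=
    ((tendsto_pow_atTop_nhds_zero_of_lt_one (by norm_num) (by norm_num)).mul_const _).add_const _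
  simpa using ge_of_tendsto' t key
end
end
end CF


namespace CF
noncomputable section
open Complex (I)
open scoped ComplexConjugate Classical

lemma thsum (u : ℝ) (a : ℕ) (ha : Nat.Coprime 21 a) : ∑ j ∈ Finset.range 21, thR (Int.fract (u + j * a / 21)) = 1 := by
  set l := ⌊21 * u⌋
  set s := Int.fract (21 * u) with hs
  have hu : u = (l + s) / 21 := by rw [Int.floor_add_fract]; ring
  have s0 := Int.fract_nonneg (21 * u)
  have s1 := Int.fract_lt_one (21 * u)
  rw [← hs] at s0 s1
  set F : ℤ → ℝ := fun i => thR (Int.fract ((s + i) / 21))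
  have hF : ∀ i : ℤ, F i = F (i % 21) := by
    intro i
    have : (i:ℝ) = ((i % 21 : ℤ) : ℝ) + 21 * ((i / 21 : ℤ) : ℝ) := by exact_mod_cast (Int.emod_add_mul_ediv i 21).symm
    simp only [F]
    rw [this, show (s + (((i % 21 : ℤ) : ℝ) + 21 * ((i / 21 : ℤ) : ℝ))) / 21 = (s + ((i % 21 : ℤ) : ℝ)) / 21 + ((i / 21 : ℤ) : ℝ) by ring, Int.fract_add_intCast]
  set φ : ℕ → ℕ := fun j => ((l + j * a) % 21).toNat
  have hφ : ∀ j, (φ j : ℤ) = (l + j * a) % 21 := fun j => Int.toNat_of_nonneg (Int.emod_nonneg _ (by norm_num))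
  have inj : Set.InjOn φ (Finset.range 21 : Finset ℕ) := by
    intro j hj j' hj' h
    have h2 : (l + j * a) % 21 = (l + j' * a) % 21 := by rw [← hφ, ← hφ, h]
    have h3 : (21:ℤ) ∣ ((j:ℤ) - j') * a := by
      have := Int.dvd_of_emod_eq_zero (Int.emod_eq_emod_iff_emod_sub_eq_zero.1 h2)
      rwa [add_sub_add_left_eq_sub, ← sub_mul] at this
    have h4 : (21:ℤ) ∣ (j:ℤ) - j' := IsCoprime.dvd_of_dvd_mul_right (by exact_mod_cast Nat.isCoprime_iff_coprime.2 ha) h3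
    simp at hj hj'
    omega
  have img : (Finset.range 21).image φ = Finset.range 21 := by
    refine Finset.eq_of_subset_of_card_le (fun i hi => ?_) (by rw [Finset.card_image_of_injOn inj])
    obtain ⟨j, -, rfl⟩ := Finset.mem_image.1 hi
    have := hφ j
    rw [Finset.mem_range]; omega
  calc _ = ∑ j ∈ Finset.range 21, F (φ j) := by
        refine Finset.sum_congr rfl fun j _ => ?_
        rw [hφ, ← hF]
        simp only [F]; congr 2; rw [hu]; push_cast; ring
    _ = ∑ i ∈ Finset.range 21, F i := by rw [← Finset.sum_image (f := fun i : ℕ => F i) inj, img]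
    _ = ∑ i ∈ Finset.range 21, ((fun i : ℕ => st (s + i - 26/5)) (i + 1) - (fun i : ℕ => st (s + i - 26/5)) i) := by
        refine Finset.sum_congr rfl fun i hi => ?_
        have hi : (i:ℝ) ≤ 20 := by rw [Finset.mem_range] at hi; exact_mod_cast (by omega : i ≤ 20)
        simp only [F]
        rw [Int.fract_eq_self.2 ⟨by positivity, by push_cast; linarith⟩, thR]
        push_cast; congr 2 <;> ring
    _ = 1 := by
        rw [Finset.sum_range_sub (fun i : ℕ => st (s + i - 26/5))]; push_cast
        rw [st1 (by linarith), st0 (by linarith)]; ring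

lemma psth (u v w : ℝ) : psR (v - u) * thR (u + w - ⌊v + w⌋) = psR (v - u) * thR (Int.fract (u + w)) := by
  by_cases h : psR (v - u) = 0
  · rw [h, zero_mul, zero_mul]
  congr 1
  obtain ⟨h1, h2⟩ := psR_supp h
  by_cases e : ⌊v + w⌋ = ⌊u + w⌋
  · rw [e]; rfl
  have z1 : thR (u + w - ⌊v + w⌋) = 0 := by
    by_contra hc; have := thR_supp hc
    exact e (Int.floor_eq_iff.2 ⟨by linarith, by linarith⟩).symm
  have z2 : thR (Int.fract (u + w)) = 0 := by
    by_contra hc; have := thR_supp hc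
    rw [Int.fract] at this
    exact e (Int.floor_eq_iff.2 ⟨by linarith, by linarith⟩)
  rw [z1, z2]

lemma UU_shift (g : ℝ → ℂ) (k : ℤ) (m N t x : ℝ) : UU (fun η => g (η - t)) k m (N + t) x =
    ex (x * t) * ∫ η, ((psR (2 ^ k * N - 2 ^ k * η) * thR (2 ^ k * η + 2 ^ k * t - m) : ℝ) : ℂ) * (g η * ex (x * η)) := by
  unfold UU V Gt
  rw [← integral_add_right_eq_self _ t, ← integral_const_mul]
  congr 1; ext η
  simp only [add_sub_cancel_right, ps, psn, th]
  rw [mul_add x, ex_add, show -(2 ^ k * (η + t) - 2 ^ k * (N + t)) = 2 ^ k * N - 2 ^ k * η by ring, show 2 ^ k * (η + t) - m = 2 ^ k * η + 2 ^ k * t - m by ring]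
  push_cast; ring

def aa (t : ℝ) : ℝ := st ((t - 3/10) * 50)
lemma tele (K : ℕ) (t : ℝ) : ∑ i ∈ Finset.range (2 * K + 1), psR (2 ^ ((i:ℤ) - K) * t) = aa (2 ^ K * t) - aa ((2 ^ (K + 1))⁻¹ * t) := by
  have : ∀ i : ℕ, psR (2 ^ ((i:ℤ) - K) * t) = (fun i : ℕ => aa (2 ^ ((i:ℤ) - K - 1) * t)) (i + 1) - (fun i : ℕ => aa (2 ^ ((i:ℤ) - K - 1) * t)) i := by
    intro i
    simp only [psR, aa]
    push_cast
    rw [show ((i:ℤ) + 1 - K - 1) = i - K by ring, zpow_sub_one₀ (two_ne_zero : (2:ℝ) ≠ 0) ((i:ℤ) - K)]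
    congr 3; ring
  rw [Finset.sum_congr rfl fun i _ => this i, Finset.sum_range_sub (fun i : ℕ => aa (2 ^ ((i:ℤ) - K - 1) * t))]
  congr 2
  · push_cast; rw [show (2 * (K:ℤ) + 1 - K - 1) = K by ring, zpow_natCast]
  · push_cast; rw [show (0 - (K:ℤ) - 1) = -((K+1 : ℕ) : ℤ) by push_cast; ring, zpow_neg, zpow_natCast]

lemma psR_bd (t : ℝ) : |psR t| ≤ 1 := by
  unfold psR
  rw [abs_le]
  have := smoothTransition.nonneg ((t - 3/10) * 50)
  have := smoothTransition.nonneg ((t / 2 - 3/10) * 50)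
  have := smoothTransition.le_one ((t - 3/10) * 50)
  have := smoothTransition.le_one ((t / 2 - 3/10) * 50)
  constructor <;> linarith
lemma psR_cont : Continuous psR := by
  unfold psR; exact (smoothTransition.continuous.comp (by fun_prop)).sub (smoothTransition.continuous.comp (by fun_prop))
lemma thR_cont : Continuous thR := by
  unfold thR; exact (smoothTransition.continuous.comp (by fun_prop)).sub (smoothTransition.continuous.comp (by fun_prop))
lemma thR_bd (t : ℝ) : |thR t| ≤ 1 := by
  unfold thR
  rw [abs_le]
  have := smoothTransition.nonneg (21 * (t - 1/5))
  have := smoothTransition.nonneg (21 * (t - 1/5) - 1)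
  have := smoothTransition.le_one (21 * (t - 1/5))
  have := smoothTransition.le_one (21 * (t - 1/5) - 1)
  constructor <;> linarith

lemma modelsum {g : ℝ → ℂ} (hg : Integrable g) (K : ℕ) (N x : ℝ) :
    ∑ j ∈ Finset.range 21, ex (-(x * (j * 2 ^ K / 21))) * ∑ i ∈ Finset.range (2 * K + 1),
      UU (fun η => g (η - j * 2 ^ K / 21)) ((i:ℤ) - K) (fl (-((i:ℤ) - K)) (N + j * 2 ^ K / 21)) (N + j * 2 ^ K / 21) x =
    ∫ η, ((aa (2 ^ K * (N - η)) - aa ((2 ^ (K + 1))⁻¹ * (N - η)) : ℝ) : ℂ) * (g η * ex (x * η)) := by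
  have hge : Integrable (fun η => g η * ex (x * η)) := intg_ex hg (by fun_prop)
  have hi : ∀ (k : ℤ) (c : ℝ), Integrable fun η => ((psR (2 ^ k * N - 2 ^ k * η) * thR (2 ^ k * η + c) : ℝ) : ℂ) * (g η * ex (x * η)) := by
    intro k c
    refine hge.bdd_mul (c := 1) ?_ (Eventually.of_forall fun η => ?_)
    · refine Continuous.aestronglyMeasurable (Complex.continuous_ofReal.comp ?_)
      exact (psR_cont.comp (by fun_prop)).mul (thR_cont.comp (by fun_prop))
    · rw [Complex.norm_real, norm_mul]
      exact mul_le_one₀ (psR_bd _) (norm_nonneg _) (thR_bd _)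
  simp_rw [UU_shift]
  simp_rw [← Finset.mul_sum, ← mul_assoc, ← ex_add, neg_add_cancel, ex_zero, one_mul]
  rw [Finset.sum_comm]
  have e1 : ∀ i ∈ Finset.range (2 * K + 1), ∑ j ∈ Finset.range 21, ∫ η, ((psR (2 ^ ((i:ℤ) - K) * N - 2 ^ ((i:ℤ) - K) * η) *
        thR (2 ^ ((i:ℤ) - K) * η + 2 ^ ((i:ℤ) - K) * (j * 2 ^ K / 21) - fl (-((i:ℤ) - K)) (N + j * 2 ^ K / 21)) : ℝ) : ℂ) * g η * ex (x * η) =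
      ∫ η, ((psR (2 ^ ((i:ℤ) - K) * (N - η)) : ℝ) : ℂ) * (g η * ex (x * η)) := by
    intro i _
    have e2 : (2:ℝ) ^ ((i:ℤ) - K) * 2 ^ K = 2 ^ i := by
      rw [← zpow_natCast, ← zpow_add₀ two_ne_zero, ← zpow_natCast]; congr 1; ring
    rw [← integral_finsetSum]
    · congr 1; ext η
      rw [← Finset.sum_mul, ← Finset.sum_mul, mul_assoc, ← Complex.ofReal_sum]
      congr 2
      have e3 : ∀ j : ℕ, psR (2 ^ ((i:ℤ) - K) * N - 2 ^ ((i:ℤ) - K) * η) *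
          thR (2 ^ ((i:ℤ) - K) * η + 2 ^ ((i:ℤ) - K) * (j * 2 ^ K / 21) - fl (-((i:ℤ) - K)) (N + j * 2 ^ K / 21)) =
          psR (2 ^ ((i:ℤ) - K) * (N - η)) * thR (Int.fract (2 ^ ((i:ℤ) - K) * η + j * (2 ^ i : ℕ) / 21)) := by
        intro j
        have e4 : 2 ^ ((i:ℤ) - K) * (j * 2 ^ K / 21) = (j:ℝ) * (2 ^ i : ℕ) / 21 := by push_cast; rw [← e2]; ring
        rw [mul_sub, ← e4, ← psth, fl, zpow_neg, div_inv_eq_mul]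
        congr 5; ring
      simp_rw [e3]
      rw [← Finset.mul_sum, thsum _ _ (Nat.Coprime.pow_right _ (by norm_num)), mul_one]
    · intro j _
      simpa only [mul_assoc, add_sub_assoc] using hi ((i:ℤ) - K) (2 ^ ((i:ℤ) - K) * (j * 2 ^ K / 21) - fl (-((i:ℤ) - K)) (N + j * 2 ^ K / 21))
  rw [Finset.sum_congr rfl e1, ← integral_finsetSum]
  · congr 1; ext η
    rw [← Finset.sum_mul, ← Complex.ofReal_sum, tele, mul_assoc]
  · intro i _
    refine hge.bdd_mul (c := 1) ?_ (Eventually.of_forall fun η => ?_)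
    · exact (Complex.continuous_ofReal.comp (psR_cont.comp (by fun_prop))).aestronglyMeasurable
    · rw [Complex.norm_real]; exact psR_bd _
end
end CF


namespace CF
noncomputable section
open Complex (I)
open scoped ComplexConjugate Classical

def box (K L : ℕ) : Finset Tile := Finset.Icc (-(K:ℤ)) K ×ˢ Finset.Icc (-(L:ℤ)) L ×ˢ Finset.Icc (-(L:ℤ)) L

lemma fl_box {i l L : ℤ} {x : ℝ} (hL : 0 ≤ L) (h : i ≤ l) (h1 : -L ≤ fl i x) (h2 : fl i x ≤ L) : -L ≤ fl l x ∧ fl l x ≤ L := by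
  unfold fl at *
  rw [Int.le_floor] at h1
  rw [Int.floor_le_iff] at h2
  push_cast at h1
  have hi := p2 i
  have hl := p2 l
  have hil : (2:ℝ) ^ i ≤ 2 ^ l := zpow_le_zpow_right₀ (by norm_num) h
  have hL' : (0:ℝ) ≤ L := by exact_mod_cast hL
  rw [Int.le_floor, Int.floor_le_iff]
  rw [le_div_iff₀ hi] at h1
  rw [div_lt_iff₀ hi] at h2
  rw [le_div_iff₀ hl, div_lt_iff₀ hl]
  push_cast
  constructor <;> nlinarith

lemma box_cvx (K L : ℕ) : Cvx (box K L) := by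
  intro x ξ a b c hab hbc h1 h2
  simp only [box, tl, Finset.mem_product, Finset.mem_Icc] at *
  exact ⟨by omega, fl_box (by positivity) hab h1.2.1.1 h1.2.1.2, fl_box (by positivity) (neg_le_neg hbc) h2.2.2.1 h2.2.2.2⟩

lemma fl_bd {K L : ℕ} {x : ℝ} (hx : |x| * 2 ^ K ≤ L) {k : ℤ} (hk : -(K:ℤ) ≤ k) : -(L:ℤ) ≤ fl k x ∧ fl k x ≤ L := by
  have h : |x / 2 ^ k| ≤ L := by
    refine le_trans ?_ hx
    rw [abs_div, abs_of_pos (p2 k), div_eq_mul_inv, ← zpow_neg, ← zpow_natCast]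
    gcongr
    · norm_num
    · omega
  rw [abs_le] at h
  unfold fl
  rw [Int.le_floor, Int.floor_le_iff]
  push_cast
  constructor <;> linarith

lemma yysum (g : ℝ → ℂ) (N : ℝ → ℝ) {K L : ℕ} {x : ℝ} (hx : |x| * 2 ^ K ≤ L) (hN : |N x| * 2 ^ K ≤ L) :
    ∑ P ∈ box K L, yy g N P x = ∑ i ∈ Finset.range (2 * K + 1), UU g ((i:ℤ) - K) (fl (-((i:ℤ) - K)) (N x)) (N x) x := by
  unfold yy
  have : (box K L).filter (fun P => P = tl P.1 x (N x)) = (Finset.range (2 * K + 1)).image (fun i : ℕ => tl ((i:ℤ) - K) x (N x)) := by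
    ext P
    rw [Finset.mem_filter, Finset.mem_image]
    constructor
    · rintro ⟨h1, h2⟩
      simp only [box, Finset.mem_product, Finset.mem_Icc] at h1
      refine ⟨(P.1 + K).toNat, ?_, ?_⟩
      · rw [Finset.mem_range]; omega
      · rw [Int.toNat_of_nonneg (by omega), add_sub_cancel_right, ← h2]
    · rintro ⟨i, hi, rfl⟩
      rw [Finset.mem_range] at hi
      refine ⟨?_, rfl⟩
      simp only [box, tl, Finset.mem_product, Finset.mem_Icc]
      exact ⟨by omega, fl_bd hx (by omega), fl_bd hN (by omega)⟩
  rw [← Finset.sum_filter, this, Finset.sum_image]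
  · rfl
  · intro a _ b _ h
    have := congrArg Prod.fst h
    simp only [tl] at this; omega

section
variable {g : ℝ → ℂ} {N : ℝ → ℝ} {E : Set ℝ} {G e R : ℝ}

def KK (g : ℝ → ℂ) (K : ℕ) (N x : ℝ) : ℂ := ∫ η, ((aa (2 ^ K * (N - η)) - aa ((2 ^ (K + 1))⁻¹ * (N - η)) : ℝ) : ℂ) * (g η * ex (x * η))

lemma BK (hg : Integrable g) (hg2 : Integrable (fun x => ‖g x‖ ^ 2)) (hN : Measurable N) (hE : MeasurableSet E)
    (hER : ∀ x ∈ E, |x| ≤ R) (hNR : ∀ x, |N x| ≤ R) (hEf : volume E ≠ ⊤)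
    (hG : 0 < G) (he : 0 < e) (hG2 : ∫ x, ‖g x‖ ^ 2 ≤ G ^ 2) (he2 : volume.real E ≤ e ^ 2) (K : ℕ) :
    ∫ x in E, ‖KK g K (N x) x‖ ≤ 63 * C1 * e * G := by
  obtain ⟨L, hL⟩ := exists_nat_ge ((R + 2 ^ K) * 2 ^ K)
  set t : ℕ → ℝ := fun j => j * 2 ^ K / 21
  set gj : ℕ → ℝ → ℂ := fun j η => g (η - t j)
  set Nj : ℕ → ℝ → ℝ := fun j x => N x + t j
  have hgj : ∀ j, Integrable (gj j) := fun j => hg.comp_sub_right _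
  have hNj : ∀ j, Measurable (Nj j) := fun j => hN.add_const _
  have ii : ∀ j, IntegrableOn (fun x => ‖∑ P ∈ box K L, yy (gj j) (Nj j) P x‖) E := fun j =>
    (integrable_finsetSum _ fun P _ => yy_int (hgj j) (hNj j) P hEf).norm
  have key : ∀ x ∈ E, KK g K (N x) x = ∑ j ∈ Finset.range 21, ex (-(x * t j)) * ∑ P ∈ box K L, yy (gj j) (Nj j) P x := by
    intro x hx
    rw [KK, ← modelsum hg K (N x) x]
    refine Finset.sum_congr rfl fun j hj => ?_
    have hj : (j:ℝ) ≤ 21 := by rw [Finset.mem_range] at hj; exact_mod_cast hj.le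
    have p : (0:ℝ) < 2 ^ K := by positivity
    have h1 : |t j| ≤ 2 ^ K := by
      rw [abs_of_nonneg (by positivity), div_le_iff₀ (by norm_num)]; nlinarith
    rw [yysum]
    · refine le_trans ?_ hL
      gcongr; linarith [hER x hx]
    · refine le_trans ?_ hL
      gcongr
      exact (abs_add_le _ _).trans (add_le_add (hNR x) h1)
  calc ∫ x in E, ‖KK g K (N x) x‖ = ∫ x in E, ‖∑ j ∈ Finset.range 21, ex (-(x * t j)) * ∑ P ∈ box K L, yy (gj j) (Nj j) P x‖ :=
        setIntegral_congr_fun hE fun x hx => by simp only [key x hx]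
    _ ≤ ∫ x in E, ∑ j ∈ Finset.range 21, ‖∑ P ∈ box K L, yy (gj j) (Nj j) P x‖ := by
        refine integral_mono_of_nonneg (Eventually.of_forall fun x => norm_nonneg _) (integrable_finsetSum _ fun j _ => ii j) (Eventually.of_forall fun x => ?_)
        refine (norm_sum_le _ _).trans (Finset.sum_le_sum fun j _ => ?_)
        rw [norm_mul, norm_ex, one_mul]
    _ = ∑ j ∈ Finset.range 21, ∫ x in E, ‖∑ P ∈ box K L, yy (gj j) (Nj j) P x‖ := integral_finsetSum _ fun j _ => ii j
    _ ≤ ∑ j ∈ Finset.range 21, 3 * C1 * e * G := by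
        refine Finset.sum_le_sum fun j _ => ?_
        refine IT (hgj j) (hg2.comp_sub_right (t j)) (hNj j) hE hEf hG he ?_ he2 (box_cvx K L)
        exact (integral_sub_right_eq_self (fun x => ‖g x‖ ^ 2) (t j)).trans_le hG2
    _ = _ := by rw [Finset.sum_const, Finset.card_range]; simp; ring

lemma aa_bd (a b : ℝ) : |aa a - aa b| ≤ 1 := by
  unfold aa
  rw [abs_le]
  have := smoothTransition.nonneg ((a - 3/10) * 50)
  have := smoothTransition.nonneg ((b - 3/10) * 50)
  have := smoothTransition.le_one ((a - 3/10) * 50)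
  have := smoothTransition.le_one ((b - 3/10) * 50)
  constructor <;> linarith
lemma aa_cont : Continuous aa := by unfold aa; exact smoothTransition.continuous.comp (by fun_prop)

lemma KK_le (hg : Integrable g) (K : ℕ) (n x : ℝ) : ‖KK g K n x‖ ≤ ∫ η, ‖g η‖ := by
  refine norm_integral_le_of_norm_le hg.norm (Eventually.of_forall fun η => ?_)
  rw [norm_mul, norm_mul, norm_ex, mul_one, Complex.norm_real]
  exact mul_le_of_le_one_left (norm_nonneg _) (aa_bd _ _)
lemma KK_aesm (hg : Integrable g) (K : ℕ) (n x : ℝ) : AEStronglyMeasurable (fun η => ((aa (2 ^ K * (n - η)) - aa ((2 ^ (K + 1))⁻¹ * (n - η)) : ℝ) : ℂ) * (g η * ex (x * η))) := by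
  refine AEStronglyMeasurable.mul (Continuous.aestronglyMeasurable (Complex.continuous_ofReal.comp ?_)) (intg_ex hg (by fun_prop)).aestronglyMeasurable
  exact (aa_cont.comp (by fun_prop)).sub (aa_cont.comp (by fun_prop))
lemma KK_cont (hg : Integrable g) (K : ℕ) : Continuous (fun z : ℝ × ℝ => KK g K z.1 z.2) := by
  unfold KK
  refine continuous_of_dominated (bound := fun η => ‖g η‖) (fun z => KK_aesm hg K z.1 z.2) (fun z => ?_) hg.norm ?_
  · refine Eventually.of_forall fun η => ?_
    rw [norm_mul, norm_mul, norm_ex, mul_one, Complex.norm_real]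
    exact mul_le_of_le_one_left (norm_nonneg _) (aa_bd _ _)
  · refine Eventually.of_forall fun η => ?_
    refine Continuous.mul (Complex.continuous_ofReal.comp ?_) (continuous_const.mul (cont_ex.comp (by fun_prop)))
    exact (aa_cont.comp (by fun_prop)).sub (aa_cont.comp (by fun_prop))

lemma KK_lim (hg : Integrable g) (n x : ℝ) : Tendsto (fun K => KK g K n x) atTop (nhds (∫ η in Iio n, g η * ex (x * η))) := by
  unfold KK
  rw [← integral_indicator measurableSet_Iio]
  refine tendsto_integral_of_dominated_convergence (fun η => ‖g η‖) (fun K => KK_aesm hg K n x) hg.norm (fun K => ?_) ?_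
  · refine Eventually.of_forall fun η => ?_
    rw [norm_mul, norm_mul, norm_ex, mul_one, Complex.norm_real]
    exact mul_le_of_le_one_left (norm_nonneg _) (aa_bd _ _)
  · refine Eventually.of_forall fun η => ?_
    by_cases h : η < n
    · rw [indicator_of_mem (by exact h)]
      have t1 : Tendsto (fun K : ℕ => (2:ℝ) ^ K * (n - η)) atTop atTop :=
        Tendsto.atTop_mul_const (sub_pos.2 h) (tendsto_pow_atTop_atTop_of_one_lt (by norm_num))
      have t2 : Tendsto (fun K : ℕ => ((2:ℝ) ^ (K + 1))⁻¹ * (n - η)) atTop (nhds (0 * (n - η))) :=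
        ((tendsto_inv_atTop_zero.comp ((tendsto_pow_atTop_atTop_of_one_lt (by norm_num)).comp (tendsto_add_atTop_nat 1)))).mul_const _
      rw [zero_mul] at t2
      refine tendsto_const_nhds.congr' ?_
      filter_upwards [t1.eventually_ge_atTop 1, t2.eventually_lt_const (show (0:ℝ) < 3/10 by norm_num)] with K h1 h2
      rw [aa, aa, st1 (by linarith), st0 (by linarith)]
      simp
    · rw [indicator_of_notMem (by exact h)]
      refine tendsto_const_nhds.congr fun K => ?_
      rw [not_lt] at h
      have h1 : (2:ℝ) ^ K * (n - η) ≤ 0 := mul_nonpos_of_nonneg_of_nonpos (by positivity) (by linarith)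
      have h2 : ((2:ℝ) ^ (K + 1))⁻¹ * (n - η) ≤ 0 := mul_nonpos_of_nonneg_of_nonpos (by positivity) (by linarith)
      rw [aa, aa, st0 (by linarith), st0 (by linarith)]
      simp

lemma BD (hg : Integrable g) (hg2 : Integrable (fun x => ‖g x‖ ^ 2)) (hN : Measurable N) (hE : MeasurableSet E)
    (hER : ∀ x ∈ E, |x| ≤ R) (hNR : ∀ x, |N x| ≤ R) (hEf : volume E ≠ ⊤)
    (hG : 0 < G) (he : 0 < e) (hG2 : ∫ x, ‖g x‖ ^ 2 ≤ G ^ 2) (he2 : volume.real E ≤ e ^ 2) :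
    IntegrableOn (fun x => ‖∫ η in Iio (N x), g η * ex (x * η)‖) E ∧ ∫ x in E, ‖∫ η in Iio (N x), g η * ex (x * η)‖ ≤ 63 * C1 * e * G := by
  have fi : IsFiniteMeasure (volume.restrict E) := ⟨by simpa using hEf.lt_top⟩
  have me : ∀ K, Measurable (fun x => KK g K (N x) x) := fun K => by
    have h1 := (KK_cont hg K).measurable
    have h0 : Measurable (fun x => (N x, x)) := hN.prodMk measurable_id
    have h2 := Measurable.comp h1 h0
    simp only [Function.comp_def] at h2
    exact h2
  have lim : ∀ x, Tendsto (fun K => KK g K (N x) x) atTop (nhds (∫ η in Iio (N x), g η * ex (x * η))) := fun x => KK_lim hg _ _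
  have ml : Measurable fun x => ∫ η in Iio (N x), g η * ex (x * η) := measurable_of_tendsto_metrizable me (tendsto_pi_nhds.2 lim)
  constructor
  · refine IntegrableOn.of_bound hEf.lt_top ml.norm.aestronglyMeasurable (∫ η, ‖g η‖) (Eventually.of_forall fun x => ?_)
    rw [norm_norm]
    exact le_of_tendsto' (lim x).norm fun K => KK_le hg _ _ _
  · refine le_of_tendsto' (tendsto_integral_of_dominated_convergence (fun _ => ∫ η, ‖g η‖) (fun K => (me K).norm.aestronglyMeasurable) (integrable_const _)
      (fun K => Eventually.of_forall fun x => ?_) (Eventually.of_forall fun x => (lim x).norm)) (fun K => BK hg hg2 hN hE hER hNR hEf hG he hG2 he2 K)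
    rw [norm_norm]; exact KK_le hg _ _ _
end
end
end CF


namespace CF
noncomputable section
open Complex (I)
open scoped ComplexConjugate Classical

section
variable {f : ℝ → ℂ}

lemma f_loc (hf : Measurable f) (h2 : Integrable (fun x => ‖f x‖ ^ 2)) (a b : ℝ) : IntegrableOn f (Ioc a b) := by
  have c : IntegrableOn (fun _ : ℝ => (1:ℝ)) (Ioc a b) := integrableOn_const (by simp)
  have i : IntegrableOn (fun x => 1 + ‖f x‖ ^ 2) (Ioc a b) := c.add h2.integrableOn
  refine Integrable.mono' i hf.aestronglyMeasurable (Eventually.of_forall fun x => ?_)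
  nlinarith [sq_nonneg (‖f x‖ - 1)]

def Q (f : ℝ → ℂ) (a b x : ℝ) : ℂ := ∫ η in Ioc a b, f η * ex (x * η)

lemma Q_cont (hf : Measurable f) (h2 : Integrable (fun x => ‖f x‖ ^ 2)) (a b : ℝ) : Continuous (Q f a b) := cont_V (f_loc hf h2 a b)

/-- weak type bound, finite stage -/
lemma W1 (hf : Measurable f) (h2 : Integrable (fun x => ‖f x‖ ^ 2)) {a ε G : ℝ} (hε : 0 < ε) (hG : 0 < G)
    (hG2 : ∫ x in Ioi a, ‖f x‖ ^ 2 ≤ G ^ 2) (q : ℕ → ℝ) (n : ℕ) :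
    volume {x : ℝ | |x| ≤ n ∧ ∃ i ≤ n, a ≤ q i ∧ q i ≤ n ∧ ε < ‖Q f a (q i) x‖} ≤ ENNReal.ofReal ((63 * C1 * G / ε) ^ 2) := by
  set p : ℝ → ℕ → Prop := fun x i => (a ≤ q i ∧ q i ≤ n ∧ ε < ‖Q f a (q i) x‖) with hp
  set E : Set ℝ := {x : ℝ | |x| ≤ n ∧ ∃ i ≤ n, p x i} with hEd
  have mp : ∀ i, MeasurableSet {x | p x i} := by
    intro i
    have m1 : MeasurableSet {x | ε < ‖Q f a (q i) x‖} := measurableSet_lt measurable_const (Q_cont hf h2 _ _).norm.measurable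
    exact (MeasurableSet.const _).inter ((MeasurableSet.const _).inter m1)
  have hE : MeasurableSet E := by
    have : E = {x : ℝ | |x| ≤ (n:ℝ)} ∩ ⋃ i ∈ Finset.range (n + 1), {x | p x i} := by
      ext x; simp [hEd]
    rw [this]
    exact (measurableSet_le measurable_norm measurable_const).inter (Finset.measurableSet_biUnion _ fun i _ => mp i)
  have hEf : volume E ≠ ⊤ := by
    refine ((measure_mono (t := Icc (-(n:ℝ)) n) fun x hx => abs_le.1 hx.1).trans_lt ?_).ne
    simp
  have ex1 : ∀ x, ∃ i, p x i ∨ i = n + 1 := fun x => ⟨n + 1, Or.inr rfl⟩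
  set F : ℝ → ℕ := fun x => Nat.find (ex1 x) with hF
  have mF : Measurable F := measurable_find ex1 fun k => (mp k).union (MeasurableSet.const _)
  have Fle : ∀ x, F x ≤ n + 1 := fun x => Nat.find_min' (ex1 x) (Or.inr rfl)
  set N : ℝ → ℝ := fun x => q (F x)
  have hN : Measurable N := (measurable_from_nat (f := q)).comp mF
  set R : ℝ := n + ∑ i ∈ Finset.range (n + 2), |q i|
  have hNR : ∀ x, |N x| ≤ R := fun x => by
    have : |q (F x)| ≤ ∑ i ∈ Finset.range (n + 2), |q i| :=
      Finset.single_le_sum (f := fun i => |q i|) (fun i _ => abs_nonneg _) (Finset.mem_range.2 (by have := Fle x; omega))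
    have : (0:ℝ) ≤ n := by positivity
    simp only [R, N]; linarith
  have hER : ∀ x ∈ E, |x| ≤ R := fun x hx => by
    have : 0 ≤ ∑ i ∈ Finset.range (n + 2), |q i| := Finset.sum_nonneg fun i _ => abs_nonneg _
    simp only [R]; linarith [hx.1]
  set g : ℝ → ℂ := indicator (Ioc a n) f with hgd
  have hg : Integrable g := (f_loc hf h2 a n).integrable_indicator measurableSet_Ioc
  have gsq : (fun x => ‖g x‖ ^ 2) = indicator (Ioc a n) (fun x => ‖f x‖ ^ 2) := by
    ext x; by_cases h : x ∈ Ioc a n <;> simp [hgd, h]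
  have hg2 : Integrable (fun x => ‖g x‖ ^ 2) := by rw [gsq]; exact h2.indicator measurableSet_Ioc
  have hgG : ∫ x, ‖g x‖ ^ 2 ≤ G ^ 2 := by
    rw [gsq, integral_indicator measurableSet_Ioc]
    refine le_trans (setIntegral_mono_set h2.integrableOn (Eventually.of_forall fun x => by positivity) ?_) hG2
    exact Ioc_subset_Ioi_self.eventuallyLE
  rcases eq_or_ne (volume E) 0 with h0 | h0
  · rw [h0]; exact zero_le
  have v : 0 < volume.real E := ENNReal.toReal_pos h0 hEf
  obtain ⟨bi, bd⟩ := BD hg hg2 hN hE hER hNR hEf hG (Real.sqrt_pos.2 v) hgG (Real.sq_sqrt v.le).ge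
  have low : ∀ x ∈ E, ε ≤ ‖∫ η in Iio (N x), g η * ex (x * η)‖ := by
    rintro x ⟨-, i, hi, hpi⟩
    have h1 : F x ≤ i := Nat.find_min' (ex1 x) (Or.inl hpi)
    have h3 : p x (F x) := (Nat.find_spec (ex1 x)).resolve_right (by simp only [hF] at h1; omega)
    obtain ⟨c1, c2, c3⟩ := h3
    have : ∫ η in Iio (N x), g η * ex (x * η) = Q f a (q (F x)) x := by
      rw [Q, ← integral_Iic_eq_integral_Iio, ← integral_indicator measurableSet_Iic, ← integral_indicator measurableSet_Ioc]
      congr 1; ext η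
      simp only [indicator, hgd, N, mem_Iic, mem_Ioc]
      by_cases e1 : η ≤ q (F x) <;> by_cases e2 : a < η
      · simp [e1, e2, e1.trans c2]
      · simp [e2]
      · simp [e1]
      · simp [e1]
    rw [this]; exact c3.le
  have fin := (setIntegral_mono_on (integrableOn_const hEf) bi hE low).trans bd
  rw [setIntegral_const, smul_eq_mul] at fin
  have s2 := Real.sq_sqrt v.le
  have sp := Real.sqrt_pos.2 v
  have h3 : √(volume.real E) ≤ 63 * C1 * G / ε := by
    rw [le_div_iff₀ hε]
    refine le_of_mul_le_mul_left ?_ sp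
    calc √(volume.real E) * (√(volume.real E) * ε) = √(volume.real E) ^ 2 * ε := by ring
      _ ≤ _ := by rw [s2]; linarith
  rw [← ENNReal.ofReal_toReal hEf]
  refine ENNReal.ofReal_le_ofReal ?_
  change volume.real E ≤ _
  rw [← s2]
  gcongr

lemma W2 (hf : Measurable f) (h2 : Integrable (fun x => ‖f x‖ ^ 2)) {a ε G : ℝ} (hε : 0 < ε) (hG : 0 < G)
    (hG2 : ∫ x in Ioi a, ‖f x‖ ^ 2 ≤ G ^ 2) :
    volume {x | ∃ r : ℚ, a ≤ r ∧ ε < ‖Q f a r x‖} ≤ ENNReal.ofReal ((63 * C1 * G / ε) ^ 2) := by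
  obtain ⟨q, hq⟩ := exists_surjective_nat ℚ
  set B : ℕ → Set ℝ := fun n => {x : ℝ | |x| ≤ n ∧ ∃ i ≤ n, a ≤ ((q i : ℚ) : ℝ) ∧ ((q i : ℚ) : ℝ) ≤ n ∧ ε < ‖Q f a (q i) x‖}
  have mono : Monotone B := by
    rintro m n h x ⟨h1, i, h2, h3, h4, h5⟩
    have : (m:ℝ) ≤ n := by exact_mod_cast h
    exact ⟨h1.trans this, i, h2.trans h, h3, h4.trans this, h5⟩
  refine (measure_mono (t := ⋃ n, B n) ?_).trans ?_
  · rintro x ⟨r, h1, h3⟩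
    obtain ⟨i, rfl⟩ := hq r
    obtain ⟨n, hn⟩ := exists_nat_ge (|x| + i + |((q i : ℚ) : ℝ)|)
    have a1 := abs_nonneg x; have a2 := abs_nonneg ((q i : ℚ) : ℝ); have a3 := le_abs_self ((q i : ℚ) : ℝ)
    have a4 : (0:ℝ) ≤ i := by positivity
    refine mem_iUnion.2 ⟨n, by linarith, i, ?_, h1, by linarith, h3⟩
    have : (i:ℝ) ≤ n := by linarith
    exact_mod_cast this
  · rw [mono.measure_iUnion]
    exact iSup_le fun n => W1 hf h2 hε hG hG2 (fun i => q i) n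

lemma AE (hf : Measurable f) (h2 : Integrable (fun x => ‖f x‖ ^ 2)) :
    ∀ᵐ x : ℝ, ∃ l, Tendsto (fun N : ℝ => ∫ η in (0:ℝ)..N, f η * ex (x * η)) atTop (nhds l) := by
  have tail : Tendsto (fun n : ℕ => ∫ x in Ioi (n:ℝ), ‖f x‖ ^ 2) atTop (nhds 0) := by
    have := tendsto_setIntegral_of_antitone (μ := volume) (f := fun x => ‖f x‖ ^ 2) (s := fun n : ℕ => Ioi (n:ℝ)) (fun n => measurableSet_Ioi)
      (fun m n h => Ioi_subset_Ioi (by exact_mod_cast h)) ⟨0, h2.integrableOn⟩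
    have e : ⋂ n : ℕ, Ioi (n:ℝ) = ∅ := by
      ext x; simp only [mem_iInter, mem_Ioi, mem_empty_iff_false, iff_false, not_forall, not_lt]; exact exists_nat_ge x
    rwa [e, setIntegral_empty] at this
  have main : ∀ ε > 0, ∀ᵐ x : ℝ, ∃ n : ℕ, ∀ r : ℚ, (n:ℝ) ≤ r → ‖Q f n r x‖ ≤ ε := by
    intro ε hε
    rw [ae_iff]
    refine le_antisymm (ENNReal.le_of_forall_pos_le_add fun δ hδ _ => ?_) (zero_le)
    rw [zero_add]
    obtain ⟨G, hG, hGδ⟩ : ∃ G > 0, (63 * C1 * G / ε) ^ 2 ≤ (δ:ℝ) := by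
      have t : Tendsto (fun G => (63 * C1 * G / ε) ^ 2) (nhdsWithin 0 (Ioi 0)) (nhds ((63 * C1 * 0 / ε) ^ 2)) :=
        (Continuous.tendsto (by fun_prop) 0).mono_left nhdsWithin_le_nhds
      have h3 := t.eventually_le_const (u := (δ:ℝ)) (by simpa using hδ)
      obtain ⟨G, h4, h5⟩ := (h3.and self_mem_nhdsWithin).exists
      exact ⟨G, h5, h4⟩
    obtain ⟨n, hn⟩ := (tail.eventually_le_const (show 0 < G ^ 2 by positivity)).exists
    calc _ ≤ volume {x | ∃ r : ℚ, (n:ℝ) ≤ r ∧ ε < ‖Q f n r x‖} := by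
          refine measure_mono fun x hx => ?_
          simp only [mem_ofPred_eq, not_exists, not_forall, not_le] at hx ⊢
          obtain ⟨r, h1, h3⟩ := hx n
          exact ⟨r, h1, h3⟩
      _ ≤ ENNReal.ofReal ((63 * C1 * G / ε) ^ 2) := W2 hf h2 hε hG hn
      _ ≤ δ := by rw [← ENNReal.ofReal_coe_nnreal]; exact ENNReal.ofReal_le_ofReal hGδ
  have all := ae_all_iff.2 fun m : ℕ => main (1 / (m + 1)) (by positivity)
  filter_upwards [all] with x hx
  have ii : ∀ a b, IntervalIntegrable (fun η => f η * ex (x * η)) volume a b := fun a b => by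
    have : ∀ a b, IntegrableOn (fun η => f η * ex (x * η)) (Ioc a b) := fun a b => intg_ex (f_loc hf h2 a b) (by fun_prop)
    exact ⟨this a b, this b a⟩
  refine cauchy_map_iff_exists_tendsto.1 ?_
  rw [Metric.cauchy_iff]
  refine ⟨inferInstance, fun ε hε => ?_⟩
  obtain ⟨m, hm⟩ := exists_nat_one_div_lt (show 0 < ε / 2 by positivity)
  obtain ⟨n, hn⟩ := hx m
  have hr : ∀ N : ℝ, (n:ℝ) < N → ‖∫ η in (n:ℝ)..N, f η * ex (x * η)‖ ≤ 1 / (m + 1) := by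
    intro N hN
    have c : Continuous (fun N => ‖∫ η in (n:ℝ)..N, f η * ex (x * η)‖) := (intervalIntegral.continuous_primitive ii _).norm
    by_contra hc
    push Not at hc
    have o : IsOpen {N : ℝ | (n:ℝ) < N ∧ 1 / ((m:ℝ) + 1) < ‖∫ η in (n:ℝ)..N, f η * ex (x * η)‖} :=
      (isOpen_lt continuous_const continuous_id).inter (isOpen_lt continuous_const c)
    obtain ⟨r, hr⟩ := Rat.denseRange_cast.exists_mem_open o ⟨N, hN, hc⟩
    have := hn r hr.1.le
    rw [Q, ← intervalIntegral.integral_of_le hr.1.le] at this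
    exact absurd hr.2 (not_lt.2 this)
  refine ⟨(fun N : ℝ => ∫ η in (0:ℝ)..N, f η * ex (x * η)) '' Ioi (n:ℝ), image_mem_map (Ioi_mem_atTop _), ?_⟩
  rintro _ ⟨N, hN, rfl⟩ _ ⟨M, hM, rfl⟩
  have e : ∀ N, ∫ η in (0:ℝ)..N, f η * ex (x * η) = (∫ η in (0:ℝ)..n, f η * ex (x * η)) + ∫ η in (n:ℝ)..N, f η * ex (x * η) := fun N =>
    (intervalIntegral.integral_add_adjacent_intervals (ii _ _) (ii _ _)).symm
  simp only
  rw [e N, e M, dist_add_left, dist_eq_norm]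
  refine (norm_sub_le _ _).trans_lt ?_
  linarith [hr N hN, hr M hM]

lemma ae_scale {p : ℝ → Prop} (h : ∀ᵐ x : ℝ, p x) {c : ℝ} (hc : c ≠ 0) : ∀ᵐ k : ℝ, p (k * c) := by
  rw [ae_iff] at h ⊢
  have := Real.volume_preimage_mul_right hc {x | ¬ p x}
  rw [h, mul_zero] at this
  exact this
end
end
end CF

theorem carleson_fourier_integral
    (g : ℝ → ℂ) (hmeas : Measurable g)
    (hL2 : Integrable (fun x => ‖g x‖ ^ 2)) :
    ∀ᵐ k : ℝ, ∃ l : ℂ,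
      Tendsto (fun N : ℝ => ∫ x in (-N)..N, g x * Complex.exp (Complex.I * k * x))
        atTop (nhds l) := by
  have h1 := CF.ae_scale (CF.AE hmeas hL2) (c := (2 * π)⁻¹) (by positivity)
  have h2 := CF.ae_scale (CF.AE (hmeas.comp measurable_neg) hL2.comp_neg) (c := -(2 * π)⁻¹) (by rw [neg_ne_zero]; positivity)
  filter_upwards [h1, h2] with k ⟨l1, t1⟩ ⟨l2, t2⟩
  refine ⟨l2 + l1, (t2.add t1).congr fun N => ?_⟩
  have ee : ∀ η : ℝ, CF.ex (k * (2 * π)⁻¹ * η) = Complex.exp (Complex.I * k * η) := by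
    intro η
    have hp : (π:ℂ) ≠ 0 := by exact_mod_cast Real.pi_ne_zero
    rw [CF.ex]; congr 1; push_cast; field_simp
  have ii : ∀ a b, IntervalIntegrable (fun η => g η * CF.ex (k * (2 * π)⁻¹ * η)) volume a b := fun a b => by
    have : ∀ a b, IntegrableOn (fun η => g η * CF.ex (k * (2 * π)⁻¹ * η)) (Ioc a b) := fun a b => CF.intg_ex (CF.f_loc hmeas hL2 a b) (by fun_prop)
    exact ⟨this a b, this b a⟩
  simp_rw [← ee]
  rw [← intervalIntegral.integral_add_adjacent_intervals (ii (-N) 0) (ii 0 N)]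
  congr 1
  have := intervalIntegral.integral_comp_neg (a := 0) (b := N) (fun η => g η * CF.ex (k * (2 * π)⁻¹ * η))
  rw [neg_zero] at this
  rw [← this]
  congr 1; ext η
  simp only [Function.comp]
  congr 2; ring
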